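/- Let (x_*,u_*) be a local minimum of radius R(·) for problem (P'_DAE) with dynamics Eẋ(t)=g(x(t),u(t)), where E is an m×n_x matrix of full row rank and g is strictly differentiable. Suppose there exists δ>0 with R(t)≥δ and that C_φ^{ε,R} (for φ(x,u,v)=Ev−g(x,u), K_φ={0}) is compact. Then (no further constraint qualification needed, since full row rank of E implies NNAMCQ) there exist an arc p, λ₀∈{0,1}, and a measurable function μ:[t₀,t₁]→ℝ^{n_u} with μ(t)∈N^C_U(u_*(t)) a.e., satisfying: (λ₀,p(t))≠0 for all t; (p(t₀),−p(t₁))∈λ₀∂f(x_*(t₀),x_*(t₁))+N_S(x_*(t₀),x_*(t₁)); the Euler adjoint equations for a.e. t: ṗ(t)=−∇_x g(x_*(t),u_*(t))^T(EE^T)^{−1}Ep(t) and μ(t)=∇_u g(x_*(t),u_*(t))^T(EE^T)^{−1}Ep(t); and the Weierstrass condition: for a.e. t, u∈U, Ev=g(x_*(t),u), |(u,v)−(u_*(t),ẋ_*(t))|<R(t) imply ⟨p(t),v−ẋ_*(t)⟩≤0. In the free end point case λ₀ can be taken as 1. -/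

import Mathlib

open Filter Topology Set MeasureTheory
open scoped RealInnerProductSpace ENNReal NNReal

noncomputable section

abbrev Euc (n : ℕ) : Type := EuclideanSpace ℝ (Fin n)

abbrev PL2 (α β : Type) : Type := WithLp 2 (α × β)

abbrev PL3 (α β γ : Type) : Type := PL2 α (PL2 β γ)

def pl2 {α β : Type} (a : α) (b : β) : PL2 α β := (WithLp.equiv 2 (α × β)).symm (a, b)

def pl2fst {α β : Type} (z : PL2 α β) : α := (WithLp.equiv 2 (α × β) z).1

def pl2snd {α β : Type} (z : PL2 α β) : β := (WithLp.equiv 2 (α × β) z).2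

def pl3 {α β γ : Type} (a : α) (b : β) (c : γ) : PL3 α β γ := pl2 a (pl2 b c)

section Variational

variable {E : Type} [NormedAddCommGroup E] [InnerProductSpace ℝ E]

/-- Fréchet normal cone. -/
def frechetNC (C : Set E) (x : E) : Set E :=
  {v | ∀ ε > 0, ∃ δ > 0, ∀ y ∈ C, ‖y - x‖ < δ → ⟪v, y - x⟫ ≤ ε * ‖y - x‖}

/-- Limiting (Mordukhovich) normal cone. -/
def limitingNC (C : Set E) (x : E) : Set E :=
  {v | ∃ xs vs : ℕ → E, (∀ n, xs n ∈ C ∧ vs n ∈ frechetNC C (xs n)) ∧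
      Tendsto xs atTop (𝓝 x) ∧ Tendsto vs atTop (𝓝 v)}

/-- Clarke normal cone: closed convex hull of the limiting normal cone. -/
def clarkeNC (C : Set E) (x : E) : Set E := closure (convexHull ℝ (limitingNC C x))

def NormallyRegular (C : Set E) : Prop := ∀ x ∈ C, frechetNC C x = limitingNC C x

/-- Proximal subdifferential of a real-valued function. -/
def proxSubdiff (g : E → ℝ) (x : E) : Set E :=
  {ζ | ∃ σ > 0, ∃ δ > 0, ∀ y, ‖y - x‖ < δ →
    g x + ⟪ζ, y - x⟫ - σ * ‖y - x‖ ^ 2 ≤ g y}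

/-- Limiting (Mordukhovich) subdifferential. -/
def limSubdiff (g : E → ℝ) (x : E) : Set E :=
  {ζ | ∃ xs ζs : ℕ → E, (∀ n, ζs n ∈ proxSubdiff g (xs n)) ∧
      Tendsto xs atTop (𝓝 x) ∧ Tendsto (fun n => g (xs n)) atTop (𝓝 (g x)) ∧
      Tendsto ζs atTop (𝓝 ζ)}

/-- Clarke generalized gradient: convex hull of the limiting subdifferential. -/
def clarkeSubdiff (g : E → ℝ) (x : E) : Set E := convexHull ℝ (limSubdiff g x)

/-- Tangent (contingent) cone. -/
def tangentC (C : Set E) (x : E) : Set E :=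
  {w | ∃ (t : ℕ → ℝ) (ws : ℕ → E), (∀ n, 0 < t n ∧ x + t n • ws n ∈ C) ∧
      Tendsto t atTop (𝓝 0) ∧ Tendsto ws atTop (𝓝 w)}

/-- Directional limiting normal cone in direction `w`. -/
def dirLimitingNC (C : Set E) (x : E) (w : E) : Set E :=
  {v | ∃ (t : ℕ → ℝ) (ws vs : ℕ → E),
      (∀ n, 0 < t n ∧ vs n ∈ frechetNC C (x + t n • ws n)) ∧
      Tendsto t atTop (𝓝 0) ∧ Tendsto ws atTop (𝓝 w) ∧ Tendsto vs atTop (𝓝 v)}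

end Variational

section Maps

variable {F G : Type} [NormedAddCommGroup F] [NormedAddCommGroup G]

/-- Calmness of a set-valued map at a point of its graph (neighborhood-ball form). -/
def Calm (Ψ : F → Set G) (x₀ : F) (y₀ : G) : Prop :=
  ∃ μ : ℝ, 0 ≤ μ ∧ ∃ Ux ∈ 𝓝 x₀, ∃ Vy ∈ 𝓝 y₀,
    ∀ x ∈ Ux, ∀ y ∈ Ψ x ∩ Vy, ∃ z ∈ Ψ x₀, ‖y - z‖ ≤ μ * ‖x - x₀‖

/-- Upper Lipschitz continuity at a point. -/
def UpperLipschitzAt (Ψ : F → Set G) (x₀ : F) : Prop :=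
  ∃ μ : ℝ, 0 ≤ μ ∧ ∃ Ux ∈ 𝓝 x₀,
    ∀ x ∈ Ux, ∀ y ∈ Ψ x, ∃ z ∈ Ψ x₀, ‖y - z‖ ≤ μ * ‖x - x₀‖

end Maps

/-- An absolutely continuous arc on `[t0,t1]` with values in `ℝ^n`,
recorded together with its a.e. derivative. -/
structure Arc (n : ℕ) (t0 t1 : ℝ) where
  f : ℝ → Euc n
  d : ℝ → Euc n
  intble : IntervalIntegrable d volume t0 t1
  rel : ∀ t ∈ Set.Icc t0 t1, f t = f t0 + ∫ s in t0..t, d s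


namespace ProblemPDAE

variable {nx nu m : ℕ} {t0 t1 : ℝ}

/-- Matrix–vector multiplication on Euclidean spaces. -/
def mV (A : Matrix (Fin m) (Fin nx) ℝ) (x : Euc nx) : Euc m :=
  (EuclideanSpace.equiv (Fin m) ℝ).symm (A.mulVec (EuclideanSpace.equiv (Fin nx) ℝ x))

/-- Admissible pairs of problem (P'_DAE): `E ẋ(t) = g(x(t),u(t))` a.e.,
`u(t) ∈ U` a.e., `(x(t₀),x(t₁)) ∈ S`. -/
def Admissible (E : Matrix (Fin m) (Fin nx) ℝ) (g : PL2 (Euc nx) (Euc nu) → Euc m)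
    (Uset : Set (Euc nu)) (S : Set (PL2 (Euc nx) (Euc nx)))
    (x : Arc nx t0 t1) (u : ℝ → Euc nu) : Prop :=
  Measurable u ∧
  (∀ᵐ t ∂(volume.restrict (Set.Icc t0 t1)),
    mV E (x.d t) = g (pl2 (x.f t) (u t)) ∧ u t ∈ Uset) ∧
  pl2 (x.f t0) (x.f t1) ∈ S

/-- `(x_*,u_*)` is a local minimum of radius `R(·)` for (P'_DAE). -/
def IsLocalMinOfRadius (E : Matrix (Fin m) (Fin nx) ℝ)
    (g : PL2 (Euc nx) (Euc nu) → Euc m) (f : PL2 (Euc nx) (Euc nx) → ℝ)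
    (Uset : Set (Euc nu)) (S : Set (PL2 (Euc nx) (Euc nx)))
    (ε : ℝ) (R : ℝ → ℝ≥0∞) (xs : Arc nx t0 t1) (us : ℝ → Euc nu) : Prop :=
  Admissible E g Uset S xs us ∧
  ∀ (x : Arc nx t0 t1) (u : ℝ → Euc nu), Admissible E g Uset S x u →
    (∀ᵐ t ∂(volume.restrict (Set.Icc t0 t1)),
      ‖x.f t - xs.f t‖ ≤ ε ∧
      (‖pl2 (u t - us t) (x.d t - xs.d t)‖₊ : ℝ≥0∞) ≤ R t) →
    (∫ t in t0..t1, ‖x.d t - xs.d t‖) ≤ ε →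
    f (pl2 (xs.f t0) (xs.f t1)) ≤ f (pl2 (x.f t0) (x.f t1))

/-- The set `C_φ^{ε,R}` for `φ(x,u,v) = Ev − g(x,u)` and `K_φ = {0}`. -/
def Cset (E : Matrix (Fin m) (Fin nx) ℝ) (g : PL2 (Euc nx) (Euc nu) → Euc m)
    (Uset : Set (Euc nu)) (ε : ℝ) (R : ℝ → ℝ≥0∞)
    (xs : Arc nx t0 t1) (us : ℝ → Euc nu) : Set (ℝ × Euc nx × Euc nu × Euc nx) :=
  closure {q : ℝ × Euc nx × Euc nu × Euc nx | q.1 ∈ Set.Icc t0 t1 ∧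
    q.2.2.1 ∈ Uset ∧ mV E q.2.2.2 = g (pl2 q.2.1 q.2.2.1) ∧
    ‖q.2.1 - xs.f q.1‖ ≤ ε ∧
    (‖pl2 (q.2.2.1 - us q.1) (q.2.2.2 - xs.d q.1)‖₊ : ℝ≥0∞) ≤ R q.1}

/-- The perturbed constraint map `M_φ(Θ) = {(x,u,v) : Ev − g(x,u) + Θ = 0, u ∈ U}`. -/
def Mmap (E : Matrix (Fin m) (Fin nx) ℝ) (g : PL2 (Euc nx) (Euc nu) → Euc m)
    (Uset : Set (Euc nu)) : Euc m → Set (PL3 (Euc nx) (Euc nu) (Euc nx)) :=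
  fun Θ => {z | pl2fst (pl2snd z) ∈ Uset ∧
    mV E (pl2snd (pl2snd z)) - g (pl2 (pl2fst z) (pl2fst (pl2snd z))) + Θ = 0}

end ProblemPDAE

/-- Ekeland's variational principle for a continuous nonnegative function. -/
theorem ekeland {X : Type*} [MetricSpace X] [CompleteSpace X] {φ : X → ℝ} (hφ : Continuous φ)
    (h0 : ∀ x, 0 ≤ φ x) (x₀ : X) {κ : ℝ} (hκ : 0 < κ) :
    ∃ x, φ x + κ * dist x x₀ ≤ φ x₀ ∧ ∀ y, φ x ≤ φ y + κ * dist y x := by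
  let T : X → Set X := fun x => {y | φ y + κ * dist y x ≤ φ x}
  have hself : ∀ x, x ∈ T x := fun x => by simp [T]
  have htrans : ∀ {x y z}, y ∈ T x → z ∈ T y → z ∈ T x := by
    intro x y z hy hz
    have h1 : φ y + κ * dist y x ≤ φ x := hy
    have h2 : φ z + κ * dist z y ≤ φ y := hz
    have h3 := mul_le_mul_of_nonneg_left (dist_triangle z y x) hκ.le
    change φ z + κ * dist z x ≤ φ x
    linarith
  have hclosed : ∀ x, IsClosed (T x) := fun x =>
    isClosed_le (hφ.add (continuous_const.mul (continuous_id.dist continuous_const)))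
      continuous_const
  have hstep : ∀ x (n : ℕ), ∃ y ∈ T x, ∀ z ∈ T x, φ y ≤ φ z + (1 / 2 : ℝ) ^ n := by
    intro x n
    have hne : (φ '' T x).Nonempty := ⟨φ x, x, hself x, rfl⟩
    have hbdd : BddBelow (φ '' T x) := ⟨0, by rintro _ ⟨z, -, rfl⟩; exact h0 z⟩
    obtain ⟨_, ⟨y, hy, rfl⟩, hlt⟩ := Real.lt_sInf_add_pos hne (ε := (1 / 2 : ℝ) ^ n) (by positivity)
    refine ⟨y, hy, fun z hz => ?_⟩
    have := csInf_le hbdd ⟨z, hz, rfl⟩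
    linarith
  choose next hnext hmin using hstep
  let s : ℕ → X := fun n => Nat.rec x₀ (fun k x => next x k) n
  have hs : ∀ n, s (n + 1) = next (s n) n := fun n => rfl
  have hs1 : ∀ n, s (n + 1) ∈ T (s n) := fun n => hs n ▸ hnext _ _
  have hmem : ∀ n m, n ≤ m → s m ∈ T (s n) := by
    intro n m hnm
    induction m, hnm using Nat.le_induction with
    | base => exact hself _
    | succ m _ ih => exact htrans ih (hs1 m)
  have hclose : ∀ n, ∀ z ∈ T (s (n + 1)), κ * dist z (s (n + 1)) ≤ (1 / 2 : ℝ) ^ n := by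
    intro n z hz
    have h1 := hmin (s n) n z (htrans (hs1 n) hz)
    rw [← hs n] at h1
    have h2 : φ z + κ * dist z (s (n + 1)) ≤ φ (s (n + 1)) := hz
    linarith
  have hlim0 : Tendsto (fun n : ℕ => (1 / 2 : ℝ) ^ n / κ) atTop (𝓝 0) := by
    simpa using (tendsto_pow_atTop_nhds_zero_of_lt_one (by norm_num : (0 : ℝ) ≤ 1 / 2)
      (by norm_num)).div_const κ
  have hclose' : ∀ n, ∀ z ∈ T (s (n + 1)), dist z (s (n + 1)) ≤ (1 / 2 : ℝ) ^ n / κ := by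
    intro n z hz
    rw [le_div_iff₀ hκ, mul_comm]
    exact hclose n z hz
  have hcauchy : CauchySeq (fun n => s (n + 1)) :=
    cauchySeq_of_le_tendsto_0' _ (fun n m hnm => by
      rw [dist_comm]; exact hclose' n _ (hmem (n + 1) (m + 1) (by omega))) hlim0
  obtain ⟨x, hx⟩ := cauchySeq_tendsto_of_complete hcauchy
  have hxT : ∀ n, x ∈ T (s n) := fun n =>
    (hclosed _).mem_of_tendsto hx
      (eventually_atTop.2 ⟨n, fun m hm => hmem n (m + 1) (by omega)⟩)
  refine ⟨x, hxT 0, fun y => ?_⟩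
  by_contra hlt
  have hy : y ∈ T x := by
    change φ y + κ * dist y x ≤ φ x
    linarith
  have hty : Tendsto (fun n => s (n + 1)) atTop (𝓝 y) := by
    rw [tendsto_iff_dist_tendsto_zero]
    refine squeeze_zero (fun _ => dist_nonneg) (fun n => ?_) hlim0
    rw [dist_comm]
    exact hclose' n y (htrans (hxT (n + 1)) hy)
  rw [tendsto_nhds_unique hty hx] at hlt
  simp at hlt

section Caratheodory

variable {X : Type*} [NormedAddCommGroup X] [NormedSpace ℝ X] [FiniteDimensional ℝ X]
  [MeasurableSpace X] [BorelSpace X] {t0 t1 : ℝ}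

/-- Superposition of a Carathéodory field with a measurable curve is measurable. -/
theorem measurable_superposition {Y : Type*} [NormedAddCommGroup Y] [MeasurableSpace Y]
    [BorelSpace Y] {H : ℝ → X → Y} (hc : ∀ t, Continuous (H t))
    (hm : ∀ x, Measurable fun t => H t x) {z : ℝ → X} (hz : Measurable z) :
    Measurable fun t => H t (z t) := by
  have : ProperSpace X := FiniteDimensional.proper_real X
  have h := measurable_uncurry_of_continuous_of_measurable (u := fun x t => H t x) hc hm
  exact h.comp (hz.prodMk measurable_id)

theorem intervalIntegrable_of_measurable_bound {Y : Type*} [NormedAddCommGroup Y]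
    [SecondCountableTopology Y] [MeasurableSpace Y] [BorelSpace Y] {φ : ℝ → Y}
    (hm : Measurable φ) {C a b : ℝ} (hC : ∀ t ∈ uIcc a b, ‖φ t‖ ≤ C) :
    IntervalIntegrable φ volume a b := by
  rw [intervalIntegrable_iff]
  refine Measure.integrableOn_of_bounded (M := C) (by simp) hm.aestronglyMeasurable ?_
  exact (ae_restrict_iff' measurableSet_uIoc).2
    (ae_of_all _ fun t ht => hC t (uIoc_subset_uIcc ht))

theorem intervalIntegrable_superposition {H : ℝ → X → X} {K : ℝ≥0} {M : ℝ}
    (hL : ∀ t, LipschitzWith K (H t)) (hm : ∀ x, Measurable fun t => H t x)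
    (hM : ∀ t, ‖H t 0‖ ≤ M) {z : ℝ → X} (hz : Continuous z) (a b : ℝ) :
    IntervalIntegrable (fun t => H t (z t)) volume a b := by
  have : ProperSpace X := FiniteDimensional.proper_real X
  obtain ⟨C, hC⟩ := isCompact_uIcc.exists_bound_of_continuousOn (s := uIcc a b) hz.continuousOn
  refine intervalIntegrable_of_measurable_bound (C := M + K * C)
    (measurable_superposition (fun t => (hL t).continuous) hm hz.measurable) fun t ht => ?_
  have h1 := (hL t).dist_le_mul (z t) 0
  rw [dist_eq_norm, dist_zero_right] at h1
  have h2 : ‖H t (z t)‖ ≤ ‖H t (z t) - H t 0‖ + ‖H t 0‖ := by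
    simpa using norm_add_le (H t (z t) - H t 0) (H t 0)
  have h3 := mul_le_mul_of_nonneg_left (hC t ht) K.coe_nonneg
  linarith [hM t]

/-- Existence for Carathéodory differential equations with globally Lipschitz right-hand side. -/
theorem exists_caratheodory_solution (ht : t0 ≤ t1) {H : ℝ → X → X} {K : ℝ≥0} {M : ℝ}
    (hL : ∀ t, LipschitzWith K (H t)) (hm : ∀ x, Measurable fun t => H t x)
    (hM : ∀ t, ‖H t 0‖ ≤ M) (x₀ : X) :
    ∃ z : ℝ → X, Continuous z ∧ ∀ t ∈ Icc t0 t1, z t = x₀ + ∫ s in t0..t, H s (z s) := by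
  have : CompleteSpace X := FiniteDimensional.complete ℝ X
  set l : ℝ := 2 * K + 1 with hl
  have hlpos : 0 < l := by positivity
  let ext : C(Icc t0 t1, X) → ℝ → X := fun y s =>
    Real.exp (l * (s - t0)) • IccExtend ht y s
  have hext : ∀ y, Continuous (ext y) := fun y => by
    have : Continuous (IccExtend ht y) := y.continuous.Icc_extend'
    fun_prop
  have hint : ∀ y a b, IntervalIntegrable (fun s => H s (ext y s)) volume a b := fun y =>
    intervalIntegrable_superposition hL hm hM (hext y)
  have hcont : ∀ y, Continuous fun t => ∫ s in t0..t, H s (ext y s) := fun y =>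
    intervalIntegral.continuous_primitive (hint y) t0
  let Q : C(Icc t0 t1, X) → C(Icc t0 t1, X) := fun y =>
    ⟨fun t => Real.exp (-(l * ((t : ℝ) - t0))) • (x₀ + ∫ s in t0..t, H s (ext y s)), by
      have := (hcont y).comp (continuous_subtype_val (p := fun t => t ∈ Icc t0 t1))
      simp only [Function.comp_def] at this
      fun_prop⟩
  have hQ : ContractingWith (1 / 2 : ℝ≥0) Q := by
    refine ⟨by rw [← NNReal.coe_lt_coe]; norm_num, LipschitzWith.of_dist_le_mul fun y y' => ?_⟩
    rw [ContinuousMap.dist_le (by positivity)]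
    intro t
    have hexp : ∀ s, HasDerivAt (fun s => Real.exp (l * (s - t0)) / l)
        (Real.exp (l * (s - t0))) s := by
      intro s
      have h1 : HasDerivAt (fun s => l * (s - t0)) l s := by
        simpa using ((hasDerivAt_id s).sub_const t0).const_mul l
      have h2 := h1.exp.div_const l
      rwa [mul_div_assoc, div_self hlpos.ne', mul_one] at h2
    have hval : ∫ s in t0..(t : ℝ), Real.exp (l * (s - t0)) =
        (Real.exp (l * (t - t0)) - 1) / l := by
      rw [intervalIntegral.integral_eq_sub_of_hasDerivAt (fun s _ => hexp s)
        (by apply Continuous.intervalIntegrable; fun_prop)]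
      simp [sub_div]
    have hdiff : ‖∫ s in t0..(t : ℝ), (H s (ext y s) - H s (ext y' s))‖ ≤
        ∫ s in t0..(t : ℝ), (K * dist y y') * Real.exp (l * (s - t0)) := by
      refine intervalIntegral.norm_integral_le_of_norm_le t.2.1 (ae_of_all _ fun s _ => ?_)
        (by apply Continuous.intervalIntegrable; fun_prop)
      have h1 := (hL s).dist_le_mul (ext y s) (ext y' s)
      rw [dist_eq_norm, dist_eq_norm] at h1
      have h2 : ‖ext y s - ext y' s‖ ≤ Real.exp (l * (s - t0)) * dist y y' := by
        simp only [ext, ← smul_sub, norm_smul, Real.norm_eq_abs, Real.abs_exp]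
        refine mul_le_mul_of_nonneg_left ?_ (Real.exp_pos _).le
        rw [← dist_eq_norm]
        exact ContinuousMap.dist_apply_le_dist _
      calc _ ≤ _ := h1
        _ ≤ K * (Real.exp (l * (s - t0)) * dist y y') :=
          mul_le_mul_of_nonneg_left h2 K.coe_nonneg
        _ = _ := by ring
    rw [intervalIntegral.integral_const_mul, hval] at hdiff
    have hQd : dist (Q y t) (Q y' t) = Real.exp (-(l * ((t : ℝ) - t0))) *
        ‖∫ s in t0..(t : ℝ), (H s (ext y s) - H s (ext y' s))‖ := by
      rw [dist_eq_norm, intervalIntegral.integral_sub (hint _ _ _) (hint _ _ _)]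
      simp only [Q, ContinuousMap.coe_mk, ← smul_sub, norm_smul, Real.norm_eq_abs, Real.abs_exp,
        add_sub_add_left_eq_sub]
    rw [hQd]
    have hD : (0 : ℝ) ≤ dist y y' := dist_nonneg
    have hE := Real.exp_pos (-(l * ((t : ℝ) - t0)))
    have hEE : Real.exp (-(l * ((t : ℝ) - t0))) * Real.exp (l * ((t : ℝ) - t0)) = 1 := by
      rw [← Real.exp_add]; simp
    have hKl : (K : ℝ) / l ≤ 1 / 2 := by
      rw [div_le_iff₀ hlpos, hl]; linarith
    calc _ ≤ Real.exp (-(l * ((t : ℝ) - t0))) *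
          (K * dist y y' * ((Real.exp (l * (t - t0)) - 1) / l)) :=
          mul_le_mul_of_nonneg_left hdiff hE.le
      _ = (K / l) * dist y y' * (1 - Real.exp (-(l * ((t : ℝ) - t0)))) := by
          linear_combination (K * dist y y' / l) * hEE
      _ ≤ (K / l) * dist y y' * 1 := by
          refine mul_le_mul_of_nonneg_left (by linarith) (by positivity)
      _ ≤ _ := by
          rw [mul_one]
          refine mul_le_mul_of_nonneg_right ?_ hD
          simpa using hKl
  have : Nonempty C(Icc t0 t1, X) := ⟨ContinuousMap.const _ 0⟩
  set y := ContractingWith.fixedPoint Q hQ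
  have hy : Q y = y := hQ.fixedPoint_isFixedPt
  refine ⟨ext y, hext y, fun t htt => ?_⟩
  have h1 : y ⟨t, htt⟩ = Real.exp (-(l * (t - t0))) • (x₀ + ∫ s in t0..t, H s (ext y s)) := by
    conv_lhs => rw [← hy]
    rfl
  have h2 : ext y t = Real.exp (l * (t - t0)) • y ⟨t, htt⟩ := by
    simp only [ext, IccExtend_of_mem ht _ htt]
  rw [h2, h1, smul_smul, ← Real.exp_add]
  simp

end Caratheodory

/-- Integral form of Grönwall's inequality. -/
theorem gronwall_integral {t0 t1 : ℝ} {φ : ℝ → ℝ} (hφ : Continuous φ) (h0 : ∀ t, 0 ≤ φ t) {a K : ℝ}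
    (ha : 0 ≤ a) (hK : 0 ≤ K)
    (h : ∀ t ∈ Icc t0 t1, φ t ≤ a + K * ∫ s in t0..t, φ s) :
    ∀ t ∈ Icc t0 t1, φ t ≤ a * Real.exp (K * (t1 - t0)) := by
  intro t ht
  let W : ℝ → ℝ := fun t => a + K * ∫ s in t0..t, φ s
  have hW : ∀ t, HasDerivAt W (K * φ t) t := fun t =>
    ((intervalIntegral.integral_hasDerivAt_right (hφ.intervalIntegrable _ _)
      (hφ.stronglyMeasurableAtFilter _ _) hφ.continuousAt).const_mul K).const_add a
  have h1 := norm_le_gronwallBound_of_norm_deriv_right_le (f := W) (f' := fun t => K * φ t)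
    (δ := a) (K := K) (ε := 0) (a := t0) (b := t1)
    (fun t _ => (hW t).continuousAt.continuousWithinAt) (fun t _ => (hW t).hasDerivWithinAt)
    (by simp [W, abs_of_nonneg ha]) (fun t ht => by
      have h2 := h t ⟨ht.1, ht.2.le⟩
      rw [Real.norm_eq_abs, Real.norm_eq_abs, abs_of_nonneg (mul_nonneg hK (h0 t)), add_zero]
      exact mul_le_mul_of_nonneg_left (h2.trans (le_abs_self _)) hK) t ht
  rw [gronwallBound_ε0] at h1
  calc φ t ≤ W t := h t ht
    _ ≤ ‖W t‖ := le_abs_self _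
    _ ≤ a * Real.exp (K * (t - t0)) := h1
    _ ≤ _ := by
      gcongr
      exact ht.2

theorem dist_le_of_integral_eq {X : Type*} [NormedAddCommGroup X] [NormedSpace ℝ X] {t0 t1 : ℝ}
    {z d : ℝ → X} {C : ℝ}
    (hd : IntervalIntegrable d volume t0 t1) (hC : ∀ t ∈ Icc t0 t1, ‖d t‖ ≤ C)
    (hz : ∀ t ∈ Icc t0 t1, z t = z t0 + ∫ s in t0..t, d s) {s t : ℝ} (hs : s ∈ Icc t0 t1)
    (ht : t ∈ Icc t0 t1) : ‖z t - z s‖ ≤ C * |t - s| := by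
  have h01 : t0 ≤ t1 := hs.1.trans hs.2
  have hsub : ∀ {a}, a ∈ Icc t0 t1 → IntervalIntegrable d volume t0 a := fun {a} ha =>
    hd.mono_set (by rw [uIcc_of_le h01, uIcc_of_le ha.1]; exact Icc_subset_Icc_right ha.2)
  rw [hz t ht, hz s hs, add_sub_add_left_eq_sub,
    intervalIntegral.integral_interval_sub_left (hsub ht) (hsub hs)]
  refine intervalIntegral.norm_integral_le_of_norm_le_const fun r hr => hC r ?_
  have := uIoc_subset_uIcc hr
  rw [uIcc] at this
  exact ⟨(le_inf hs.1 ht.1).trans this.1, this.2.trans (sup_le hs.2 ht.2)⟩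

section Adjoint

variable {X : Type} [NormedAddCommGroup X] [InnerProductSpace ℝ X] [FiniteDimensional ℝ X]
  [MeasurableSpace X] [BorelSpace X] {t0 t1 : ℝ}

/-- Product rule for the inner product of two Lipschitz curves. -/
theorem inner_sub_inner_eq_integral (h01 : t0 ≤ t1) {p p' z z' : ℝ → X} {C : ℝ}
    (hp' : IntervalIntegrable p' volume t0 t1) (hz' : IntervalIntegrable z' volume t0 t1)
    (hCp : ∀ t ∈ Icc t0 t1, ‖p' t‖ ≤ C) (hCz : ∀ t ∈ Icc t0 t1, ‖z' t‖ ≤ C)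
    (hpc : Continuous p) (hzc : Continuous z)
    (hp : ∀ t ∈ Icc t0 t1, p t = p t0 + ∫ s in t0..t, p' s)
    (hz : ∀ t ∈ Icc t0 t1, z t = z t0 + ∫ s in t0..t, z' s) :
    ⟪p t1, z t1⟫ - ⟪p t0, z t0⟫ = ∫ s in t0..t1, (⟪p' s, z s⟫ + ⟪p s, z' s⟫) := by
  obtain ⟨Mp, hMp⟩ := isCompact_Icc.exists_bound_of_continuousOn (s := Icc t0 t1) hpc.continuousOn
  obtain ⟨Mz, hMz⟩ := isCompact_Icc.exists_bound_of_continuousOn (s := Icc t0 t1) hzc.continuousOn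
  have hlip : LipschitzOnWith (Real.toNNReal (Mp * C + C * Mz)) (fun t => ⟪p t, z t⟫)
      (uIcc t0 t1) := by
    rw [uIcc_of_le h01]
    refine LipschitzOnWith.of_dist_le_mul fun t ht s hs => ?_
    have e : ⟪p t, z t⟫ - ⟪p s, z s⟫ = ⟪p t, z t - z s⟫ + ⟪p t - p s, z s⟫ := by
      rw [inner_sub_right, inner_sub_left]; ring
    rw [Real.dist_eq, Real.dist_eq, e]
    have h1 := (abs_real_inner_le_norm (p t) (z t - z s)).trans (mul_le_mul (hMp t ht)
      (dist_le_of_integral_eq hz' hCz hz hs ht) (norm_nonneg _) ((norm_nonneg _).trans (hMp t ht)))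
    have h2 := (abs_real_inner_le_norm (p t - p s) (z s)).trans (mul_le_mul
      (dist_le_of_integral_eq hp' hCp hp hs ht) (hMz s hs) (norm_nonneg _)
      ((norm_nonneg _).trans (dist_le_of_integral_eq hp' hCp hp hs ht)))
    have h3 := abs_add_le ⟪p t, z t - z s⟫ ⟪p t - p s, z s⟫
    have h4 := mul_le_mul_of_nonneg_right (Real.le_coe_toNNReal (Mp * C + C * Mz))
      (abs_nonneg (t - s))
    linarith
  rw [← hlip.absolutelyContinuousOnInterval.integral_deriv_eq_sub]
  refine intervalIntegral.integral_congr_ae ?_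
  have hne : ∀ᵐ t ∂(volume : Measure ℝ), t ≠ t1 := by
    simp [ae_iff]
  filter_upwards [hp'.ae_hasDerivAt_integral, hz'.ae_hasDerivAt_integral, hne] with t h1 h2 h3 ht
  rw [uIoc_of_le h01] at ht
  have htI : t ∈ uIcc t0 t1 := by rw [uIcc_of_le h01]; exact ⟨ht.1.le, ht.2⟩
  have hnb : ∀ᶠ s in 𝓝 t, s ∈ Icc t0 t1 :=
    Icc_mem_nhds ht.1 (lt_of_le_of_ne ht.2 h3)
  have hpd : HasDerivAt p (p' t) t :=
    ((h1 htI t0 left_mem_uIcc).const_add (p t0)).congr_of_eventuallyEq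
      (hnb.mono fun s hs => hp s hs)
  have hzd : HasDerivAt z (z' t) t :=
    ((h2 htI t0 left_mem_uIcc).const_add (z t0)).congr_of_eventuallyEq
      (hnb.mono fun s hs => hz s hs)
  rw [(hpd.inner ℝ hzd).deriv, add_comm]

theorem measurable_adjoint_apply {A : ℝ → X →L[ℝ] X} (hA : Measurable A) (x : X) :
    Measurable fun t => ContinuousLinearMap.adjoint (A t) x := by
  have h1 : Measurable fun B : X →L[ℝ] X => ContinuousLinearMap.adjoint B :=
    (ContinuousLinearMap.adjoint (𝕜 := ℝ) (E := X) (F := X)).continuous.measurable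
  exact (ContinuousLinearMap.measurable_apply x).comp (h1.comp hA)

/-- Solvability of the backward adjoint equation. -/
theorem exists_adjoint_arc (h01 : t0 ≤ t1) {A : ℝ → X →L[ℝ] X} {K : ℝ≥0} (hA : Measurable A)
    (hK : ∀ t, ‖A t‖ ≤ K) (p₁ : X) :
    ∃ p : ℝ → X, Continuous p ∧ p t1 = p₁ ∧
      (∀ t ∈ Icc t0 t1, p t = p t0 + ∫ s in t0..t, -(ContinuousLinearMap.adjoint (A s) (p s))) ∧
      ∀ t ∈ Icc t0 t1, ‖p t‖ ≤ ‖p₁‖ * Real.exp (K * (t1 - t0)) := by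
  have hn : ∀ t, ‖ContinuousLinearMap.adjoint (A t)‖ ≤ K := fun t => by
    rw [LinearIsometryEquiv.norm_map]; exact hK t
  let H : ℝ → X → X := fun s x => ContinuousLinearMap.adjoint (A (t0 + t1 - s)) x
  have hL : ∀ t, LipschitzWith K (H t) := fun t =>
    (ContinuousLinearMap.adjoint (A (t0 + t1 - t))).lipschitz.weaken (by
      rw [← NNReal.coe_le_coe]; exact hn _)
  have hm : ∀ x, Measurable fun t => H t x := fun x =>
    (measurable_adjoint_apply hA x).comp (measurable_const.sub measurable_id)
  obtain ⟨q, hqc, hq⟩ := exists_caratheodory_solution h01 hL hm (M := 0) (by simp [H]) p₁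
  have hqi : ∀ a b, IntervalIntegrable (fun s => H s (q s)) volume a b :=
    intervalIntegrable_superposition hL hm (M := 0) (by simp [H]) hqc
  have hq0 : q t0 = p₁ := by simpa using hq t0 (left_mem_Icc.2 h01)
  have hbd : ∀ t ∈ Icc t0 t1, ‖q t‖ ≤ ‖p₁‖ * Real.exp (K * (t1 - t0)) := by
    refine gronwall_integral hqc.norm (fun _ => norm_nonneg _) (norm_nonneg _) K.coe_nonneg ?_
    intro t ht
    rw [← intervalIntegral.integral_const_mul]
    have h1 : ‖∫ s in t0..t, H s (q s)‖ ≤ ∫ s in t0..t, K * ‖q s‖ :=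
      intervalIntegral.norm_integral_le_of_norm_le ht.1
        (ae_of_all _ fun s _ => (ContinuousLinearMap.le_opNorm _ _).trans
          (mul_le_mul_of_nonneg_right (hn _) (norm_nonneg _)))
        (by apply Continuous.intervalIntegrable; fun_prop)
    conv_lhs => rw [hq t ht]
    exact (norm_add_le _ _).trans (by gcongr)
  have hrefl : ∀ t ∈ Icc t0 t1, t0 + t1 - t ∈ Icc t0 t1 := fun t ht =>
    ⟨by linarith [ht.2], by linarith [ht.1]⟩
  refine ⟨fun t => q (t0 + t1 - t), by fun_prop, by simpa using hq0, fun t ht => ?_, fun t ht =>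
    hbd _ (hrefl t ht)⟩
  have h1 : ∫ s in t0..t, -(ContinuousLinearMap.adjoint (A s) (q (t0 + t1 - s))) =
      -∫ s in (t0 + t1 - t)..t1, H s (q s) := by
    rw [intervalIntegral.integral_neg]
    have := intervalIntegral.integral_comp_sub_left (a := t0) (b := t) (fun s => H s (q s))
      (t0 + t1)
    simp only [H, sub_sub_cancel, add_sub_cancel_left] at this
    rw [this]
  simp only [h1]
  rw [hq _ (hrefl t ht), hq (t0 + t1 - t0) (by simpa using h01), add_sub_cancel_left,
    ← intervalIntegral.integral_add_adjacent_intervals (hqi t0 (t0 + t1 - t)) (hqi _ t1)]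
  abel

end Adjoint

/-- A countable family of bounded Carathéodory vector fields with bounded, continuous
state derivatives. -/
structure SmoothFields (X : Type) [NormedAddCommGroup X] [InnerProductSpace ℝ X]
    [MeasurableSpace X] where
  F : ℕ → ℝ → X → X
  D : ℕ → ℝ → X → X →L[ℝ] X
  K : ℝ≥0
  measF : ∀ i x, Measurable fun t => F i t x
  measD : ∀ i x, Measurable fun t => D i t x
  hasFDerivAt : ∀ i t x, HasFDerivAt (F i t) (D i t x) x
  contD : ∀ i t, Continuous (D i t)
  normF : ∀ i t x, ‖F i t x‖ ≤ K
  normD : ∀ i t x, ‖D i t x‖ ≤ K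

namespace SmoothFields

variable {X : Type} [NormedAddCommGroup X] [InnerProductSpace ℝ X] [FiniteDimensional ℝ X]
  [MeasurableSpace X] [BorelSpace X] (Φ : SmoothFields X) {t0 t1 : ℝ}

/-- `z` solves `ż = F_{k(t)}(t, z)` on `[t0, t1]`. -/
def Traj (Φ : SmoothFields X) (t0 t1 : ℝ) (k : ℝ → ℕ) (z : ℝ → X) : Prop :=
  Continuous z ∧ ∀ t ∈ Icc t0 t1, z t = z t0 + ∫ s in t0..t, Φ.F (k s) s (z s)

theorem lipschitz (i : ℕ) (t : ℝ) : LipschitzWith Φ.K (Φ.F i t) :=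
  lipschitzWith_of_nnnorm_fderiv_le (fun x => (Φ.hasFDerivAt i t x).differentiableAt)
    fun x => by
      rw [(Φ.hasFDerivAt i t x).fderiv, ← NNReal.coe_le_coe]
      exact Φ.normD i t x

theorem norm_sub_le (i : ℕ) (t : ℝ) (x y : X) : ‖Φ.F i t x - Φ.F i t y‖ ≤ Φ.K * ‖x - y‖ := by
  simpa [dist_eq_norm] using (Φ.lipschitz i t).dist_le_mul x y

theorem measurable_select {Y : Type*} [MeasurableSpace Y] {G : ℕ → ℝ → Y}
    (hG : ∀ i, Measurable (G i)) {k : ℝ → ℕ} (hk : Measurable k) :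
    Measurable fun t => G (k t) t :=
  (measurable_from_prod_countable_right (f := fun q : ℕ × ℝ => G q.1 q.2) hG).comp
    (hk.prodMk measurable_id)

theorem measurable_F {k : ℝ → ℕ} (hk : Measurable k) {z : ℝ → X} (hz : Measurable z) :
    Measurable fun t => Φ.F (k t) t (z t) :=
  measurable_superposition (H := fun t => Φ.F (k t) t) (fun t => (Φ.lipschitz (k t) t).continuous)
    (fun x => measurable_select (fun i => Φ.measF i x) hk) hz

theorem measurable_D {k : ℝ → ℕ} (hk : Measurable k) {z : ℝ → X} (hz : Measurable z) :
    Measurable fun t => Φ.D (k t) t (z t) :=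
  measurable_superposition (H := fun t => Φ.D (k t) t) (fun t => Φ.contD (k t) t)
    (fun x => measurable_select (fun i => Φ.measD i x) hk) hz

theorem intervalIntegrable_F {k : ℝ → ℕ} (hk : Measurable k) {z : ℝ → X} (hz : Measurable z)
    (a b : ℝ) : IntervalIntegrable (fun t => Φ.F (k t) t (z t)) volume a b :=
  intervalIntegrable_of_measurable_bound (Φ.measurable_F hk hz) fun t _ => Φ.normF (k t) t (z t)

theorem exists_traj (h01 : t0 ≤ t1) {k : ℝ → ℕ} (hk : Measurable k) (x₀ : X) :
    ∃ z, Φ.Traj t0 t1 k z ∧ z t0 = x₀ := by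
  obtain ⟨z, hzc, hz⟩ := exists_caratheodory_solution h01 (H := fun t => Φ.F (k t) t)
    (fun t => Φ.lipschitz (k t) t) (fun x => measurable_select (fun i => Φ.measF i x) hk)
    (M := Φ.K) (fun t => Φ.normF _ _ _) x₀
  have h0 : z t0 = x₀ := by simpa using hz t0 (left_mem_Icc.2 h01)
  exact ⟨z, ⟨hzc, by rw [h0]; exact hz⟩, h0⟩

/-- The number of switches, as a real function, between two index selections. -/
def gap (k l : ℝ → ℕ) (t : ℝ) : ℝ := |(k t : ℝ) - l t|

theorem gap_nonneg (k l : ℝ → ℕ) (t : ℝ) : 0 ≤ gap k l t := abs_nonneg _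

theorem measurable_gap {k l : ℝ → ℕ} (hk : Measurable k) (hl : Measurable l) :
    Measurable (gap k l) := by
  unfold gap
  have h1 : Measurable fun t => (k t : ℝ) := measurable_from_top.comp hk
  have h2 : Measurable fun t => (l t : ℝ) := measurable_from_top.comp hl
  exact (h1.sub h2).norm

theorem gap_le {k l : ℝ → ℕ} {n : ℕ} (hk : ∀ t, k t ≤ n) (hl : ∀ t, l t ≤ n) (t : ℝ) :
    gap k l t ≤ n := by
  have h1 : (k t : ℝ) ≤ n := by exact_mod_cast hk t
  have h2 : (l t : ℝ) ≤ n := by exact_mod_cast hl t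
  have h3 : (0 : ℝ) ≤ k t := by positivity
  have h4 : (0 : ℝ) ≤ l t := by positivity
  exact abs_sub_le_iff.2 ⟨by linarith, by linarith⟩

theorem one_le_gap {k l : ℝ → ℕ} {t : ℝ} (h : k t ≠ l t) : 1 ≤ gap k l t := by
  have h1 : (k t : ℤ) - l t ≠ 0 := by omega
  have h2 := Int.one_le_abs h1
  unfold gap
  exact_mod_cast h2

theorem intervalIntegrable_gap {k l : ℝ → ℕ} {n : ℕ} (hk : Measurable k) (hl : Measurable l)
    (hkn : ∀ t, k t ≤ n) (hln : ∀ t, l t ≤ n) (a b : ℝ) :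
    IntervalIntegrable (gap k l) volume a b :=
  intervalIntegrable_of_measurable_bound (measurable_gap hk hl) (C := n) fun t _ => by
    rw [Real.norm_eq_abs, abs_of_nonneg (gap_nonneg _ _ _)]
    exact gap_le hkn hln t

theorem norm_F_sub_F_le (k l : ℝ → ℕ) (t : ℝ) (x : X) :
    ‖Φ.F (k t) t x - Φ.F (l t) t x‖ ≤ 2 * Φ.K * gap k l t := by
  by_cases h : k t = l t
  · rw [h, sub_self, norm_zero]
    exact mul_nonneg (by positivity) (gap_nonneg _ _ _)
  · have h1 := norm_sub_le_of_le (Φ.normF (k t) t x) (Φ.normF (l t) t x)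
    have h2 := mul_le_mul_of_nonneg_left (one_le_gap h) (by positivity : (0 : ℝ) ≤ 2 * Φ.K)
    linarith

/-- Lipschitz dependence of trajectories on the initial point and on the selection. -/
theorem Traj.norm_sub_le {k l : ℝ → ℕ} {n : ℕ} (hk : Measurable k) (hl : Measurable l)
    (hkn : ∀ t, k t ≤ n) (hln : ∀ t, l t ≤ n) {z w : ℝ → X}
    (hz : Φ.Traj t0 t1 k z) (hw : Φ.Traj t0 t1 l w) :
    ∀ t ∈ Icc t0 t1, ‖z t - w t‖ ≤
      (‖z t0 - w t0‖ + 2 * Φ.K * ∫ s in t0..t1, gap k l s) * Real.exp (Φ.K * (t1 - t0)) := by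
  by_cases h01 : t0 ≤ t1
  swap
  · intro t ht; exact absurd (ht.1.trans ht.2) h01
  have hg := intervalIntegrable_gap (n := n) hk hl hkn hln
  have hg0 : 0 ≤ ∫ s in t0..t1, gap k l s :=
    intervalIntegral.integral_nonneg h01 fun s _ => gap_nonneg _ _ _
  refine gronwall_integral (hz.1.sub hw.1).norm (fun _ => norm_nonneg _) (by positivity)
    Φ.K.coe_nonneg fun t ht => ?_
  have hd : IntervalIntegrable (fun s => Φ.K * ‖z s - w s‖) volume t0 t := by
    have := hz.1; have := hw.1
    apply Continuous.intervalIntegrable; fun_prop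
  have e : z t - w t = (z t0 - w t0) +
      ∫ s in t0..t, (Φ.F (k s) s (z s) - Φ.F (l s) s (w s)) := by
    rw [intervalIntegral.integral_sub (Φ.intervalIntegrable_F hk hz.1.measurable _ _)
      (Φ.intervalIntegrable_F hl hw.1.measurable _ _), hz.2 t ht, hw.2 t ht]
    abel
  have hb : ‖∫ s in t0..t, (Φ.F (k s) s (z s) - Φ.F (l s) s (w s))‖ ≤
      ∫ s in t0..t, (2 * Φ.K * gap k l s + Φ.K * ‖z s - w s‖) := by
    refine intervalIntegral.norm_integral_le_of_norm_le ht.1 (ae_of_all _ fun s _ => ?_)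
      (((hg _ _).const_mul _).add hd)
    have h1 := Φ.norm_sub_le (k s) s (z s) (w s)
    have h2 := Φ.norm_F_sub_F_le k l s (w s)
    have h3 := norm_add_le (Φ.F (k s) s (z s) - Φ.F (k s) s (w s))
      (Φ.F (k s) s (w s) - Φ.F (l s) s (w s))
    rw [sub_add_sub_cancel] at h3
    linarith
  rw [intervalIntegral.integral_add ((hg _ _).const_mul _) hd,
    intervalIntegral.integral_const_mul, intervalIntegral.integral_const_mul] at hb
  have hmono : ∫ s in t0..t, gap k l s ≤ ∫ s in t0..t1, gap k l s :=
    intervalIntegral.integral_mono_interval le_rfl ht.1 ht.2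
      (ae_of_all _ fun s => gap_nonneg _ _ _) (hg _ _)
  have h4 := mul_le_mul_of_nonneg_left hmono (by positivity : (0 : ℝ) ≤ 2 * Φ.K)
  have h5 := norm_add_le (z t0 - w t0) (∫ s in t0..t, (Φ.F (k s) s (z s) - Φ.F (l s) s (w s)))
  rw [← e] at h5
  change ‖z t - w t‖ ≤ _ + Φ.K * ∫ s in t0..t, ‖z s - w s‖
  linarith

theorem Traj.norm_sub_le_mul (h01 : t0 ≤ t1) {k l : ℝ → ℕ} {n : ℕ} (hk : Measurable k)
    (hl : Measurable l) (hkn : ∀ t, k t ≤ n) (hln : ∀ t, l t ≤ n) {z w : ℝ → X}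
    (hz : Φ.Traj t0 t1 k z) (hw : Φ.Traj t0 t1 l w) {t : ℝ} (ht : t ∈ Icc t0 t1) :
    ‖z t - w t‖ ≤ ((1 + 2 * Φ.K) * Real.exp (Φ.K * (t1 - t0))) *
      (‖z t0 - w t0‖ + ∫ s in t0..t1, gap k l s) := by
  have hg0 : 0 ≤ ∫ s in t0..t1, gap k l s :=
    intervalIntegral.integral_nonneg h01 fun s _ => gap_nonneg _ _ _
  have h0 := norm_nonneg (z t0 - w t0)
  refine (Traj.norm_sub_le Φ hk hl hkn hln hz hw t ht).trans ?_
  rw [mul_right_comm (1 + 2 * (Φ.K : ℝ))]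
  refine mul_le_mul_of_nonneg_right ?_ (Real.exp_pos _).le
  have := mul_nonneg Φ.K.coe_nonneg h0
  linarith

/-- First-order expansion of the end-point pairing with the adjoint arc along perturbed
trajectories. -/
theorem tendsto_variation (h01 : t0 ≤ t1) {k : ℝ → ℕ} {n : ℕ} (hk : Measurable k)
    (hkn : ∀ t, k t ≤ n) {z : ℝ → X} (hz : Φ.Traj t0 t1 k z) {p : ℝ → X} (hpc : Continuous p)
    (hp : ∀ t ∈ Icc t0 t1, p t = p t0 +
      ∫ s in t0..t, -(ContinuousLinearMap.adjoint (Φ.D (k s) s (z s)) (p s)))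
    {l : ℕ → ℝ → ℕ} (hl : ∀ j, Measurable (l j)) (hln : ∀ j t, l j t ≤ n) {w : ℕ → ℝ → X}
    (hw : ∀ j, Φ.Traj t0 t1 (l j) (w j)) {ρ : ℕ → ℝ} (hρ : ∀ j, 0 < ρ j)
    (hρ0 : Tendsto ρ atTop (𝓝 0))
    (hle : ∀ j, ‖w j t0 - z t0‖ + ∫ s in t0..t1, gap (l j) k s ≤ ρ j) :
    Tendsto (fun j => (⟪p t1, w j t1 - z t1⟫ - ⟪p t0, w j t0 - z t0⟫ -
      ∫ s in t0..t1, ⟪p s, Φ.F (l j s) s (z s) - Φ.F (k s) s (z s)⟫) / ρ j) atTop (𝓝 0) := by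
  obtain ⟨P, hP⟩ := isCompact_Icc.exists_bound_of_continuousOn (s := Icc t0 t1) hpc.continuousOn
  have hP0 : 0 ≤ P := (norm_nonneg _).trans (hP t0 (left_mem_Icc.2 h01))
  set C : ℝ := (1 + 2 * Φ.K) * Real.exp (Φ.K * (t1 - t0)) with hC
  have hC0 : 0 ≤ C := by positivity
  have hΔ : ∀ j, ∀ t ∈ Icc t0 t1, ‖w j t - z t‖ ≤ C * ρ j := by
    intro j t ht
    exact (Traj.norm_sub_le_mul Φ h01 (hl j) hk (hln j) hkn (hw j) hz ht).trans
      (mul_le_mul_of_nonneg_left (hle j) hC0)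
  let A : ℝ → X →L[ℝ] X := fun s => Φ.D (k s) s (z s)
  have hAm : Measurable A := Φ.measurable_D hk hz.1.measurable
  let r : ℕ → ℝ → ℝ := fun j s => ⟪p s, Φ.F (l j s) s (w j s) - Φ.F (l j s) s (z s) -
    A s (w j s - z s)⟫
  have hAwm : ∀ j, Measurable fun s => A s (w j s - z s) := fun j =>
    measurable_superposition (H := fun s x => A s x) (fun s => (A s).continuous)
      (fun x => (ContinuousLinearMap.measurable_apply x).comp hAm)
      ((hw j).1.sub hz.1).measurable
  have hrm : ∀ j, Measurable (r j) := fun j =>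
    hpc.measurable.inner (((Φ.measurable_F (hl j) (hw j).1.measurable).sub
      (Φ.measurable_F (hl j) hz.1.measurable)).sub (hAwm j))
  let r₀ : ℕ → ℝ → ℝ := fun j s => ‖Φ.F (k s) s (w j s) - Φ.F (k s) s (z s) - A s (w j s - z s)‖
  have hr₀m : ∀ j, Measurable (r₀ j) := fun j =>
    (((Φ.measurable_F hk (hw j).1.measurable).sub
      (Φ.measurable_F hk hz.1.measurable)).sub (hAwm j)).norm
  have hlin : ∀ i j s, s ∈ Icc t0 t1 → ‖Φ.F i s (w j s) - Φ.F i s (z s) - A s (w j s - z s)‖ ≤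
      2 * Φ.K * (C * ρ j) := by
    intro i j s hs
    have h1 := Φ.norm_sub_le i s (w j s) (z s)
    have h2 := ((A s).le_opNorm (w j s - z s)).trans
      (mul_le_mul_of_nonneg_right (Φ.normD _ _ _) (norm_nonneg _))
    have h3 := mul_le_mul_of_nonneg_left (hΔ j s hs) Φ.K.coe_nonneg
    have h4 := norm_sub_le_of_le h1 h2
    linarith
  have hrbound : ∀ j s, s ∈ Icc t0 t1 →
      |r j s| ≤ P * (r₀ j s + 2 * Φ.K * (C * ρ j) * gap (l j) k s) := by
    intro j s hs
    refine (abs_real_inner_le_norm _ _).trans (mul_le_mul (hP s hs) ?_ (norm_nonneg _) hP0)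
    by_cases h : l j s = k s
    · simp only [h, r₀]
      have := gap_nonneg (l j) k s
      have := (hρ j).le
      exact le_add_of_nonneg_right (by positivity)
    · have h1 := one_le_gap h
      have h2 : (0 : ℝ) ≤ 2 * Φ.K * (C * ρ j) := by have := (hρ j).le; positivity
      have h3 := mul_le_mul_of_nonneg_left h1 h2
      have h4 := hlin (l j s) j s hs
      have h5 : 0 ≤ r₀ j s := norm_nonneg _
      linarith
  have hident : ∀ j, ⟪p t1, w j t1 - z t1⟫ - ⟪p t0, w j t0 - z t0⟫ -
      ∫ s in t0..t1, ⟪p s, Φ.F (l j s) s (z s) - Φ.F (k s) s (z s)⟫ = ∫ s in t0..t1, r j s := by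
    intro j
    have hp'm : Measurable fun s => -(ContinuousLinearMap.adjoint (A s) (p s)) :=
      (measurable_superposition (H := fun s x => ContinuousLinearMap.adjoint (A s) x)
        (fun s => (ContinuousLinearMap.adjoint (A s)).continuous)
        (fun x => measurable_adjoint_apply hAm x) hpc.measurable).neg
    have hp'b : ∀ t ∈ Icc t0 t1, ‖-(ContinuousLinearMap.adjoint (A t) (p t))‖ ≤
        Φ.K * P + 2 * Φ.K := by
      intro t ht
      rw [norm_neg]
      have h1 := (ContinuousLinearMap.adjoint (A t)).le_opNorm (p t)
      rw [LinearIsometryEquiv.norm_map] at h1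
      have h2 := mul_le_mul (Φ.normD (k t) t (z t)) (hP t ht) (norm_nonneg _) Φ.K.coe_nonneg
      have := Φ.K.coe_nonneg
      linarith
    have hwz := (Φ.intervalIntegrable_F (hl j) (hw j).1.measurable t0 t1).sub
      (Φ.intervalIntegrable_F hk hz.1.measurable t0 t1)
    have h1 := inner_sub_inner_eq_integral (C := Φ.K * P + 2 * Φ.K) h01
      (intervalIntegrable_of_measurable_bound hp'm (by rwa [uIcc_of_le h01])) hwz hp'b
      (fun t _ => by
        have := norm_sub_le_of_le (Φ.normF (l j t) t (w j t)) (Φ.normF (k t) t (z t))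
        have := mul_nonneg Φ.K.coe_nonneg hP0
        linarith) hpc ((hw j).1.sub hz.1) hp
      (fun t ht => by
        have hsub : ∀ (i : ℝ → ℕ) (hi : Measurable i) (v : ℝ → X), Measurable v →
            IntervalIntegrable (fun s => Φ.F (i s) s (v s)) volume t0 t := fun i hi v hv =>
          Φ.intervalIntegrable_F hi hv _ _
        rw [intervalIntegral.integral_sub (hsub _ (hl j) _ (hw j).1.measurable)
          (hsub _ hk _ hz.1.measurable)]
        simp only [Pi.sub_apply]
        rw [(hw j).2 t ht, hz.2 t ht]
        abel)
    simp only [Pi.sub_apply] at h1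
    rw [h1, ← intervalIntegral.integral_sub]
    · refine intervalIntegral.integral_congr fun s _ => ?_
      simp only [r, inner_neg_left, ContinuousLinearMap.adjoint_inner_left, map_sub,
        inner_sub_right]
      ring
    · refine intervalIntegrable_of_measurable_bound
        (C := (Φ.K * P + 2 * Φ.K) * (C * ρ j) + P * (2 * Φ.K)) ?_ ?_
      · exact (hp'm.inner ((hw j).1.sub hz.1).measurable).add (hpc.measurable.inner
          ((Φ.measurable_F (hl j) (hw j).1.measurable).sub (Φ.measurable_F hk hz.1.measurable)))
      · rw [uIcc_of_le h01]
        intro t ht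
        have h2 := (abs_real_inner_le_norm _ _).trans
          (mul_le_mul (hp'b t ht) (hΔ j t ht) (norm_nonneg _)
            ((norm_nonneg _).trans (hp'b t ht)))
        have h3 := (abs_real_inner_le_norm _ _).trans (mul_le_mul (hP t ht)
          (norm_sub_le_of_le (Φ.normF (l j t) t (w j t)) (Φ.normF (k t) t (z t)))
          (norm_nonneg _) hP0)
        have h4 := (abs_add_le _ _).trans (add_le_add h2 h3)
        rw [Real.norm_eq_abs]
        linarith
    · refine intervalIntegrable_of_measurable_bound (C := P * (2 * Φ.K)) ?_ ?_
      · exact hpc.measurable.inner ((Φ.measurable_F (hl j) hz.1.measurable).sub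
          (Φ.measurable_F hk hz.1.measurable))
      · rw [uIcc_of_le h01]
        intro t ht
        have h3 := (abs_real_inner_le_norm _ _).trans (mul_le_mul (hP t ht)
          (norm_sub_le_of_le (Φ.normF (l j t) t (z t)) (Φ.normF (k t) t (z t)))
          (norm_nonneg _) hP0)
        rw [Real.norm_eq_abs]
        linarith
  have hr₀b : ∀ j s, s ∈ Icc t0 t1 → |r₀ j s / ρ j| ≤ 2 * Φ.K * C := by
    intro j s hs
    rw [abs_of_nonneg (div_nonneg (norm_nonneg _) (hρ j).le), div_le_iff₀ (hρ j)]
    linarith [hlin (k s) j s hs]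
  have hr₀lim : Tendsto (fun j => ∫ s in t0..t1, r₀ j s / ρ j) atTop (𝓝 0) := by
    have : Tendsto (fun j => ∫ s in t0..t1, r₀ j s / ρ j) atTop
        (𝓝 (∫ s in t0..t1, (0 : ℝ))) := by
      refine intervalIntegral.tendsto_integral_filter_of_dominated_convergence
        (fun _ => 2 * Φ.K * C)
        (.of_forall fun j => ((hr₀m j).div_const _).aestronglyMeasurable)
        (.of_forall fun j => ae_of_all _ fun s hs => ?_) intervalIntegrable_const
        (ae_of_all _ fun s hs => ?_)
      · rw [uIoc_of_le h01] at hs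
        exact hr₀b j s ⟨hs.1.le, hs.2⟩
      · rw [uIoc_of_le h01] at hs
        have hs' : s ∈ Icc t0 t1 := ⟨hs.1.le, hs.2⟩
        have hwlim : Tendsto (fun j => w j s) atTop (𝓝 (z s)) := by
          rw [tendsto_iff_norm_sub_tendsto_zero]
          exact squeeze_zero (fun _ => norm_nonneg _) (fun j => hΔ j s hs')
            (by simpa using hρ0.const_mul C)
        have ho : (fun j => Φ.F (k s) s (w j s) - Φ.F (k s) s (z s) - A s (w j s - z s))
            =o[atTop] fun j => w j s - z s :=
          (Φ.hasFDerivAt (k s) s (z s)).isLittleO.comp_tendsto hwlim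
        have hO : (fun j => w j s - z s) =O[atTop] ρ :=
          Asymptotics.IsBigO.of_bound C (.of_forall fun j => by
            rw [Real.norm_eq_abs, abs_of_pos (hρ j)]; exact hΔ j s hs')
        exact (ho.trans_isBigO hO).norm_left.tendsto_div_nhds_zero
    simpa using this
  have hbound : ∀ j, |(∫ s in t0..t1, r j s) / ρ j| ≤
      P * (∫ s in t0..t1, r₀ j s / ρ j) + P * (2 * Φ.K * C) * ρ j := by
    intro j
    have hr₀i : IntervalIntegrable (r₀ j) volume t0 t1 :=
      intervalIntegrable_of_measurable_bound (hr₀m j) (C := 2 * Φ.K * (C * ρ j)) (by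
        rw [uIcc_of_le h01]
        intro s hs
        rw [norm_norm]
        exact hlin _ j s hs)
    have hgi := intervalIntegrable_gap (hl j) hk (hln j) hkn t0 t1
    have h1 : ‖∫ s in t0..t1, r j s‖ ≤
        ∫ s in t0..t1, P * (r₀ j s + 2 * Φ.K * (C * ρ j) * gap (l j) k s) :=
      intervalIntegral.norm_integral_le_of_norm_le h01
        (ae_of_all _ fun s hs => hrbound j s ⟨hs.1.le, hs.2⟩)
        ((hr₀i.add (hgi.const_mul _)).const_mul _)
    rw [intervalIntegral.integral_const_mul, intervalIntegral.integral_add hr₀i (hgi.const_mul _),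
      intervalIntegral.integral_const_mul, Real.norm_eq_abs] at h1
    have h2 : ∫ s in t0..t1, gap (l j) k s ≤ ρ j := by
      linarith [hle j, norm_nonneg (w j t0 - z t0)]
    have h3 : (0 : ℝ) ≤ P * (2 * Φ.K * (C * ρ j)) := by have := (hρ j).le; positivity
    have h4 := mul_le_mul_of_nonneg_left h2 h3
    rw [abs_div, abs_of_pos (hρ j), div_le_iff₀ (hρ j), intervalIntegral.integral_div, add_mul,
      mul_assoc, div_mul_cancel₀ _ (hρ j).ne']
    linarith
  simp only [hident]
  refine squeeze_zero_norm hbound ?_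
  simpa using (hr₀lim.const_mul P).add (hρ0.const_mul (P * (2 * Φ.K * C)))

end SmoothFields

namespace SmoothFields

/-- Integrable functions with values in `{0, …, n}`. -/
def selectionSet (t0 t1 : ℝ) (n : ℕ) : Set (Lp ℝ 1 (volume.restrict (Icc t0 t1))) :=
  {σ | ∀ᵐ t ∂volume.restrict (Icc t0 t1), ∃ k : ℕ, k ≤ n ∧ σ t = k}

theorem isClosed_selectionSet (t0 t1 : ℝ) (n : ℕ) : IsClosed (selectionSet t0 t1 n) := by
  refine isClosed_of_closure_subset fun σ hσ => ?_
  obtain ⟨τ, hτ, hlim⟩ := mem_closure_iff_seq_limit.1 hσ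
  have h1 : TendstoInMeasure (volume.restrict (Icc t0 t1)) (fun j t => τ j t) atTop σ :=
    tendstoInMeasure_of_tendsto_Lp hlim
  obtain ⟨ns, -, hae⟩ := h1.exists_seq_tendsto_ae
  have hfin : IsClosed ((fun k : ℕ => (k : ℝ)) '' Iic n) :=
    ((finite_Iic n).image _).isClosed
  filter_upwards [hae, ae_all_iff.2 hτ] with t ht hk
  obtain ⟨k, hk, he⟩ := hfin.mem_of_tendsto ht (.of_forall fun j => by
    obtain ⟨k, hk, he⟩ := hk (ns j); exact ⟨k, hk, he.symm⟩)
  exact ⟨k, hk, he.symm⟩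

/-- The index selection attached to an integrable function. -/
def sel {t0 t1 : ℝ} (n : ℕ) (σ : Lp ℝ 1 (volume.restrict (Icc t0 t1))) (t : ℝ) : ℕ :=
  min ⌊σ t⌋₊ n

theorem measurable_sel {t0 t1 : ℝ} (n : ℕ) (σ : Lp ℝ 1 (volume.restrict (Icc t0 t1))) :
    Measurable (sel n σ) :=
  (Nat.measurable_floor.comp (Lp.stronglyMeasurable σ).measurable).min measurable_const

theorem sel_eq {t0 t1 : ℝ} {n : ℕ} {σ : Lp ℝ 1 (volume.restrict (Icc t0 t1))}
    (hσ : σ ∈ selectionSet t0 t1 n) :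
    ∀ᵐ t ∂volume.restrict (Icc t0 t1), (sel n σ t : ℝ) = σ t := by
  filter_upwards [hσ] with t ⟨k, hk, he⟩
  simp [sel, he, hk]

theorem dist_selection {t0 t1 : ℝ} (h01 : t0 ≤ t1)
    {σ τ : Lp ℝ 1 (volume.restrict (Icc t0 t1))} {k l : ℝ → ℕ}
    (hk : ∀ᵐ t ∂volume.restrict (Icc t0 t1), (k t : ℝ) = σ t)
    (hl : ∀ᵐ t ∂volume.restrict (Icc t0 t1), (l t : ℝ) = τ t) :
    dist σ τ = ∫ t in t0..t1, gap k l t := by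
  rw [dist_eq_norm, L1.norm_eq_integral_norm, intervalIntegral.integral_of_le h01,
    ← integral_Icc_eq_integral_Ioc]
  refine integral_congr_ae ?_
  filter_upwards [hk, hl, Lp.coeFn_sub σ τ] with t h1 h2 h3
  rw [gap, h1, h2, h3, Pi.sub_apply, Real.norm_eq_abs]

theorem exists_selection {t0 t1 : ℝ} {n : ℕ} {k : ℝ → ℕ} (hk : Measurable k)
    (hkn : ∀ t, k t ≤ n) : ∃ τ ∈ selectionSet t0 t1 n,
      ∀ᵐ t ∂volume.restrict (Icc t0 t1), (k t : ℝ) = τ t := by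
  have hm : MemLp (fun t => (k t : ℝ)) 1 (volume.restrict (Icc t0 t1)) :=
    MemLp.of_bound (measurable_from_top.comp hk).aestronglyMeasurable n (ae_of_all _ fun t => by
      simpa using hkn t)
  have he := hm.coeFn_toLp
  exact ⟨hm.toLp _, by filter_upwards [he] with t ht using ⟨k t, hkn t, ht⟩,
    by filter_upwards [he] with t ht using ht.symm⟩

theorem exists_ekeland_selection {X Y : Type*} [MetricSpace X] [CompleteSpace X]
    [PseudoMetricSpace Y] {t0 t1 : ℝ} (h01 : t0 ≤ t1) (n : ℕ) {e : X → (ℝ → ℕ) → Y} {C : ℝ}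
    (he : ∀ x y k l, Measurable k → Measurable l → (∀ t, k t ≤ n) → (∀ t, l t ≤ n) →
      dist (e x k) (e y l) ≤ C * (dist x y + ∫ t in t0..t1, gap k l t))
    {Ψ : Y → ℝ} (hΨ : Continuous Ψ) (h0 : ∀ y, 0 ≤ Ψ y) (x₀ : X) {κ : ℝ} (hκ : 0 < κ) :
    ∃ x k, Measurable k ∧ (∀ t, k t ≤ n) ∧ κ * dist x x₀ ≤ Ψ (e x₀ fun _ => 0) ∧
      κ * ∫ t in t0..t1, gap k (fun _ => 0) t ≤ Ψ (e x₀ fun _ => 0) ∧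
      ∀ y l, Measurable l → (∀ t, l t ≤ n) →
        Ψ (e x k) ≤ Ψ (e y l) + κ * (dist y x + ∫ t in t0..t1, gap l k t) := by
  let V := selectionSet t0 t1 n
  have : CompleteSpace V := (isClosed_selectionSet t0 t1 n).completeSpace_coe
  have hsel : ∀ (σ : V) t, sel n σ.1 t ≤ n := fun σ t => min_le_right _ _
  let φ : X × V → ℝ := fun q => Ψ (e q.1 (sel n q.2.1))
  have hφ : Continuous φ := by
    refine hΨ.comp (continuous_iff_continuousAt.2 fun q => ?_)
    refine tendsto_iff_dist_tendsto_zero.2 (squeeze_zero (fun _ => dist_nonneg)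
      (g := fun r : X × V => C * (dist r.1 q.1 + dist r.2 q.2)) (fun r => ?_) ?_)
    · have := he r.1 q.1 _ _ (measurable_sel n r.2.1) (measurable_sel n q.2.1) (hsel _) (hsel _)
      rwa [← dist_selection h01 (sel_eq r.2.2) (sel_eq q.2.2)] at this
    · have : Continuous fun r : X × V => C * (dist r.1 q.1 + dist r.2 q.2) := by fun_prop
      simpa using this.tendsto q
  obtain ⟨τ₀, hτ₀, he₀⟩ := exists_selection (t0 := t0) (t1 := t1) (n := n)
    (k := fun _ => 0) measurable_const fun _ => Nat.zero_le _
  have hval : ∀ (y : X) (l : ℝ → ℕ) (τ : V), Measurable l → (∀ t, l t ≤ n) →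
      (∀ᵐ t ∂volume.restrict (Icc t0 t1), (l t : ℝ) = τ.1 t) → φ (y, τ) = Ψ (e y l) := by
    intro y l τ hl hln hτ
    have h1 := he y y _ _ (measurable_sel n τ.1) hl (hsel _) hln
    rw [← dist_selection h01 (sel_eq τ.2) hτ, dist_self, dist_self, add_zero,
      mul_zero] at h1
    exact ((Metric.inseparable_iff.2 (le_antisymm h1 dist_nonneg)).map hΨ).eq
  obtain ⟨⟨x, σ⟩, h1, h2⟩ := ekeland hφ (fun q => h0 _) (x₀, (⟨τ₀, hτ₀⟩ : V)) hκ
  rw [hval x₀ _ _ measurable_const (fun _ => Nat.zero_le _) he₀] at h1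
  have h3 : 0 ≤ φ (x, σ) := h0 _
  refine ⟨x, sel n σ.1, measurable_sel n _, hsel σ, ?_, ?_, fun y l hl hln => ?_⟩
  · have := mul_le_mul_of_nonneg_left (le_max_left (dist x x₀) (dist σ ⟨τ₀, hτ₀⟩)) hκ.le
    rw [Prod.dist_eq] at h1
    linarith
  · have := mul_le_mul_of_nonneg_left (le_max_right (dist x x₀) (dist σ ⟨τ₀, hτ₀⟩)) hκ.le
    rw [Prod.dist_eq] at h1
    rw [← dist_selection h01 (sel_eq σ.2) he₀]
    change κ * dist σ ⟨τ₀, hτ₀⟩ ≤ _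
    linarith
  · obtain ⟨τ, hτ, hae⟩ := exists_selection (t0 := t0) (t1 := t1) hl hln
    have h4 := h2 (y, ⟨τ, hτ⟩)
    rw [hval y l _ hl hln hae, Prod.dist_eq] at h4
    rw [← dist_selection h01 hae (sel_eq σ.2)]
    have h5 : max (dist y x) (dist (⟨τ, hτ⟩ : V) σ) ≤ dist y x + dist τ σ.1 :=
      max_le_add_of_nonneg dist_nonneg dist_nonneg
    exact h4.trans (add_le_add_right (mul_le_mul_of_nonneg_left h5 hκ.le) _)

end SmoothFields

theorem exists_shrinking_subsets {A : Set ℝ} (hA : MeasurableSet A) (h0 : volume A ≠ 0) :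
    ∃ B : ℕ → Set ℝ, (∀ j, MeasurableSet (B j) ∧ B j ⊆ A ∧ volume (B j) ≠ ⊤ ∧
      0 < volume.real (B j)) ∧ Tendsto (fun j => volume.real (B j)) atTop (𝓝 0) := by
  obtain ⟨x, hx, hpos⟩ := exists_mem_forall_mem_nhdsWithin_pos_measure h0
  have hr : ∀ j : ℕ, (0 : ℝ) < 1 / (j + 1) := fun j => by positivity
  have hfin : ∀ j : ℕ, volume (A ∩ Metric.ball x (1 / (j + 1))) ≠ ⊤ := fun j =>
    measure_ne_top_of_subset inter_subset_right measure_ball_lt_top.ne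
  refine ⟨fun j => A ∩ Metric.ball x (1 / (j + 1)), fun j => ⟨hA.inter measurableSet_ball,
    inter_subset_left, hfin j, ENNReal.toReal_pos (hpos _ (inter_mem self_mem_nhdsWithin
      (mem_nhdsWithin_of_mem_nhds (Metric.ball_mem_nhds x (hr j))))).ne' (hfin j)⟩, ?_⟩
  have hlim : Tendsto (fun j : ℕ => 2 * (1 / ((j : ℝ) + 1))) atTop (𝓝 0) := by
    simpa using tendsto_one_div_add_atTop_nhds_zero_nat.const_mul (2 : ℝ)
  refine squeeze_zero (fun _ => measureReal_nonneg) (fun j => ?_) hlim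
  refine (measureReal_mono inter_subset_right measure_ball_lt_top.ne).trans ?_
  rw [Real.volume_real_ball (hr j).le]

namespace SmoothFields

variable {X : Type} [NormedAddCommGroup X] [InnerProductSpace ℝ X] [FiniteDimensional ℝ X]
  [MeasurableSpace X] [BorelSpace X] (Φ : SmoothFields X) {t0 t1 : ℝ}

/-- `(k, z)` minimises `Ψ` of the end points up to an error linear in the distance, over all
trajectories with selections bounded by `n`. -/
def NearMin (t0 t1 : ℝ) (n : ℕ) (Ψ : X × X → ℝ) (κ : ℝ) (k : ℝ → ℕ) (z : ℝ → X) : Prop :=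
  ∀ l w, Measurable l → (∀ t, l t ≤ n) → Φ.Traj t0 t1 l w →
    Ψ (z t0, z t1) ≤ Ψ (w t0, w t1) + κ * (‖w t0 - z t0‖ + ∫ t in t0..t1, gap l k t)

theorem exists_nearMin (h01 : t0 ≤ t1) (hF0 : ∀ t, Φ.F 0 t 0 = 0) (n : ℕ)
    {Ψ : X × X → ℝ} (hΨ : Continuous Ψ) (h0 : ∀ y, 0 ≤ Ψ y) {κ : ℝ} (hκ : 0 < κ)
    (hΨκ : Ψ 0 ≤ κ ^ 2) :
    ∃ k z, Measurable k ∧ (∀ t, k t ≤ n) ∧ Φ.Traj t0 t1 k z ∧ ‖z t0‖ ≤ κ ∧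
      ∫ t in t0..t1, gap k (fun _ => 0) t ≤ κ ∧ Φ.NearMin t0 t1 n Ψ κ k z := by
  have hex : ∀ (x : X) (k : ℝ → ℕ), ∃ z, Measurable k → (Φ.Traj t0 t1 k z ∧ z t0 = x) := by
    intro x k
    by_cases hk : Measurable k
    · obtain ⟨z, hz⟩ := Φ.exists_traj h01 hk x
      exact ⟨z, fun _ => hz⟩
    · exact ⟨fun _ => 0, fun h => absurd h hk⟩
  choose Z hZ using hex
  set G : ℝ := Real.exp (Φ.K * (t1 - t0))
  have hest : ∀ (k l : ℝ → ℕ) (z w : ℝ → X), Measurable k → Measurable l → (∀ t, k t ≤ n) →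
      (∀ t, l t ≤ n) → Φ.Traj t0 t1 k z → Φ.Traj t0 t1 l w →
      dist (z t0, z t1) (w t0, w t1) ≤
        ((1 + 2 * Φ.K) * G) * (dist (z t0) (w t0) + ∫ t in t0..t1, gap k l t) := by
    intro k l z w hk hl hkn hln hz hw
    have key : ∀ t ∈ Icc t0 t1, ‖z t - w t‖ ≤
        ((1 + 2 * Φ.K) * G) * (dist (z t0) (w t0) + ∫ t in t0..t1, gap k l t) := fun t ht => by
      rw [dist_eq_norm]
      exact Traj.norm_sub_le_mul Φ h01 hk hl hkn hln hz hw ht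
    rw [Prod.dist_eq, max_le_iff]
    exact ⟨(dist_eq_norm (z t0) (w t0)).trans_le (key t0 (left_mem_Icc.2 h01)),
      (dist_eq_norm (z t1) (w t1)).trans_le (key t1 (right_mem_Icc.2 h01))⟩
  obtain ⟨x, k, hk, hkn, h1, h2, h3⟩ := exists_ekeland_selection h01 n
    (e := fun x k => (Z x k t0, Z x k t1)) (C := (1 + 2 * Φ.K) * G)
    (fun x y k l hk hl hkn hln => by
      have := hest k l _ _ hk hl hkn hln (hZ x k hk).1 (hZ y l hl).1
      rwa [(hZ x k hk).2, (hZ y l hl).2] at this ⊢) hΨ h0 (0 : X) hκ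
  have hzero : (Z 0 (fun _ => 0) t0, Z 0 (fun _ => 0) t1) = (0 : X × X) := by
    have hz := hZ 0 (fun _ => 0) measurable_const
    have h0t : Φ.Traj t0 t1 (fun _ => 0) fun _ => (0 : X) :=
      ⟨continuous_const, fun t _ => by simp [hF0]⟩
    have := hest _ _ _ _ measurable_const measurable_const (fun _ => Nat.zero_le _)
      (fun _ => Nat.zero_le _) hz.1 h0t
    rw [hz.2] at this
    refine Prod.ext hz.2 ?_
    simp only [dist_self, zero_add, gap, sub_self, abs_zero, intervalIntegral.integral_zero,
      mul_zero, Prod.dist_eq, max_le_iff] at this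
    exact dist_le_zero.1 this.2
  rw [hzero] at h1 h2
  refine ⟨k, Z x k, hk, hkn, (hZ x k hk).1, ?_, ?_, fun l w hl hln hw => ?_⟩
  · rw [(hZ x k hk).2, ← dist_zero_right]
    exact le_of_mul_le_mul_left (by linarith [sq κ]) hκ
  · exact le_of_mul_le_mul_left (by linarith [sq κ]) hκ
  · have h4 := h3 (w t0) l hl hln
    have h5 := hest _ _ _ _ hl hl hln hln (hZ (w t0) l hl).1 hw
    rw [(hZ _ l hl).2] at h5
    have h6 : (Z (w t0) l t0, Z (w t0) l t1) = (w t0, w t1) := by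
      refine Prod.ext (hZ _ l hl).2 ?_
      simp only [dist_self, zero_add, gap, sub_self, abs_zero, intervalIntegral.integral_zero,
        mul_zero, Prod.dist_eq, max_le_iff] at h5
      exact dist_le_zero.1 h5.2
    rw [h6, dist_eq_norm] at h4
    rwa [(hZ x k hk).2] at h4 ⊢

section NearMin

variable {n : ℕ} {Ψ : X × X → ℝ} {κ C : ℝ} {k : ℝ → ℕ} {z p : ℝ → X} {q0 q1 : X}

/-- The adjoint equation along `(k, z)`. -/
def Adjoint (t0 t1 : ℝ) (k : ℝ → ℕ) (z p : ℝ → X) : Prop :=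
  Continuous p ∧ ∀ t ∈ Icc t0 t1, p t = p t0 +
    ∫ s in t0..t, -(ContinuousLinearMap.adjoint (Φ.D (k s) s (z s)) (p s))

/-- First-order consequence of near minimality along a sequence of perturbations. -/
theorem NearMin.eventually_le (h01 : t0 ≤ t1) (hmin : Φ.NearMin t0 t1 n Ψ κ k z)
    (hk : Measurable k) (hkn : ∀ t, k t ≤ n) (hz : Φ.Traj t0 t1 k z)
    (hC0 : 0 ≤ C) (hC : ∀ a b, Ψ (a, b) ≤ Ψ (z t0, z t1) + ⟪q0, a - z t0⟫ + ⟪q1, b - z t1⟫ +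
      C * (‖a - z t0‖ ^ 2 + ‖b - z t1‖ ^ 2))
    (hp : Φ.Adjoint t0 t1 k z p) (hp1 : p t1 = -q1)
    {l : ℕ → ℝ → ℕ} (hl : ∀ j, Measurable (l j)) (hln : ∀ j t, l j t ≤ n) {w : ℕ → ℝ → X}
    (hw : ∀ j, Φ.Traj t0 t1 (l j) (w j)) {ρ : ℕ → ℝ} (hρ : ∀ j, 0 < ρ j)
    (hρ0 : Tendsto ρ atTop (𝓝 0))
    (hle : ∀ j, ‖w j t0 - z t0‖ + ∫ s in t0..t1, gap (l j) k s ≤ ρ j) {η : ℝ} (hη : 0 < η) :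
    ∀ᶠ j in atTop, ∫ s in t0..t1, ⟪p s, Φ.F (l j s) s (z s) - Φ.F (k s) s (z s)⟫ ≤
      ⟪q0 - p t0, w j t0 - z t0⟫ + κ * (‖w j t0 - z t0‖ + ∫ s in t0..t1, gap (l j) k s) +
        η * ρ j := by
  have h1 := Φ.tendsto_variation h01 hk hkn hz hp.1 hp.2 hl hln hw hρ hρ0 hle
  set G : ℝ := (1 + 2 * Φ.K) * Real.exp (Φ.K * (t1 - t0)) with hG
  have hK := Φ.K.coe_nonneg
  have hG0 : 0 ≤ G := by positivity
  have hb : ∀ j, ∀ t ∈ Icc t0 t1, ‖w j t - z t‖ ^ 2 ≤ (G * ρ j) ^ 2 := by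
    intro j t ht
    exact pow_le_pow_left₀ (norm_nonneg _)
      ((Traj.norm_sub_le_mul Φ h01 (hl j) hk (hln j) hkn (hw j) hz ht).trans
        (mul_le_mul_of_nonneg_left (hle j) hG0)) 2
  have h2 : Tendsto (fun j => 2 * C * G ^ 2 * ρ j) atTop (𝓝 0) := by
    simpa using hρ0.const_mul (2 * C * G ^ 2)
  filter_upwards [h1.eventually (gt_mem_nhds (half_pos hη)),
    h1.eventually (lt_mem_nhds (neg_lt_zero.2 (half_pos hη))),
    h2.eventually (gt_mem_nhds (half_pos hη))] with j h3 h3' h4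
  rw [lt_div_iff₀ (hρ j)] at h3'
  have h5 := hmin _ _ (hl j) (hln j) (hw j)
  have h6 := hC (w j t0) (w j t1)
  have h7 := mul_le_mul_of_nonneg_left (add_le_add (hb j t0 (left_mem_Icc.2 h01))
    (hb j t1 (right_mem_Icc.2 h01))) hC0
  have h8 := mul_lt_mul_of_pos_right h4 (hρ j)
  rw [hp1, inner_neg_left] at h3'
  rw [inner_sub_left]
  nlinarith

theorem NearMin.norm_sub_le (h01 : t0 ≤ t1) (hmin : Φ.NearMin t0 t1 n Ψ κ k z)
    (hk : Measurable k) (hkn : ∀ t, k t ≤ n) (hz : Φ.Traj t0 t1 k z) (hκ : 0 ≤ κ)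
    (hC0 : 0 ≤ C) (hC : ∀ a b, Ψ (a, b) ≤ Ψ (z t0, z t1) + ⟪q0, a - z t0⟫ + ⟪q1, b - z t1⟫ +
      C * (‖a - z t0‖ ^ 2 + ‖b - z t1‖ ^ 2))
    (hp : Φ.Adjoint t0 t1 k z p) (hp1 : p t1 = -q1) : ‖p t0 - q0‖ ≤ κ := by
  rcases eq_or_ne (p t0 - q0) 0 with h | h
  · simpa [h] using hκ
  have hpos : 0 < ‖p t0 - q0‖ := norm_pos_iff.2 h
  have hs : ∀ j : ℕ, (0 : ℝ) < 1 / (j + 1) := fun j => by positivity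
  choose w hw hw0 using fun j : ℕ =>
    Φ.exists_traj h01 hk (z t0 + (1 / ((j : ℝ) + 1)) • (p t0 - q0))
  have hd : ∀ j, w j t0 - z t0 = (1 / ((j : ℝ) + 1)) • (p t0 - q0) := fun j => by
    rw [hw0, add_sub_cancel_left]
  have hn : ∀ j, ‖w j t0 - z t0‖ = (1 / ((j : ℝ) + 1)) * ‖p t0 - q0‖ := fun j => by
    rw [hd, norm_smul, Real.norm_of_nonneg (hs j).le]
  have hg : ∫ s in t0..t1, gap k k s = 0 := by simp [gap]
  refine le_of_forall_pos_le_add fun η hη => ?_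
  have hev := hmin.eventually_le Φ h01 hk hkn hz hC0 hC hp hp1 (l := fun _ => k) (fun _ => hk)
    (fun _ => hkn) hw (ρ := fun j => (1 / ((j : ℝ) + 1)) * ‖p t0 - q0‖)
    (fun j => mul_pos (hs j) hpos)
    (by simpa using tendsto_one_div_add_atTop_nhds_zero_nat.mul_const ‖p t0 - q0‖)
    (fun j => by rw [hn, hg, add_zero]) hη
  obtain ⟨j, hj⟩ := hev.exists
  simp only [sub_self, inner_zero_right, intervalIntegral.integral_zero, hg, add_zero] at hj
  rw [hn, hd, inner_smul_right, ← neg_sub (p t0) q0, inner_neg_left,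
    real_inner_self_eq_norm_sq] at hj
  have h1 : 0 ≤ (1 / ((j : ℝ) + 1)) * ‖p t0 - q0‖ * (κ + η - ‖p t0 - q0‖) := by linarith
  have h2 := nonneg_of_mul_nonneg_right h1 (mul_pos (hs j) hpos)
  linarith

theorem NearMin.inner_le (h01 : t0 ≤ t1) (hmin : Φ.NearMin t0 t1 n Ψ κ k z)
    (hk : Measurable k) (hkn : ∀ t, k t ≤ n) (hz : Φ.Traj t0 t1 k z) (hκ : 0 ≤ κ)
    (hC0 : 0 ≤ C) (hC : ∀ a b, Ψ (a, b) ≤ Ψ (z t0, z t1) + ⟪q0, a - z t0⟫ + ⟪q1, b - z t1⟫ +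
      C * (‖a - z t0‖ ^ 2 + ‖b - z t1‖ ^ 2))
    (hp : Φ.Adjoint t0 t1 k z p) (hp1 : p t1 = -q1) {i : ℕ} (hi : i ≤ n) :
    ∀ᵐ t ∂volume.restrict (Icc t0 t1), ⟪p t, Φ.F i t (z t) - Φ.F (k t) t (z t)⟫ ≤ n * κ := by
  let J : ℝ → ℝ := fun t => ⟪p t, Φ.F i t (z t) - Φ.F (k t) t (z t)⟫
  have hJm : Measurable J := hp.1.measurable.inner
    ((Φ.measurable_F (k := fun _ => i) measurable_const hz.1.measurable).sub
      (Φ.measurable_F hk hz.1.measurable))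
  suffices H : ∀ η : ℝ, 0 < η → volume {t | t ∈ Icc t0 t1 ∧ n * κ + η < J t} = 0 by
    have h1 : ∀ j : ℕ, ∀ᵐ t ∂volume.restrict (Icc t0 t1), J t ≤ n * κ + 1 / ((j : ℝ) + 1) := by
      intro j
      rw [ae_restrict_iff' measurableSet_Icc, ae_iff]
      refine measure_mono_null (fun t ht => ?_) (H (1 / ((j : ℝ) + 1)) (by positivity))
      simpa [and_assoc] using ht
    filter_upwards [ae_all_iff.2 h1] with t ht
    exact ge_of_tendsto' (by simpa using
      tendsto_one_div_add_atTop_nhds_zero_nat.const_add ((n : ℝ) * κ)) ht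
  intro η hη
  by_contra hne
  have hAm : MeasurableSet {t | t ∈ Icc t0 t1 ∧ n * κ + η < J t} :=
    measurableSet_Icc.inter (measurableSet_lt measurable_const hJm)
  obtain ⟨B, hB, hB0⟩ := exists_shrinking_subsets hAm hne
  classical
  let l : ℕ → ℝ → ℕ := fun j t => if t ∈ B j then i else k t
  have hl : ∀ j, Measurable (l j) := fun j => Measurable.ite (hB j).1 measurable_const hk
  have hln : ∀ j t, l j t ≤ n := by
    intro j t
    by_cases h : t ∈ B j <;> simp [l, h, hi, hkn]
  choose w hw hw0 using fun j : ℕ => Φ.exists_traj h01 (hl j) (z t0)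
  have hint : ∀ (j : ℕ) (c : ℝ), ∫ t in t0..t1, (B j).indicator (fun _ => c) t =
      volume.real (B j) * c := by
    intro j c
    rw [intervalIntegral.integral_of_le h01, ← integral_Icc_eq_integral_Ioc,
      integral_indicator (hB j).1, Measure.restrict_restrict (hB j).1,
      inter_eq_self_of_subset_left fun t ht => ((hB j).2.1 ht).1, setIntegral_const, smul_eq_mul]
  have hii : ∀ (j : ℕ) (c : ℝ), IntervalIntegrable ((B j).indicator fun _ => c) volume t0 t1 := by
    intro j c
    refine intervalIntegrable_of_measurable_bound (measurable_const.indicator (hB j).1)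
      (C := |c|) fun t _ => ?_
    by_cases h : t ∈ B j <;> simp [h]
  have hgap : ∀ j, ∫ s in t0..t1, gap (l j) k s ≤ n * volume.real (B j) := by
    intro j
    rw [mul_comm, ← hint]
    refine intervalIntegral.integral_mono_on h01
      (intervalIntegrable_gap (hl j) hk (hln j) hkn _ _) (hii j n) fun t _ => ?_
    by_cases h : t ∈ B j
    · rw [indicator_of_mem h]
      exact gap_le (hln j) hkn t
    · simp [h, gap, l]
  have hJ : ∀ j, volume.real (B j) * (n * κ + η) ≤
      ∫ s in t0..t1, ⟪p s, Φ.F (l j s) s (z s) - Φ.F (k s) s (z s)⟫ := by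
    intro j
    obtain ⟨P, hP⟩ := isCompact_Icc.exists_bound_of_continuousOn (s := Icc t0 t1)
      hp.1.continuousOn
    rw [← hint]
    refine intervalIntegral.integral_mono_on h01 (hii j _) ?_ fun t _ => ?_
    · refine intervalIntegrable_of_measurable_bound (C := P * (2 * Φ.K))
        (hp.1.measurable.inner ((Φ.measurable_F (hl j) hz.1.measurable).sub
          (Φ.measurable_F hk hz.1.measurable))) ?_
      rw [uIcc_of_le h01]
      intro t ht
      have h3 := (abs_real_inner_le_norm _ _).trans (mul_le_mul (hP t ht)
        (norm_sub_le_of_le (Φ.normF (l j t) t (z t)) (Φ.normF (k t) t (z t)))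
        (norm_nonneg _) ((norm_nonneg _).trans (hP t ht)))
      rw [← two_mul] at h3
      exact h3
    · by_cases h : t ∈ B j
      · rw [indicator_of_mem h]
        simp only [l, h, if_true]
        exact ((hB j).2.1 h).2.le
      · simp [h, l]
  have hρ : ∀ j, 0 < ((n : ℝ) + 1) * volume.real (B j) := fun j =>
    mul_pos (by positivity) (hB j).2.2.2
  have hev := hmin.eventually_le Φ h01 hk hkn hz hC0 hC hp hp1 hl hln hw hρ
    (by simpa using hB0.const_mul ((n : ℝ) + 1)) (fun j => by
      rw [hw0, sub_self, norm_zero, zero_add]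
      have := (hB j).2.2.2
      linarith [hgap j]) (η := η / (2 * (n + 1))) (by positivity)
  obtain ⟨j, hj⟩ := hev.exists
  rw [hw0, sub_self, inner_zero_right, norm_zero, zero_add, zero_add] at hj
  have h1 := mul_le_mul_of_nonneg_left (hgap j) hκ
  have h2 : η / (2 * (n + 1)) * (((n : ℝ) + 1) * volume.real (B j)) =
      η / 2 * volume.real (B j) := by field_simp
  have h3 := mul_pos hη (hB j).2.2.2
  linarith [hJ j]

end NearMin

end SmoothFields

section FuzzySum

variable {Y : Type} [NormedAddCommGroup Y] [InnerProductSpace ℝ Y]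

theorem mem_frechetNC_of_quadratic {S : Set Y} {x v : Y} {r C : ℝ} (hr : 0 < r) (hC : 0 ≤ C)
    (h : ∀ y ∈ S, ‖y - x‖ < r → ⟪v, y - x⟫ ≤ C * ‖y - x‖ ^ 2) : v ∈ frechetNC S x := by
  intro η hη
  refine ⟨min r (η / (C + 1)), by positivity, fun y hy hyx => ?_⟩
  have h1 := h y hy (hyx.trans_le (min_le_left _ _))
  have h2 := (lt_div_iff₀ (by linarith)).1 (hyx.trans_le (min_le_right _ _))
  have h3 := norm_nonneg (y - x)
  nlinarith

theorem norm_sub_sq_expand (a y y' : Y) :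
    ‖y' - a‖ ^ 2 = ‖y - a‖ ^ 2 + 2 * ⟪y - a, y' - y⟫ + ‖y' - y‖ ^ 2 := by
  rw [← norm_add_sq_real, add_comm (y - a), sub_add_sub_cancel]

variable [FiniteDimensional ℝ Y]

theorem exists_fuzzy_sum_of_pos {S : Set Y} (hS : IsClosed S) {y0 : Y} (hy0 : y0 ∈ S) {f : Y → ℝ}
    {L r : ℝ} (hL : 0 ≤ L) (hr : 0 < r)
    (hf : ∀ x ∈ Metric.closedBall y0 r, ∀ y ∈ Metric.closedBall y0 r, |f x - f y| ≤ L * ‖x - y‖)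
    {q : Y} {lam C : ℝ} (hlam : 0 < lam) (hC : 0 ≤ C)
    (hmin : ∀ y ∈ S, ‖y - y0‖ ≤ r → 0 ≤ ⟪q, y - y0⟫ + lam * (f y - f y0) + C * ‖y - y0‖ ^ 2)
    {η : ℝ} (hη : 0 < η) :
    ∃ y' y'' ζ ν, ‖y' - y0‖ ≤ η ∧ ‖y'' - y0‖ ≤ η ∧ y'' ∈ S ∧ ζ ∈ proxSubdiff f y' ∧
      ‖ζ‖ ≤ 2 * L ∧ ν ∈ frechetNC S y'' ∧ ‖q + lam • ζ + ν‖ ≤ η := by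
  obtain ⟨θ, hθ, hθr, hθη, hθC⟩ : ∃ θ : ℝ, 0 < θ ∧ 2 * θ < r ∧ 2 * θ ≤ η ∧
      2 * (C + 1) * θ ≤ η := by
    refine ⟨min (r / 4) (min (η / 2) (η / (2 * (C + 1)))), by positivity, ?_, ?_, ?_⟩
    · linarith [min_le_left (r / 4) (min (η / 2) (η / (2 * (C + 1))))]
    · linarith [(min_le_right (r / 4) (min (η / 2) (η / (2 * (C + 1))))).trans (min_le_left _ _)]
    · have h := (min_le_right (r / 4) (min (η / 2) (η / (2 * (C + 1))))).trans (min_le_right _ _)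
      rw [le_div_iff₀ (by positivity)] at h
      linarith
  set M := lam * L
  have hM : 0 ≤ M := by positivity
  obtain ⟨N, hN, hN1, hN2⟩ : ∃ N : ℝ, 0 < N ∧ M ≤ N * θ ∧ M ^ 2 ≤ N * θ ^ 2 := by
    refine ⟨M / θ + M ^ 2 / θ ^ 2 + 1, by positivity, ?_, ?_⟩
    · have : M / θ * θ = M := by field_simp
      have : 0 ≤ M ^ 2 / θ ^ 2 * θ := by positivity
      linarith
    · have : M ^ 2 / θ ^ 2 * θ ^ 2 = M ^ 2 := by field_simp
      have : 0 ≤ M / θ * θ ^ 2 := by positivity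
      have : 0 < θ ^ 2 := by positivity
      linarith
  let B := Metric.closedBall y0 r
  have hy0B : y0 ∈ B := Metric.mem_closedBall_self hr.le
  have hfc : ContinuousOn f B := by
    refine LipschitzOnWith.continuousOn (K := L.toNNReal) (LipschitzOnWith.of_dist_le_mul
      fun x hx y hy => ?_)
    rw [Real.dist_eq, dist_eq_norm, Real.coe_toNNReal _ hL]
    exact hf x hx y hy
  have hcpt : IsCompact ((S ∩ B) ×ˢ B) :=
    (((isCompact_closedBall y0 r).inter_left hS)).prod (isCompact_closedBall y0 r)
  let φ : Y × Y → ℝ := fun w => ⟪q, w.1 - y0⟫ + lam * f w.2 + (C + 1) * ‖w.1 - y0‖ ^ 2 +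
    N * ‖w.1 - w.2‖ ^ 2
  have hφ : ContinuousOn φ ((S ∩ B) ×ˢ B) := by
    have h1 : ContinuousOn (fun w : Y × Y => f w.2) ((S ∩ B) ×ˢ B) :=
      hfc.comp continuousOn_snd fun w hw => hw.2
    exact ((by fun_prop : Continuous fun w : Y × Y => ⟪q, w.1 - y0⟫).continuousOn.add
      (continuousOn_const.mul h1)).add
      (by fun_prop : Continuous fun w : Y × Y => (C + 1) * ‖w.1 - y0‖ ^ 2).continuousOn |>.add
      (by fun_prop : Continuous fun w : Y × Y => N * ‖w.1 - w.2‖ ^ 2).continuousOn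
  obtain ⟨⟨y, z⟩, ⟨⟨hyS, hyB⟩, hzB⟩, hmin'⟩ := hcpt.exists_isMinOn
    ⟨(y0, y0), ⟨hy0, hy0B⟩, hy0B⟩ hφ
  replace hmin' : ∀ y' ∈ S, y' ∈ B → ∀ z' ∈ B, φ (y, z) ≤ φ (y', z') :=
    fun y' h1 h2 z' h3 => hmin' ⟨⟨h1, h2⟩, h3⟩
  simp only [φ] at hmin'
  have hyB' : ‖y - y0‖ ≤ r := by rw [← dist_eq_norm]; exact hyB
  have hLyz := (abs_le.1 (hf y hyB z hzB)).2
  have h1 := hmin' y hyS hyB y hyB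
  have h2 := hmin' y0 hy0 hy0B y0 hy0B
  have h3 := hmin y hyS hyB'
  simp only [sub_self, norm_zero, inner_zero_right] at h1 h2
  have hLl := mul_le_mul_of_nonneg_left hLyz hlam.le
  have h0 := norm_nonneg (y - z)
  have hyz : N * ‖y - z‖ ≤ M := by
    rcases h0.eq_or_lt with h | h
    · rw [← h, mul_zero]; exact hM
    · refine le_of_mul_le_mul_right ?_ h
      simp only [M]
      linarith
  have hyz' : ‖y - z‖ ≤ θ := le_of_mul_le_mul_left (hyz.trans hN1) hN
  have hyy0 : ‖y - y0‖ ≤ θ := by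
    refine abs_le_of_sq_le_sq' ?_ hθ.le |>.2
    have h4 : ‖y - y0‖ ^ 2 ≤ M * ‖y - z‖ := by
      have : 0 ≤ N * ‖y - z‖ ^ 2 := by positivity
      simp only [M]
      linarith
    refine le_of_mul_le_mul_left ?_ hN
    have := mul_le_mul_of_nonneg_left hyz hM
    have := mul_le_mul_of_nonneg_left h4 hN.le
    linarith [sq M]
  have hzy0 : ‖z - y0‖ ≤ 2 * θ := by
    have := norm_sub_le_norm_sub_add_norm_sub z y y0
    rw [norm_sub_rev z y] at this
    linarith
  refine ⟨z, y, (2 * N / lam) • (y - z), -(q + (2 * (C + 1)) • (y - y0) + (2 * N) • (y - z)),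
    hzy0.trans hθη, by linarith, hyS, ?_, ?_, ?_, ?_⟩
  · refine ⟨N / lam, by positivity, r - 2 * θ, by linarith, fun z' hz' => ?_⟩
    have hz'B : z' ∈ B := by
      rw [Metric.mem_closedBall, dist_eq_norm]
      linarith [norm_sub_le_norm_sub_add_norm_sub z' z y0]
    have h4 := hmin' y hyS hyB z' hz'B
    have h5 := norm_sub_sq_expand y z z'
    rw [norm_sub_rev z' y, norm_sub_rev z y, ← neg_sub y z, inner_neg_left] at h5
    rw [h5] at h4
    rw [inner_smul_left, RCLike.conj_to_real]
    refine le_of_mul_le_mul_left ?_ hlam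
    have : lam * (f z + 2 * N / lam * ⟪y - z, z' - z⟫ - N / lam * ‖z' - z‖ ^ 2) =
        lam * f z + 2 * N * ⟪y - z, z' - z⟫ - N * ‖z' - z‖ ^ 2 := by field_simp
    rw [this]
    linarith
  · rw [norm_smul, Real.norm_of_nonneg (by positivity), div_mul_eq_mul_div, div_le_iff₀ hlam]
    simp only [M] at hyz
    linarith
  · refine mem_frechetNC_of_quadratic (r := r - θ) (C := C + 1 + N) (by linarith) (by linarith)
      fun y' hy' hyy' => ?_
    have hy'B : y' ∈ B := by
      rw [Metric.mem_closedBall, dist_eq_norm]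
      linarith [norm_sub_le_norm_sub_add_norm_sub y' y y0]
    have h4 := hmin' y' hy' hy'B z hzB
    rw [norm_sub_sq_expand y0 y y', norm_sub_sq_expand z y y',
      ← sub_add_sub_cancel y' y y0, inner_add_right] at h4
    simp only [inner_neg_left, inner_add_left, inner_smul_left, RCLike.conj_to_real]
    linarith
  · have : q + lam • (2 * N / lam) • (y - z) +
        -(q + (2 * (C + 1)) • (y - y0) + (2 * N) • (y - z)) = -((2 * (C + 1)) • (y - y0)) := by
      rw [smul_smul, mul_div_cancel₀ _ hlam.ne']
      abel
    rw [this, norm_neg, norm_smul, Real.norm_of_nonneg (by positivity)]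
    exact (mul_le_mul_of_nonneg_left hyy0 (by positivity)).trans hθC

/-- Approximate multiplier rule for minimising a linear perturbation of a Lipschitz function
over a closed set. -/
theorem exists_fuzzy_sum {S : Set Y} (hS : IsClosed S) {y0 : Y} (hy0 : y0 ∈ S) {f : Y → ℝ}
    {L r : ℝ} (hL : 0 ≤ L) (hr : 0 < r)
    (hf : ∀ x ∈ Metric.closedBall y0 r, ∀ y ∈ Metric.closedBall y0 r, |f x - f y| ≤ L * ‖x - y‖)
    {q : Y} {lam C : ℝ} (hlam : 0 ≤ lam) (hC : 0 ≤ C)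
    (hmin : ∀ y ∈ S, ‖y - y0‖ ≤ r → 0 ≤ ⟪q, y - y0⟫ + lam * (f y - f y0) + C * ‖y - y0‖ ^ 2)
    {η : ℝ} (hη : 0 < η) :
    ∃ y' y'' ζ ν, ‖y' - y0‖ ≤ η ∧ ‖y'' - y0‖ ≤ η ∧ y'' ∈ S ∧ ζ ∈ proxSubdiff f y' ∧
      ‖ζ‖ ≤ 2 * L ∧ ν ∈ frechetNC S y'' ∧ ‖q + lam • ζ + ν‖ ≤ η := by
  rcases hlam.eq_or_lt with rfl | hlam
  swap
  · exact exists_fuzzy_sum_of_pos hS hy0 hL hr hf hlam hC hmin hη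
  obtain ⟨y', -, ζ, -, h1, -, -, h2, h3, -, -⟩ := exists_fuzzy_sum_of_pos
    (isClosed_singleton (x := y0)) rfl hL hr hf (q := 0) one_pos le_rfl (by simp) hη
  refine ⟨y', y0, ζ, -q, h1, by simpa using hη.le, hy0, h2, h3,
    mem_frechetNC_of_quadratic hr hC fun y hy hyr => ?_, by simpa using hη.le⟩
  have := hmin y hy hyr.le
  rw [inner_neg_left]
  linarith

end FuzzySum

section Penalty

variable {Y : Type} [NormedAddCommGroup Y] [InnerProductSpace ℝ Y] [FiniteDimensional ℝ Y]

theorem posPart_sq_sub_le (a b c : ℝ) :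
    (max (b - c) 0) ^ 2 - (max (a - c) 0) ^ 2 ≤ 2 * max (a - c) 0 * (b - a) + (b - a) ^ 2 := by
  rcases le_total (a - c) 0 with h | h <;> rcases le_total (b - c) 0 with h' | h' <;>
    simp only [max_eq_left, max_eq_right, h, h'] <;> nlinarith

/-- The distance from `(e, 0)` to the truncated epigraphical image of `f` over `S` is a
continuous merit function; it is superdifferentiable, with supergradients of multiplier type,
away from its zeros. -/
theorem exists_merit_function {S : Set Y} (hS : IsClosed S) {y0 : Y} (hy0 : y0 ∈ S) {f : Y → ℝ}
    {L r : ℝ} (hL : 0 ≤ L) (hr : 0 < r)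
    (hf : ∀ x ∈ Metric.closedBall y0 r, ∀ y ∈ Metric.closedBall y0 r, |f x - f y| ≤ L * ‖x - y‖)
    {κ : ℝ} :
    ∃ Ψ : Y → ℝ, Continuous Ψ ∧ (∀ e, 0 ≤ Ψ e) ∧ Ψ y0 ≤ κ ^ 2 ∧
      ∀ e, ¬(e ∈ S ∧ f e ≤ f y0 - κ ^ 2) →
        ∃ q y lam C, 0 ≤ lam ∧ 0 ≤ C ∧ ‖q‖ ^ 2 + lam ^ 2 = 1 ∧ y ∈ S ∧
          ‖y - y0‖ ≤ 2 * ‖e - y0‖ + κ ^ 2 ∧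
          (∀ e', Ψ e' ≤ Ψ e + ⟪q, e' - e⟫ + C * ‖e' - e‖ ^ 2) ∧
          ∀ y' ∈ S, ‖y' - y0‖ ≤ r →
            0 ≤ ⟪-q, y' - y⟫ + lam * (f y' - f y) + C * ‖y' - y‖ ^ 2 := by
  let B := Metric.closedBall y0 r
  let a : Y → ℝ := fun y => max (f y - (f y0 - κ ^ 2)) 0
  have ha0 : ∀ y, 0 ≤ a y := fun y => le_max_right _ _
  let G : Y → WithLp 2 (Y × ℝ) := fun y => WithLp.toLp 2 (y, a y)
  let P : Y → WithLp 2 (Y × ℝ) := fun y => WithLp.toLp 2 (y, 0)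
  let T := G '' (S ∩ B)
  have hfc : ContinuousOn f B := by
    refine LipschitzOnWith.continuousOn (K := L.toNNReal) (LipschitzOnWith.of_dist_le_mul
      fun x hx y hy => ?_)
    rw [Real.dist_eq, dist_eq_norm, Real.coe_toNNReal _ hL]
    exact hf x hx y hy
  have hT : IsCompact T := by
    refine ((isCompact_closedBall y0 r).inter_left hS).image_of_continuousOn ?_
    refine (WithLp.prod_continuous_toLp 2 Y ℝ).comp_continuousOn ?_
    exact continuousOn_id.prodMk (((hfc.mono inter_subset_right).sub continuousOn_const).sup
      continuousOn_const)
  have hy0B : y0 ∈ B := Metric.mem_closedBall_self hr.le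
  have hTn : T.Nonempty := ⟨G y0, y0, ⟨hy0, hy0B⟩, rfl⟩
  have hdist : ∀ e y, dist (P e) (G y) ^ 2 = ‖e - y‖ ^ 2 + a y ^ 2 := by
    intro e y
    rw [dist_eq_norm, WithLp.prod_norm_sq_eq_of_L2]
    simp [P, G]
  have hP : ∀ e e', dist (P e) (P e') = ‖e - e'‖ := by
    intro e e'
    rw [dist_eq_norm, ← sq_eq_sq₀ (norm_nonneg _) (norm_nonneg _), WithLp.prod_norm_sq_eq_of_L2]
    simp [P]
  have hle : ∀ e, ∀ y ∈ S, y ∈ B → Metric.infDist (P e) T ^ 2 ≤ ‖e - y‖ ^ 2 + a y ^ 2 := by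
    intro e y hy hyB
    have hmem : G y ∈ T := mem_image_of_mem G ⟨hy, hyB⟩
    rw [← hdist]
    exact pow_le_pow_left₀ Metric.infDist_nonneg (Metric.infDist_le_dist_of_mem hmem) 2
  have hΨ0 : Metric.infDist (P y0) T ≤ κ ^ 2 := by
    refine abs_le_of_sq_le_sq' ((hle y0 y0 hy0 hy0B).trans_eq ?_) (sq_nonneg κ) |>.2
    simp [a, sq_nonneg]
  refine ⟨fun e => Metric.infDist (P e) T, ?_, fun e => Metric.infDist_nonneg, hΨ0,
    fun e hne => ?_⟩
  · refine (Metric.continuous_infDist_pt T).comp ?_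
    exact (WithLp.prod_continuous_toLp 2 Y ℝ).comp (by fun_prop)
  obtain ⟨_, ⟨y, ⟨hyS, hyB⟩, rfl⟩, hy⟩ := hT.exists_infDist_eq_dist hTn (P e)
  set h := Metric.infDist (P e) T with hh
  have hsq : h ^ 2 = ‖e - y‖ ^ 2 + a y ^ 2 := by rw [hy, hdist]
  have h0 : 0 ≤ h := Metric.infDist_nonneg
  have hpos : 0 < h := by
    refine h0.lt_of_ne fun h1 => hne ?_
    rw [← h1] at hsq
    have h2 : ‖e - y‖ = 0 := by nlinarith [sq_nonneg ‖e - y‖, sq_nonneg (a y)]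
    have h3 : a y = 0 := by nlinarith [sq_nonneg ‖e - y‖, sq_nonneg (a y)]
    rw [norm_sub_eq_zero_iff] at h2
    rw [h2]
    refine ⟨hyS, ?_⟩
    have : f y - (f y0 - κ ^ 2) ≤ a y := le_max_left _ _
    linarith
  have hey : ‖e - y‖ ≤ h := abs_le_of_sq_le_sq' (by rw [hsq]; linarith [sq_nonneg (a y)]) h0 |>.2
  have hhle : h ≤ κ ^ 2 + ‖e - y0‖ := by
    have := Metric.infDist_le_infDist_add_dist (s := T) (x := P e) (y := P y0)
    rw [hP] at this
    linarith
  refine ⟨h⁻¹ • (e - y), y, h⁻¹ * a y, (1 + L ^ 2) * (2 * h)⁻¹, by have := ha0 y; positivity,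
    by positivity, ?_, hyS, ?_, fun e' => ?_, fun y' hy' hy'r => ?_⟩
  · rw [norm_smul, Real.norm_of_nonneg (by positivity), mul_pow, mul_pow, ← mul_add, ← hsq]
    field_simp
  · have := norm_sub_le_norm_sub_add_norm_sub y e y0
    rw [norm_sub_rev y e] at this
    linarith
  · have h1 := hle e' y hyS hyB
    rw [norm_sub_sq_expand y e e'] at h1
    set h' := Metric.infDist (P e') T
    have h2 : 2 * h * h' ≤ 2 * h * (h + ⟪h⁻¹ • (e - y), e' - e⟫ + (2 * h)⁻¹ * ‖e' - e‖ ^ 2) := by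
      have e1 : 2 * h * (h + ⟪h⁻¹ • (e - y), e' - e⟫ + (2 * h)⁻¹ * ‖e' - e‖ ^ 2) =
          2 * h ^ 2 + 2 * ⟪e - y, e' - e⟫ + ‖e' - e‖ ^ 2 := by
        rw [inner_smul_left, RCLike.conj_to_real]
        field_simp
      rw [e1]
      nlinarith [sq_nonneg (h - h')]
    have h3 := le_of_mul_le_mul_left h2 (by positivity)
    have h4 : 0 ≤ L ^ 2 * (2 * h)⁻¹ * ‖e' - e‖ ^ 2 := by positivity
    linarith
  · have hy'B : y' ∈ B := by rw [Metric.mem_closedBall, dist_eq_norm]; exact hy'r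
    have h1 := hle e y' hy' hy'B
    rw [← hh, hsq, norm_sub_rev e y', norm_sub_sq_expand e y y', norm_sub_rev e y] at h1
    have h2 := posPart_sq_sub_le (f y) (f y') (f y0 - κ ^ 2)
    have h3 : (f y' - f y) ^ 2 ≤ L ^ 2 * ‖y' - y‖ ^ 2 := by
      rw [← mul_pow, ← sq_abs]
      exact pow_le_pow_left₀ (abs_nonneg _) (hf y' hy'B y hyB) 2
    change a y' ^ 2 - a y ^ 2 ≤ 2 * a y * _ + _ at h2
    refine nonneg_of_mul_nonneg_right (a := 2 * h) ?_ (by positivity)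
    have e1 : 2 * h * (⟪-(h⁻¹ • (e - y)), y' - y⟫ + h⁻¹ * a y * (f y' - f y) +
        (1 + L ^ 2) * (2 * h)⁻¹ * ‖y' - y‖ ^ 2) = 2 * ⟪y - e, y' - y⟫ + 2 * a y * (f y' - f y) +
        (1 + L ^ 2) * ‖y' - y‖ ^ 2 := by
      rw [← smul_neg, neg_sub, inner_smul_left, RCLike.conj_to_real]
      field_simp
    rw [e1]
    linarith

end Penalty

theorem inner_pl2 {X Y : Type} [NormedAddCommGroup X] [InnerProductSpace ℝ X]
    [NormedAddCommGroup Y] [InnerProductSpace ℝ Y] (w : PL2 X Y) (a : X) (b : Y) :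
    ⟪w, pl2 a b⟫ = ⟪pl2fst w, a⟫ + ⟪pl2snd w, b⟫ := WithLp.prod_inner_apply _ _

theorem norm_pl2_sq {X Y : Type} [NormedAddCommGroup X] [InnerProductSpace ℝ X]
    [NormedAddCommGroup Y] [InnerProductSpace ℝ Y] (a : X) (b : Y) :
    ‖pl2 a b‖ ^ 2 = ‖a‖ ^ 2 + ‖b‖ ^ 2 := WithLp.prod_norm_sq_eq_of_L2 _

theorem norm_pl2_le {X Y : Type} [NormedAddCommGroup X] [InnerProductSpace ℝ X]
    [NormedAddCommGroup Y] [InnerProductSpace ℝ Y] (a : X) (b : Y) :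
    ‖pl2 a b‖ ≤ ‖a‖ + ‖b‖ := by
  refine abs_le_of_sq_le_sq' ?_ (by positivity) |>.2
  rw [norm_pl2_sq]
  nlinarith [norm_nonneg a, norm_nonneg b]

theorem pl2_sub_pl2 {X Y : Type} [NormedAddCommGroup X] [NormedAddCommGroup Y]
    (a a' : X) (b b' : Y) : pl2 a b - pl2 a' b' = pl2 (a - a') (b - b') := rfl

theorem continuous_pl2 {X Y : Type} [NormedAddCommGroup X] [NormedAddCommGroup Y] :
    Continuous fun w : X × Y => pl2 w.1 w.2 := WithLp.prod_continuous_toLp 2 X Y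

namespace SmoothFields

variable {X : Type} [NormedAddCommGroup X] [InnerProductSpace ℝ X] [FiniteDimensional ℝ X]
  [MeasurableSpace X] [BorelSpace X] (Φ : SmoothFields X) {t0 t1 : ℝ}

theorem Traj.norm_le (h01 : t0 ≤ t1) (hF0 : ∀ t, Φ.F 0 t 0 = 0) {k : ℝ → ℕ} {n : ℕ}
    (hk : Measurable k) (hkn : ∀ t, k t ≤ n) {z : ℝ → X} (hz : Φ.Traj t0 t1 k z) {t : ℝ}
    (ht : t ∈ Icc t0 t1) :
    ‖z t‖ ≤ ((1 + 2 * Φ.K) * Real.exp (Φ.K * (t1 - t0))) *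
      (‖z t0‖ + ∫ s in t0..t1, gap k (fun _ => 0) s) := by
  have h0 : Φ.Traj t0 t1 (fun _ => 0) fun _ => (0 : X) :=
    ⟨continuous_const, fun t _ => by simp [hF0]⟩
  simpa using Traj.norm_sub_le_mul Φ h01 hk measurable_const hkn (fun _ => Nat.zero_le _) hz h0 ht

/-- The reference arc `0` is optimal among small trajectories with selections below `n`. -/
def LocalMin (t0 t1 : ℝ) (f : PL2 X X → ℝ) (S : Set (PL2 X X)) (e : PL2 X X) (n : ℕ) (ρ : ℝ) :
    Prop :=
  ∀ k z, Measurable k → (∀ t, k t ≤ n) → Φ.Traj t0 t1 k z → (∀ t ∈ Icc t0 t1, ‖z t‖ ≤ ρ) →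
    ∫ t in t0..t1, gap k (fun _ => 0) t ≤ ρ → e + pl2 (z t0) (z t1) ∈ S →
      f e ≤ f (e + pl2 (z t0) (z t1))

theorem exists_approx_multipliers (h01 : t0 ≤ t1) (hF0 : ∀ t, Φ.F 0 t 0 = 0)
    {S : Set (PL2 X X)} (hS : IsClosed S) {e : PL2 X X} (he : e ∈ S) {f : PL2 X X → ℝ}
    {L r : ℝ} (hL : 0 ≤ L) (hr : 0 < r)
    (hf : ∀ x ∈ Metric.closedBall e r, ∀ y ∈ Metric.closedBall e r, |f x - f y| ≤ L * ‖x - y‖)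
    {n : ℕ} {ρ : ℝ} (hρ : 0 < ρ) (hmin : Φ.LocalMin t0 t1 f S e n ρ) {θ : ℝ} (hθ : 0 < θ) :
    ∃ (k : ℝ → ℕ) (z p : ℝ → X) (q y' y'' ζ ν : PL2 X X) (lam : ℝ),
      (Measurable k ∧ (∀ t, k t ≤ n) ∧ ∫ t in t0..t1, gap k (fun _ => 0) t ≤ θ) ∧
      (Continuous z ∧ ∀ t ∈ Icc t0 t1, ‖z t‖ ≤ θ) ∧
      (Φ.Adjoint t0 t1 k z p ∧ p t1 = -pl2snd q ∧ ‖p t0 - pl2fst q‖ ≤ θ) ∧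
      (0 ≤ lam ∧ ‖q‖ ^ 2 + lam ^ 2 = 1) ∧
      (∀ i ≤ n, ∀ᵐ t ∂volume.restrict (Icc t0 t1),
        ⟪p t, Φ.F i t (z t) - Φ.F (k t) t (z t)⟫ ≤ θ) ∧
      (‖y' - e‖ ≤ θ ∧ ζ ∈ proxSubdiff f y' ∧ ‖ζ‖ ≤ 2 * L) ∧
      (‖y'' - e‖ ≤ θ ∧ y'' ∈ S ∧ ν ∈ frechetNC S y'') ∧ ‖-q + lam • ζ + ν‖ ≤ θ := by
  set M : ℝ := (1 + 2 * Φ.K) * Real.exp (Φ.K * (t1 - t0)) with hM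
  have hM0 : 0 ≤ M := by have := Φ.K.coe_nonneg; positivity
  obtain ⟨κ, hκ, hκ1, hκρ, hκθ, hMρ, hMθ, hnθ, h8θ, h8r⟩ : ∃ κ : ℝ, 0 < κ ∧ κ ≤ 1 ∧ κ ≤ ρ ∧
      κ ≤ θ ∧ M * (2 * κ) ≤ ρ ∧ M * (2 * κ) ≤ θ ∧ n * κ ≤ θ ∧ 8 * M * κ + 2 * κ ≤ θ ∧
      8 * M * κ + 2 * κ ≤ r / 2 := by
    set β := min (min ρ θ) (min r 1)
    have hβ : 0 < β := by positivity
    have h1 : β ≤ ρ := (min_le_left _ _).trans (min_le_left _ _)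
    have h2 : β ≤ θ := (min_le_left _ _).trans (min_le_right _ _)
    have h3 : β ≤ r := (min_le_right _ _).trans (min_le_left _ _)
    have h4 : β ≤ 1 := (min_le_right _ _).trans (min_le_right _ _)
    have hD : 0 < 16 * M + 4 + 2 * (n : ℝ) := by positivity
    have hκ : 0 < β / (16 * M + 4 + 2 * n) := by positivity
    have h5 : β / (16 * M + 4 + 2 * n) * (16 * M + 4 + 2 * n) = β := div_mul_cancel₀ _ hD.ne'
    set κ := β / (16 * M + 4 + 2 * n)
    have h6 : 0 ≤ M * κ := by positivity
    have h7 : 0 ≤ n * κ := by positivity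
    exact ⟨κ, hκ, by linarith, by linarith, by linarith, by linarith, by linarith, by linarith,
      by linarith, by linarith⟩
  obtain ⟨Ψ, hΨc, hΨ0, hΨe, hΨ⟩ := exists_merit_function hS he hL hr hf (κ := κ)
  obtain ⟨k, z, hk, hkn, hz, hz0, hkκ, hnm⟩ := Φ.exists_nearMin h01 hF0 n
    (Ψ := fun w => Ψ (e + pl2 w.1 w.2)) (hΨc.comp (continuous_const.add continuous_pl2))
    (fun _ => hΨ0 _) hκ (by
      have h0 : pl2 (0 : X) (0 : X) = 0 := rfl
      simpa [h0] using hΨe)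
  have hzb : ∀ t ∈ Icc t0 t1, ‖z t‖ ≤ M * (2 * κ) := fun t ht =>
    (Traj.norm_le Φ h01 hF0 hk hkn hz ht).trans (mul_le_mul_of_nonneg_left (by linarith) hM0)
  have hend : ‖e + pl2 (z t0) (z t1) - e‖ ≤ 4 * M * κ := by
    rw [add_sub_cancel_left]
    have h1 := norm_pl2_le (z t0) (z t1)
    have h2 := hzb t0 (left_mem_Icc.2 h01)
    have h3 := hzb t1 (right_mem_Icc.2 h01)
    linarith
  have hκ2 : κ ^ 2 ≤ κ := by nlinarith
  obtain ⟨q, y, lam, C, hlam, hC, hql, hyS, hye, hsup, hmy⟩ := hΨ (e + pl2 (z t0) (z t1)) (by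
    rintro ⟨h1, h2⟩
    have h3 := hmin k z hk hkn hz (fun t ht => (hzb t ht).trans hMρ) (hkκ.trans hκρ) h1
    have : 0 < κ ^ 2 := by positivity
    linarith)
  have hye' : ‖y - e‖ ≤ 8 * M * κ + κ := by linarith
  have hball : Metric.closedBall y (r / 2) ⊆ Metric.closedBall e r := by
    refine Metric.closedBall_subset_closedBall' ?_
    rw [dist_eq_norm]
    linarith
  obtain ⟨y', y'', ζ, ν, h1, h2, h3, h4, h5, h6, h7⟩ := exists_fuzzy_sum hS hyS hL (half_pos hr)
    (fun x hx y hy => hf x (hball hx) y (hball hy)) (q := -q) hlam hC (fun y'' hy'' hyy => hmy _ hy''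
      (by
        have := norm_sub_le_norm_sub_add_norm_sub y'' y e
        linarith)) hκ
  have hqX : ∀ a b : X, Ψ (e + pl2 a b) ≤ Ψ (e + pl2 (z t0) (z t1)) + ⟪pl2fst q, a - z t0⟫ +
      ⟪pl2snd q, b - z t1⟫ + C * (‖a - z t0‖ ^ 2 + ‖b - z t1‖ ^ 2) := by
    intro a b
    have := hsup (e + pl2 a b)
    rwa [add_sub_add_left_eq_sub, pl2_sub_pl2, inner_pl2, norm_pl2_sq, ← add_assoc] at this
  obtain ⟨p, hpc, hp1, hp, -⟩ := exists_adjoint_arc h01 (Φ.measurable_D hk hz.1.measurable)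
    (fun t => Φ.normD (k t) t (z t)) (-pl2snd q)
  have hadj : Φ.Adjoint t0 t1 k z p := ⟨hpc, hp⟩
  refine ⟨k, z, p, q, y', y'', ζ, ν, lam, ⟨hk, hkn, hkκ.trans hκθ⟩,
    ⟨hz.1, fun t ht => (hzb t ht).trans hMθ⟩,
    ⟨hadj, hp1, (hnm.norm_sub_le Φ h01 hk hkn hz hκ.le hC hqX hadj hp1).trans hκθ⟩,
    ⟨hlam, hql⟩, fun i hi => ?_, ⟨?_, h4, h5⟩, ⟨?_, h3, h6⟩, h7.trans hκθ⟩
  · filter_upwards [hnm.inner_le Φ h01 hk hkn hz hκ.le hC hqX hadj hp1 hi] with t ht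
    exact ht.trans hnθ
  · linarith [norm_sub_le_norm_sub_add_norm_sub y' y e]
  · linarith [norm_sub_le_norm_sub_add_norm_sub y'' y e]

end SmoothFields

section Cones

variable {Y : Type} [NormedAddCommGroup Y] [InnerProductSpace ℝ Y]

theorem smul_mem_frechetNC {S : Set Y} {x v : Y} (hv : v ∈ frechetNC S x) {c : ℝ} (hc : 0 < c) :
    c • v ∈ frechetNC S x := by
  intro η hη
  obtain ⟨δ, hδ, h⟩ := hv (η / c) (by positivity)
  refine ⟨δ, hδ, fun y hy hyx => ?_⟩
  rw [inner_smul_left, RCLike.conj_to_real]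
  have := mul_le_mul_of_nonneg_left (h y hy hyx) hc.le
  rwa [← mul_assoc, mul_div_cancel₀ _ hc.ne'] at this

theorem smul_mem_limitingNC {S : Set Y} {x v : Y} (hv : v ∈ limitingNC S x) {c : ℝ} (hc : 0 < c) :
    c • v ∈ limitingNC S x := by
  obtain ⟨xs, vs, h, hx, hvs⟩ := hv
  exact ⟨xs, fun n => c • vs n, fun n => ⟨(h n).1, smul_mem_frechetNC (h n).2 hc⟩, hx,
    hvs.const_smul c⟩

theorem frechetNC_subset_clarkeNC {S : Set Y} {x v : Y} (hx : x ∈ S) (hv : v ∈ frechetNC S x) :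
    v ∈ clarkeNC S x :=
  subset_closure (subset_convexHull ℝ _ ⟨fun _ => x, fun _ => v, fun _ => ⟨hx, hv⟩,
    tendsto_const_nhds, tendsto_const_nhds⟩)

theorem eq_zero_of_mem_frechetNC_univ {x v : Y} (hv : v ∈ frechetNC univ x) : v = 0 := by
  by_contra hne
  have hpos : 0 < ‖v‖ := norm_pos_iff.2 hne
  obtain ⟨δ, hδ, h⟩ := hv (‖v‖ / 2) (by positivity)
  have hs : 0 < δ / (2 * ‖v‖) := by positivity
  have h1 : ‖x + (δ / (2 * ‖v‖)) • v - x‖ = δ / 2 := by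
    rw [add_sub_cancel_left, norm_smul, Real.norm_of_nonneg hs.le]
    field_simp
  have h2 := h (x + (δ / (2 * ‖v‖)) • v) trivial (by rw [h1]; linarith)
  rw [h1, add_sub_cancel_left, inner_smul_right, real_inner_self_eq_norm_sq] at h2
  have h3 : δ / (2 * ‖v‖) * ‖v‖ ^ 2 = δ / 2 * ‖v‖ := by field_simp
  rw [h3] at h2
  nlinarith

theorem eq_zero_of_mem_limitingNC_univ {x v : Y} (hv : v ∈ limitingNC univ x) : v = 0 := by
  obtain ⟨xs, vs, h, -, hvs⟩ := hv
  have : vs = fun _ => 0 := funext fun n => eq_zero_of_mem_frechetNC_univ (h n).2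
  rw [this] at hvs
  exact tendsto_nhds_unique hvs tendsto_const_nhds

end Cones

theorem eq_add_integral_of_integral_eq {X : Type*} [NormedAddCommGroup X] [NormedSpace ℝ X] {t0 t1 s : ℝ}
    {p d : ℝ → X} (hd : ∀ a b, IntervalIntegrable d volume a b)
    (hp : ∀ t ∈ Icc t0 t1, p t = p t0 + ∫ s in t0..t, d s) (hs : s ∈ Icc t0 t1) {t : ℝ}
    (ht : t ∈ Icc t0 t1) : p t = p s + ∫ r in s..t, d r := by
  rw [hp t ht, hp s hs, add_assoc, intervalIntegral.integral_add_adjacent_intervals (hd _ _)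
    (hd _ _)]

/-- A solution of a homogeneous linear differential inequality vanishing somewhere vanishes. -/
theorem eq_zero_of_norm_deriv_le {X : Type*} [NormedAddCommGroup X] [NormedSpace ℝ X]
    {t0 t1 K : ℝ} (hK : 0 ≤ K) {p d : ℝ → X} (hpc : Continuous p)
    (hd : ∀ a b, IntervalIntegrable d volume a b) (hdp : ∀ t, ‖d t‖ ≤ K * ‖p t‖)
    (hp : ∀ t ∈ Icc t0 t1, p t = p t0 + ∫ s in t0..t, d s) {s : ℝ} (hs : s ∈ Icc t0 t1)
    (h0 : p s = 0) {t : ℝ} (ht : t ∈ Icc t0 t1) : p t = 0 := by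
  have hi : ∀ a b, IntervalIntegrable (fun t => K * ‖p t‖) volume a b := fun a b => by
    apply Continuous.intervalIntegrable; fun_prop
  rw [← norm_le_zero_iff]
  rcases le_total s t with hst | hst
  · have := gronwall_integral (t0 := s) (t1 := t1) hpc.norm (fun _ => norm_nonneg _) le_rfl hK
      (fun r hr => ?_) t ⟨hst, ht.2⟩
    · simpa using this
    · rw [eq_add_integral_of_integral_eq hd hp hs ⟨hs.1.trans hr.1, hr.2⟩, h0, zero_add, zero_add,
        ← intervalIntegral.integral_const_mul]
      exact intervalIntegral.norm_integral_le_of_norm_le hr.1 (ae_of_all _ fun _ _ => hdp _)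
        (hi _ _)
  · have := gronwall_integral (t0 := 0) (t1 := s - t0) (φ := fun r => ‖p (s - r)‖) (a := 0)
      (by fun_prop) (fun _ => norm_nonneg _) le_rfl hK (fun r hr => ?_) (s - t)
      ⟨by linarith, by linarith [ht.1]⟩
    · simpa using this
    · have h1 := eq_add_integral_of_integral_eq hd hp hs (t := s - r)
        ⟨by linarith [hr.2], by linarith [hr.1, hs.2]⟩
      have h2 := intervalIntegral.integral_comp_sub_left (a := 0) (b := r) (fun r => ‖p r‖) s
      rw [sub_zero] at h2
      rw [h1, h0, zero_add, zero_add, h2, ← intervalIntegral.integral_const_mul,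
        intervalIntegral.integral_symm, norm_neg]
      exact intervalIntegral.norm_integral_le_of_norm_le (by linarith [hr.1])
        (ae_of_all _ fun _ _ => hdp _) (hi _ _)

namespace SmoothFields

variable {X : Type} [NormedAddCommGroup X] [InnerProductSpace ℝ X] [FiniteDimensional ℝ X]
  [MeasurableSpace X] [BorelSpace X] (Φ : SmoothFields X) {t0 t1 : ℝ}

theorem norm_adjoint_le (i : ℕ) (t : ℝ) (x v : X) :
    ‖-(ContinuousLinearMap.adjoint (Φ.D i t x) v)‖ ≤ Φ.K * ‖v‖ := by
  rw [norm_neg]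
  refine (ContinuousLinearMap.le_opNorm _ _).trans (mul_le_mul_of_nonneg_right ?_ (norm_nonneg _))
  rw [LinearIsometryEquiv.norm_map]
  exact Φ.normD i t x

theorem measurable_adjoint {k : ℝ → ℕ} (hk : Measurable k) {z p : ℝ → X} (hz : Measurable z)
    (hp : Measurable p) :
    Measurable fun s => -(ContinuousLinearMap.adjoint (Φ.D (k s) s (z s)) (p s)) :=
  (measurable_superposition (H := fun s x => ContinuousLinearMap.adjoint (Φ.D (k s) s (z s)) x)
    (fun s => (ContinuousLinearMap.adjoint (Φ.D (k s) s (z s))).continuous)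
    (fun x => measurable_adjoint_apply (Φ.measurable_D hk hz) x) hp).neg

theorem intervalIntegrable_adjoint {k : ℝ → ℕ} (hk : Measurable k) {z p : ℝ → X}
    (hz : Measurable z) (hp : Continuous p) (a b : ℝ) :
    IntervalIntegrable (fun s => -(ContinuousLinearMap.adjoint (Φ.D (k s) s (z s)) (p s)))
      volume a b := by
  have hi : IntervalIntegrable (fun t => Φ.K * ‖p t‖) volume a b := by
    apply Continuous.intervalIntegrable; fun_prop
  exact hi.mono_fun (Φ.measurable_adjoint hk hz hp.measurable).aestronglyMeasurable
    (ae_of_all _ fun s => (Φ.norm_adjoint_le _ _ _ _).trans (le_abs_self _))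

/-- Stability of adjoint arcs with respect to the coefficients. -/
theorem tendsto_adjoint (h01 : t0 ≤ t1) {k : ℕ → ℝ → ℕ} (hk : ∀ j, Measurable (k j))
    {z p : ℕ → ℝ → X} (hz : ∀ j, Continuous (z j))
    (hp : ∀ j, Φ.Adjoint t0 t1 (k j) (z j) (p j)) {pl : ℝ → X}
    (hpl : Φ.Adjoint t0 t1 (fun _ => 0) (fun _ => 0) pl)
    (h0 : Tendsto (fun j => p j t0) atTop (𝓝 (pl t0)))
    (hk0 : ∀ᵐ t ∂volume.restrict (Icc t0 t1), ∀ᶠ j in atTop, k j t = 0)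
    (hz0 : ∀ t ∈ Icc t0 t1, Tendsto (fun j => z j t) atTop (𝓝 0)) :
    ∀ t ∈ Icc t0 t1, Tendsto (fun j => p j t) atTop (𝓝 (pl t)) := by
  let ad : (X →L[ℝ] X) → X →L[ℝ] X := fun B => ContinuousLinearMap.adjoint B
  have hadc : Continuous ad := (ContinuousLinearMap.adjoint (𝕜 := ℝ) (E := X) (F := X)).continuous
  let c : ℕ → ℝ → ℝ := fun j s => ‖-(ad (Φ.D (k j s) s (z j s)) (pl s)) - -(ad (Φ.D 0 s 0) (pl s))‖
  have hcm : ∀ j, Measurable (c j) := fun j =>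
    ((Φ.measurable_adjoint (hk j) (hz j).measurable hpl.1.measurable).sub
      (Φ.measurable_adjoint (k := fun _ => 0) (z := fun _ => 0) measurable_const measurable_const
        hpl.1.measurable)).norm
  have hcb : ∀ j s, c j s ≤ 2 * Φ.K * ‖pl s‖ := by
    intro j s
    have := norm_sub_le_of_le (Φ.norm_adjoint_le (k j s) s (z j s) (pl s))
      (Φ.norm_adjoint_le 0 s 0 (pl s))
    exact this.trans_eq (by ring)
  have hbi : IntervalIntegrable (fun s => 2 * Φ.K * ‖pl s‖) volume t0 t1 := by
    have := hpl.1
    apply Continuous.intervalIntegrable; fun_prop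
  have hci : ∀ j, IntervalIntegrable (c j) volume t0 t1 := fun j =>
    hbi.mono_fun (hcm j).aestronglyMeasurable (ae_of_all _ fun s => by
      change ‖c j s‖ ≤ _
      rw [Real.norm_of_nonneg (norm_nonneg _)]
      exact (hcb j s).trans (le_abs_self _))
  have hclim : Tendsto (fun j => ∫ s in t0..t1, c j s) atTop (𝓝 0) := by
    have : Tendsto (fun j => ∫ s in t0..t1, c j s) atTop (𝓝 (∫ s in t0..t1, (0 : ℝ))) := by
      refine intervalIntegral.tendsto_integral_filter_of_dominated_convergence
        (fun s => 2 * Φ.K * ‖pl s‖) (.of_forall fun j => (hcm j).aestronglyMeasurable)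
        (.of_forall fun j => ae_of_all _ fun s _ => ?_) hbi ?_
      · rw [Real.norm_of_nonneg (norm_nonneg _)]
        exact hcb j s
      · rw [ae_restrict_iff' measurableSet_Icc] at hk0
        filter_upwards [hk0] with s hs hsI
        rw [uIoc_of_le h01] at hsI
        have hsI' : s ∈ Icc t0 t1 := ⟨hsI.1.le, hsI.2⟩
        have h1 : Tendsto (fun j => ‖-(ad (Φ.D 0 s (z j s)) (pl s)) - -(ad (Φ.D 0 s 0) (pl s))‖)
            atTop (𝓝 0) := by
          have hcont : Continuous fun x => ‖-(ad (Φ.D 0 s x) (pl s)) - -(ad (Φ.D 0 s 0) (pl s))‖ :=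
            (((hadc.comp (Φ.contD 0 s)).clm_apply continuous_const).neg.sub continuous_const).norm
          simpa [Function.comp_def] using (hcont.tendsto 0).comp (hz0 s hsI')
        refine h1.congr' ?_
        filter_upwards [hs hsI'] with j hj
        simp only [c, hj]
    simpa using this
  have hgr : ∀ j, ∀ t ∈ Icc t0 t1, ‖p j t - pl t‖ ≤
      (‖p j t0 - pl t0‖ + ∫ s in t0..t1, c j s) * Real.exp (Φ.K * (t1 - t0)) := by
    intro j
    have hc0 : 0 ≤ ∫ s in t0..t1, c j s :=
      intervalIntegral.integral_nonneg h01 fun s _ => norm_nonneg _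
    refine gronwall_integral ((hp j).1.sub hpl.1).norm (fun _ => norm_nonneg _) (by positivity)
      Φ.K.coe_nonneg fun t ht => ?_
    have hd : IntervalIntegrable (fun s => Φ.K * ‖p j s - pl s‖) volume t0 t := by
      have := (hp j).1; have := hpl.1
      apply Continuous.intervalIntegrable; fun_prop
    have hcit : IntervalIntegrable (c j) volume t0 t :=
      (hci j).mono_set (by rw [uIcc_of_le h01, uIcc_of_le ht.1]; exact Icc_subset_Icc_right ht.2)
    have e : p j t - pl t = (p j t0 - pl t0) + ∫ s in t0..t,
        (-(ad (Φ.D (k j s) s (z j s)) (p j s)) - -(ad (Φ.D 0 s 0) (pl s))) := by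
      rw [intervalIntegral.integral_sub
        (Φ.intervalIntegrable_adjoint (hk j) (hz j).measurable (hp j).1 _ _)
        (Φ.intervalIntegrable_adjoint (k := fun _ => 0) (z := fun _ => 0) measurable_const
          measurable_const hpl.1 _ _), (hp j).2 t ht, hpl.2 t ht]
      abel
    have hb : ‖∫ s in t0..t, (-(ad (Φ.D (k j s) s (z j s)) (p j s)) - -(ad (Φ.D 0 s 0) (pl s)))‖ ≤
        ∫ s in t0..t, (c j s + Φ.K * ‖p j s - pl s‖) := by
      refine intervalIntegral.norm_integral_le_of_norm_le ht.1 (ae_of_all _ fun s _ => ?_)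
        (hcit.add hd)
      have h1 := Φ.norm_adjoint_le (k j s) s (z j s) (p j s - pl s)
      have h3 := norm_add_le (-(ad (Φ.D (k j s) s (z j s)) (pl s)) - -(ad (Φ.D 0 s 0) (pl s)))
        (-(ad (Φ.D (k j s) s (z j s)) (p j s - pl s)))
      have e2 : -(ad (Φ.D (k j s) s (z j s)) (pl s)) - -(ad (Φ.D 0 s 0) (pl s)) +
          -(ad (Φ.D (k j s) s (z j s)) (p j s - pl s)) =
          -(ad (Φ.D (k j s) s (z j s)) (p j s)) - -(ad (Φ.D 0 s 0) (pl s)) := by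
        rw [map_sub]; abel
      rw [e2] at h3
      exact h3.trans (add_le_add_right h1 _)
    rw [intervalIntegral.integral_add hcit hd, intervalIntegral.integral_const_mul] at hb
    have hmono : ∫ s in t0..t, c j s ≤ ∫ s in t0..t1, c j s :=
      intervalIntegral.integral_mono_interval le_rfl ht.1 ht.2
        (ae_of_all _ fun s => norm_nonneg _) (hci j)
    have h5 := norm_add_le (p j t0 - pl t0) (∫ s in t0..t,
      (-(ad (Φ.D (k j s) s (z j s)) (p j s)) - -(ad (Φ.D 0 s 0) (pl s))))
    rw [← e] at h5
    change ‖p j t - pl t‖ ≤ _ + Φ.K * ∫ s in t0..t, ‖p j s - pl s‖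
    linarith
  intro t ht
  rw [tendsto_iff_norm_sub_tendsto_zero] at h0 ⊢
  refine squeeze_zero (fun _ => norm_nonneg _) (fun j => hgr j t ht) ?_
  simpa using (h0.add hclim).mul_const (Real.exp (Φ.K * (t1 - t0)))

end SmoothFields

/-- Selections converging to `0` in `L¹` vanish eventually, almost everywhere, along a
subsequence. -/
theorem exists_subseq_eventually_zero {t0 t1 : ℝ} (h01 : t0 ≤ t1) {k : ℕ → ℝ → ℕ} {N : ℕ → ℕ}
    (hk : ∀ j, Measurable (k j)) (hkN : ∀ j t, k j t ≤ N j)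
    (h : Tendsto (fun j => ∫ t in t0..t1, SmoothFields.gap (k j) (fun _ => 0) t) atTop (𝓝 0)) :
    ∃ ns : ℕ → ℕ, StrictMono ns ∧
      ∀ᵐ t ∂volume.restrict (Icc t0 t1), ∀ᶠ j in atTop, k (ns j) t = 0 := by
  have hm : ∀ j, Measurable fun t => (k j t : ℝ) := fun j => measurable_from_top.comp (hk j)
  have hint : ∀ j, Integrable (fun t => (k j t : ℝ)) (volume.restrict (Icc t0 t1)) := fun j =>
    Integrable.of_bound (hm j).aestronglyMeasurable (N j) (ae_of_all _ fun t => by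
      simpa using hkN j t)
  have hnorm : Tendsto (fun j => eLpNorm ((fun t => (k j t : ℝ)) - fun _ => 0) 1
      (volume.restrict (Icc t0 t1))) atTop (𝓝 0) := by
    have h1 : ∀ j, eLpNorm ((fun t => (k j t : ℝ)) - fun _ => 0) 1
        (volume.restrict (Icc t0 t1)) =
        ENNReal.ofReal (∫ t in t0..t1, SmoothFields.gap (k j) (fun _ => 0) t) := by
      intro j
      rw [intervalIntegral.integral_of_le h01, ← integral_Icc_eq_integral_Ioc,
        eLpNorm_one_eq_lintegral_enorm,
        ← ofReal_integral_norm_eq_lintegral_enorm ((hint j).sub (integrable_const 0))]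
      congr 1
      refine integral_congr_ae (ae_of_all _ fun t => ?_)
      simp [SmoothFields.gap]
    simp only [h1]
    simpa using ENNReal.tendsto_ofReal h
  obtain ⟨ns, hns, hae⟩ := (tendstoInMeasure_of_tendsto_eLpNorm one_ne_zero
    (fun j => (hm j).aestronglyMeasurable) aestronglyMeasurable_const hnorm).exists_seq_tendsto_ae
  refine ⟨ns, hns, ?_⟩
  filter_upwards [hae] with t ht
  filter_upwards [ht.eventually (gt_mem_nhds one_pos)] with j hj
  exact_mod_cast Nat.lt_one_iff.1 (by exact_mod_cast hj)

namespace SmoothFields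

variable {X : Type} [NormedAddCommGroup X] [InnerProductSpace ℝ X] [FiniteDimensional ℝ X]
  [MeasurableSpace X] [BorelSpace X] (Φ : SmoothFields X) {t0 t1 : ℝ}

theorem exists_adjoint (h01 : t0 ≤ t1) (p₀ : X) :
    ∃ p, Φ.Adjoint t0 t1 (fun _ => 0) (fun _ => 0) p ∧ p t0 = p₀ := by
  obtain ⟨p, hpc, hp⟩ := exists_caratheodory_solution h01 (K := Φ.K) (M := 0)
    (H := fun t x => -(ContinuousLinearMap.adjoint (Φ.D 0 t 0) x))
    (fun t => LipschitzWith.of_dist_le_mul fun x y => by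
      rw [dist_eq_norm, dist_eq_norm, neg_sub_neg, ← map_sub, norm_sub_rev x y,
        ← norm_neg (ContinuousLinearMap.adjoint _ _)]
      exact Φ.norm_adjoint_le 0 t 0 (y - x))
    (fun x => (measurable_adjoint_apply (Φ.measD 0 0) x).neg) (fun t => by simp) p₀
  have h0 : p t0 = p₀ := by simpa using hp t0 (left_mem_Icc.2 h01)
  exact ⟨p, ⟨hpc, by rw [h0]; exact hp⟩, h0⟩

theorem Adjoint.smul {k : ℝ → ℕ} {z p : ℝ → X} (hp : Φ.Adjoint t0 t1 k z p) (c : ℝ) :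
    Φ.Adjoint t0 t1 k z (fun t => c • p t) := by
  refine ⟨hp.1.const_smul c, fun t ht => ?_⟩
  simp only [map_smul, ← smul_neg]
  rw [intervalIntegral.integral_smul, ← smul_add, ← hp.2 t ht]

theorem Adjoint.eq_zero {p : ℝ → X} (hp : Φ.Adjoint t0 t1 (fun _ => 0) (fun _ => 0) p) {s : ℝ}
    (hs : s ∈ Icc t0 t1) (h0 : p s = 0) {t : ℝ} (ht : t ∈ Icc t0 t1) : p t = 0 :=
  eq_zero_of_norm_deriv_le Φ.K.coe_nonneg hp.1
    (fun a b => Φ.intervalIntegrable_adjoint (k := fun _ => 0) (z := fun _ => 0) measurable_const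
      measurable_const hp.1 a b)
    (fun _ => Φ.norm_adjoint_le _ _ _ _) hp.2 hs h0 ht

/-- Multipliers, normalised by `‖q‖ ^ 2 + lam ^ 2 = 1`, for a trajectory which is minimal with
respect to every finite subfamily of the fields. -/
theorem exists_normalized_multipliers (h01 : t0 ≤ t1) (hF0 : ∀ t, Φ.F 0 t 0 = 0)
    {S : Set (PL2 X X)} (hS : IsClosed S) {e : PL2 X X} (he : e ∈ S) {f : PL2 X X → ℝ}
    (hf : LocallyLipschitz f) (hmin : ∀ n, ∃ ρ > 0, Φ.LocalMin t0 t1 f S e n ρ) :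
    ∃ (p : ℝ → X) (q ζ ν : PL2 X X) (lam : ℝ),
      Φ.Adjoint t0 t1 (fun _ => 0) (fun _ => 0) p ∧ p t0 = pl2fst q ∧ p t1 = -pl2snd q ∧
      0 ≤ lam ∧ ‖q‖ ^ 2 + lam ^ 2 = 1 ∧
      (∀ i, ∀ᵐ t ∂volume.restrict (Icc t0 t1), ⟪p t, Φ.F i t 0⟫ ≤ 0) ∧
      ζ ∈ limSubdiff f e ∧ ν ∈ limitingNC S e ∧ q = lam • ζ + ν := by
  obtain ⟨L, V, hV, hL⟩ := hf e
  obtain ⟨r, hr, hrV⟩ := Metric.nhds_basis_closedBall.mem_iff.1 hV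
  have hLr : ∀ x ∈ Metric.closedBall e r, ∀ y ∈ Metric.closedBall e r,
      |f x - f y| ≤ L * ‖x - y‖ := fun x hx y hy => by
    simpa [dist_eq_norm] using hL.dist_le_mul x (hrV hx) y (hrV hy)
  choose ρ hρ hρm using hmin
  let θ : ℕ → ℝ := fun n => 1 / ((n : ℝ) + 1)
  have hθ : Tendsto θ atTop (𝓝 0) := tendsto_one_div_add_atTop_nhds_zero_nat
  choose k z p q y' y'' ζ ν lam hk hz hp hlam hW hζ hν hsum using fun n =>
    Φ.exists_approx_multipliers h01 hF0 hS he L.coe_nonneg hr hLr (hρ n) (hρm n)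
      (Nat.one_div_pos_of_nat : 0 < θ n)
  have hq1 : ∀ n, ‖q n‖ ≤ 1 := fun n => by nlinarith [(hlam n).2, sq_nonneg (lam n)]
  have hl1 : ∀ n, |lam n| ≤ 1 := fun n => by
    rw [abs_of_nonneg (hlam n).1]; nlinarith [(hlam n).2, sq_nonneg ‖q n‖, (hlam n).1]
  have hbdd : ∀ n, (q n, lam n, ζ n) ∈ Metric.closedBall (0 : PL2 X X) 1 ×ˢ
      Metric.closedBall (0 : ℝ) 1 ×ˢ Metric.closedBall (0 : PL2 X X) (2 * L) := fun n => by
    simpa using ⟨hq1 n, hl1 n, (hζ n).2.2⟩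
  obtain ⟨⟨ql, laml, ζl⟩, -, ns, hns, hlim⟩ := ((isCompact_closedBall _ _).prod
    ((isCompact_closedBall _ _).prod (isCompact_closedBall _ _))).tendsto_subseq hbdd
  have hθns : Tendsto (fun j => θ (ns j)) atTop (𝓝 0) := hθ.comp hns.tendsto_atTop
  obtain ⟨ms, hms, hk0⟩ := exists_subseq_eventually_zero h01 (k := fun j => k (ns j)) (N := ns)
    (fun j => (hk _).1) (fun j => (hk _).2.1)
    (squeeze_zero (fun j => intervalIntegral.integral_nonneg h01 fun s _ => gap_nonneg _ _ _)
      (fun j => (hk _).2.2) hθns)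
  let σ : ℕ → ℕ := fun j => ns (ms j)
  have hθσ : Tendsto (fun j => θ (σ j)) atTop (𝓝 0) := hθns.comp hms.tendsto_atTop
  have hlimσ := hlim.comp hms.tendsto_atTop
  have hqσ : Tendsto (fun j => q (σ j)) atTop (𝓝 ql) :=
    (continuous_fst.tendsto _).comp hlimσ
  have hlσ : Tendsto (fun j => lam (σ j)) atTop (𝓝 laml) :=
    ((continuous_fst.comp continuous_snd).tendsto _).comp hlimσ
  have hζσ : Tendsto (fun j => ζ (σ j)) atTop (𝓝 ζl) :=
    ((continuous_snd.comp continuous_snd).tendsto _).comp hlimσ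
  have hνσ : Tendsto (fun j => ν (σ j)) atTop (𝓝 (ql - laml • ζl)) := by
    have h1 : Tendsto (fun j => -q (σ j) + lam (σ j) • ζ (σ j) + ν (σ j)) atTop (𝓝 0) :=
      squeeze_zero_norm (fun j => hsum (σ j)) hθσ
    have h2 := (h1.add hqσ).sub (hlσ.smul hζσ)
    rw [zero_add] at h2
    exact h2.congr fun j => by abel
  have hfst : Continuous (pl2fst : PL2 X X → X) := WithLp.continuous_fst 2 X X
  have hsnd : Continuous (pl2snd : PL2 X X → X) := WithLp.continuous_snd 2 X X
  obtain ⟨pl, hpl, hpl0⟩ := Φ.exists_adjoint h01 (pl2fst ql)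
  have hp0 : Tendsto (fun j => p (σ j) t0) atTop (𝓝 (pl t0)) := by
    rw [hpl0]
    have h1 : Tendsto (fun j => p (σ j) t0 - pl2fst (q (σ j))) atTop (𝓝 0) :=
      squeeze_zero_norm (fun j => (hp (σ j)).2.2) hθσ
    have h2 := h1.add ((hfst.tendsto _).comp hqσ)
    rw [zero_add] at h2
    exact h2.congr fun j => by simp
  have hz0 : ∀ t ∈ Icc t0 t1, Tendsto (fun j => z (σ j) t) atTop (𝓝 0) := fun t ht =>
    squeeze_zero_norm (fun j => (hz (σ j)).2 t ht) hθσ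
  have hpt := Φ.tendsto_adjoint h01 (k := fun j => k (σ j)) (z := fun j => z (σ j))
    (p := fun j => p (σ j)) (fun j => (hk _).1) (fun j => (hz _).1) (fun j => (hp _).1) hpl hp0
    hk0 hz0
  have hσ : Tendsto σ atTop atTop := hns.tendsto_atTop.comp hms.tendsto_atTop
  have hlimpt : ∀ y : ℕ → PL2 X X, (∀ j, ‖y j - e‖ ≤ θ j) →
      Tendsto (fun j => y (σ j)) atTop (𝓝 e) := fun y hy =>
    tendsto_iff_norm_sub_tendsto_zero.2
      (squeeze_zero (fun _ => norm_nonneg _) (fun j => hy (σ j)) hθσ)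
  refine ⟨pl, ql, ζl, ql - laml • ζl, laml, hpl, hpl0, ?_, ?_, ?_, ?_, ?_, ?_, by abel⟩
  · refine tendsto_nhds_unique (hpt t1 (right_mem_Icc.2 h01)) ?_
    exact (((hsnd.tendsto _).comp hqσ).neg).congr fun j => ((hp (σ j)).2.1).symm
  · exact ge_of_tendsto' hlσ fun j => (hlam _).1
  · refine tendsto_nhds_unique ((hqσ.norm.pow 2).add (hlσ.pow 2)) ?_
    exact tendsto_const_nhds.congr fun j => ((hlam (σ j)).2).symm
  · intro i
    have hall : ∀ᵐ t ∂volume.restrict (Icc t0 t1), ∀ j, i ≤ σ j →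
        ⟪p (σ j) t, Φ.F i t (z (σ j) t) - Φ.F (k (σ j) t) t (z (σ j) t)⟫ ≤ θ (σ j) :=
      ae_all_iff.2 fun j => by
        by_cases hij : i ≤ σ j
        · filter_upwards [hW (σ j) i hij] with t h _ using h
        · exact ae_of_all _ fun t h => absurd h hij
    filter_upwards [hall, hk0, ae_restrict_mem measurableSet_Icc] with t h hkt htI
    have hFc : ∀ l, Tendsto (fun j => Φ.F l t (z (σ j) t)) atTop (𝓝 (Φ.F l t 0)) := fun l =>
      ((Φ.lipschitz l t).continuous.tendsto 0).comp (hz0 t htI)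
    have hlimW : Tendsto (fun j => ⟪p (σ j) t, Φ.F i t (z (σ j) t) - Φ.F 0 t (z (σ j) t)⟫) atTop
        (𝓝 ⟪pl t, Φ.F i t 0 - Φ.F 0 t 0⟫) := (hpt t htI).inner ((hFc i).sub (hFc 0))
    rw [hF0, sub_zero] at hlimW
    refine le_of_tendsto_of_tendsto hlimW hθσ ?_
    filter_upwards [hkt, hσ.eventually_ge_atTop i] with j hj hij
    have := h j hij
    rwa [show k (σ j) t = 0 from hj] at this
  · exact ⟨fun j => y' (σ j), fun j => ζ (σ j), fun j => (hζ _).2.1, hlimpt y' fun j => (hζ j).1,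
      (hf.continuous.tendsto e).comp (hlimpt y' fun j => (hζ j).1), hζσ⟩
  · exact ⟨fun j => y'' (σ j), fun j => ν (σ j), fun j => (hν _).2, hlimpt y'' fun j => (hν j).1,
      hνσ⟩

/-- The maximum principle for a trajectory which is minimal with respect to every finite
subfamily of the fields. -/
theorem exists_multipliers (h01 : t0 ≤ t1) (hF0 : ∀ t, Φ.F 0 t 0 = 0)
    {S : Set (PL2 X X)} (hS : IsClosed S) {e : PL2 X X} (he : e ∈ S) {f : PL2 X X → ℝ}
    (hf : LocallyLipschitz f) (hmin : ∀ n, ∃ ρ > 0, Φ.LocalMin t0 t1 f S e n ρ) :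
    ∃ (p : ℝ → X) (lam : ℝ), lam ∈ ({0, 1} : Set ℝ) ∧
      Φ.Adjoint t0 t1 (fun _ => 0) (fun _ => 0) p ∧
      (∀ t ∈ Icc t0 t1, (lam, p t) ≠ 0) ∧
      (∃ a ∈ limSubdiff f e, ∃ b ∈ limitingNC S e, pl2 (p t0) (-(p t1)) = lam • a + b) ∧
      (∀ i, ∀ᵐ t ∂volume.restrict (Icc t0 t1), ⟪p t, Φ.F i t 0⟫ ≤ 0) ∧
      (S = univ → lam = 1) := by
  obtain ⟨p, q, ζ, ν, lam, hp, hp0, hp1, hlam, hone, hW, hζ, hν, hq⟩ :=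
    Φ.exists_normalized_multipliers h01 hF0 hS he hf hmin
  have hpq : pl2 (p t0) (-(p t1)) = q := by rw [hp0, hp1, neg_neg]; rfl
  rcases hlam.eq_or_lt with h0 | hpos
  · have hq1 : q ≠ 0 := by
      rintro rfl
      rw [← h0, norm_zero] at hone
      norm_num at hone
    refine ⟨p, 0, by simp, hp, fun t ht h => ?_, ⟨ζ, hζ, ν, hν, ?_⟩, hW, ?_⟩
    · have hpt : p t = 0 := congrArg Prod.snd h
      refine hq1 ?_
      rw [← hpq, hp.eq_zero Φ ht hpt (left_mem_Icc.2 h01),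
        hp.eq_zero Φ ht hpt (right_mem_Icc.2 h01), neg_zero]
      rfl
    · rw [hpq, hq, ← h0]
    · rintro rfl
      refine absurd ?_ hq1
      rw [hq, ← h0, zero_smul, zero_add, eq_zero_of_mem_limitingNC_univ hν]
  · refine ⟨fun t => lam⁻¹ • p t, 1, by simp, hp.smul Φ _, fun t ht h => ?_,
      ⟨ζ, hζ, lam⁻¹ • ν, smul_mem_limitingNC hν (inv_pos.2 hpos), ?_⟩, fun i => ?_, fun _ => rfl⟩
    · exact one_ne_zero (congrArg Prod.fst h)
    · rw [← smul_neg, show pl2 (lam⁻¹ • p t0) (lam⁻¹ • -p t1) = lam⁻¹ • pl2 (p t0) (-(p t1)) from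
        rfl, hpq, hq, smul_add, smul_smul, inv_mul_cancel₀ hpos.ne']
    · filter_upwards [hW i] with t h
      rw [inner_smul_left, RCLike.conj_to_real]
      exact mul_nonpos_of_nonneg_of_nonpos (inv_pos.2 hpos).le h

end SmoothFields

/-- At a local maximum over `S`, the gradient is a Fréchet normal. -/
theorem mem_frechetNC_of_isLocalMaxOn {Y : Type} [NormedAddCommGroup Y] [InnerProductSpace ℝ Y]
    {S : Set Y} {x v : Y} {φ : Y → ℝ} {φ' : Y →L[ℝ] ℝ} (hφ : HasFDerivAt φ φ' x)
    (hmax : IsLocalMaxOn φ S x) (hv : ∀ w, ⟪v, w⟫ = φ' w) : v ∈ frechetNC S x := by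
  intro η hη
  obtain ⟨δ, hδ, h⟩ := Metric.eventually_nhds_iff.1
    ((eventually_nhdsWithin_iff.1 hmax).and (hφ.isLittleO.def hη))
  refine ⟨δ, hδ, fun y hy hyx => ?_⟩
  obtain ⟨h1, h2⟩ := h (by rwa [dist_eq_norm])
  have h3 := (abs_le.1 h2).1
  rw [hv]
  linarith [h1 hy]

/-- A bounded smooth map with bounded derivative which agrees with the identity near `0`. -/
theorem exists_truncation (X : Type) [NormedAddCommGroup X] [InnerProductSpace ℝ X]
    [FiniteDimensional ℝ X] : ∃ (P : X → X) (C : ℝ), ContDiff ℝ 1 P ∧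
      (∀ z, ‖z‖ ≤ 1 → P z = z) ∧ (∀ z, ‖P z‖ ≤ C) ∧ ∀ z, ‖fderiv ℝ P z‖ ≤ C := by
  let χ : ContDiffBump (0 : X) := ⟨1, 2, one_pos, one_lt_two⟩
  have hP : ContDiff ℝ 1 fun z : X => χ z • z := χ.contDiff.smul contDiff_id
  have hc : HasCompactSupport fun z : X => χ z • z := χ.hasCompactSupport.smul_right
  obtain ⟨C₁, h₁⟩ := hc.exists_bound_of_continuous hP.continuous
  obtain ⟨C₂, h₂⟩ := (hc.fderiv (𝕜 := ℝ)).exists_bound_of_continuous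
    (hP.continuous_fderiv one_ne_zero)
  refine ⟨fun z => χ z • z, max C₁ C₂, hP, fun z hz => ?_, fun z => (h₁ z).trans (le_max_left _ _),
    fun z => (h₂ z).trans (le_max_right _ _)⟩
  change χ z • z = z
  rw [χ.one_of_mem_closedBall (by simpa using hz), one_smul]

section Inclusions

variable (X V : Type) [NormedAddCommGroup X] [InnerProductSpace ℝ X]
  [NormedAddCommGroup V] [InnerProductSpace ℝ V]

/-- The inclusion of the first factor. -/
def pl2inl : X →L[ℝ] PL2 X V :=
  ((WithLp.prodContinuousLinearEquiv 2 ℝ X V).symm : X × V →L[ℝ] PL2 X V).comp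
    (ContinuousLinearMap.inl ℝ X V)

/-- The inclusion of the second factor. -/
def pl2inr : V →L[ℝ] PL2 X V :=
  ((WithLp.prodContinuousLinearEquiv 2 ℝ X V).symm : X × V →L[ℝ] PL2 X V).comp
    (ContinuousLinearMap.inr ℝ X V)

variable {X V}

theorem pl2_eq_inl_add_inr (x : X) (u : V) : pl2 x u = pl2inl X V x + pl2inr X V u := by
  change pl2 x u = pl2 (x + 0) (0 + u)
  rw [add_zero, zero_add]

theorem hasFDerivAt_pl2_left (x : X) (u : V) :
    HasFDerivAt (fun x : X => (pl2 x u : PL2 X V)) (pl2inl X V) x := by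
  simp only [pl2_eq_inl_add_inr]
  exact (pl2inl X V).hasFDerivAt.add_const _

theorem hasFDerivAt_pl2_right (x : X) (u : V) :
    HasFDerivAt (fun u : V => (pl2 x u : PL2 X V)) (pl2inr X V) u := by
  simp only [pl2_eq_inl_add_inr]
  exact (pl2inr X V).hasFDerivAt.const_add _

end Inclusions

theorem continuous_of_hasStrictFDerivAt {Z Y : Type*} [NormedAddCommGroup Z] [NormedSpace ℝ Z]
    [NormedAddCommGroup Y] [NormedSpace ℝ Y] {g : Z → Y} {g' : Z → Z →L[ℝ] Y}
    (hg : ∀ z, HasStrictFDerivAt g (g' z) z) : Continuous g' := by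
  refine continuous_iff_continuousAt.2 fun z => Metric.tendsto_nhds.2 fun c hc => ?_
  lift c to ℝ≥0 using hc.le
  have hc2 : 0 < c / 2 := by have : 0 < c := hc; positivity
  obtain ⟨s, hs, hlin⟩ := (hg z).approximates_deriv_on_nhds (Or.inr hc2)
  filter_upwards [eventually_mem_nhds_iff.2 hs] with y hy
  have h1 := ((hg y).hasFDerivAt.sub (g' z).hasFDerivAt).le_of_lipschitzOn hy
    (ApproximatesLinearOn.approximatesLinearOn_iff_lipschitzOnWith.1 hlin)
  rw [dist_eq_norm]
  refine h1.trans_lt ?_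
  exact_mod_cast NNReal.half_lt_self (ne_of_gt hc)

section ControlFields

variable {X V : Type}
  [NormedAddCommGroup X] [InnerProductSpace ℝ X] [FiniteDimensional ℝ X]
  [MeasurableSpace X] [BorelSpace X]
  [NormedAddCommGroup V] [InnerProductSpace ℝ V] [FiniteDimensional ℝ V]
  [MeasurableSpace V] [BorelSpace V]

/-- The truncated fields `z ↦ h (x + P z, u i) - h (x, u) + w i`. -/
theorem exists_controlFields {h : X → V → X} {h' : X → V → X →L[ℝ] X}
    (hh : ∀ x u, HasFDerivAt (fun x => h x u) (h' x u) x)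
    (hc : Continuous fun q : X × V => h q.1 q.2) (hc' : Continuous fun q : X × V => h' q.1 q.2)
    {P : X → X} {C : ℝ} (hP : ContDiff ℝ 1 P) (hPC : ∀ z, ‖P z‖ ≤ C)
    (hPC' : ∀ z, ‖fderiv ℝ P z‖ ≤ C) {x : ℝ → X} (hx : Measurable x) (hxC : ∀ t, ‖x t‖ ≤ C)
    {u : ℝ → V} (hu : Measurable u) (huC : ∀ t, ‖u t‖ ≤ C)
    {ui : ℕ → ℝ → V} (hui : ∀ i, Measurable (ui i)) (huiC : ∀ i t, ‖ui i t‖ ≤ C)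
    {wi : ℕ → ℝ → X} (hwi : ∀ i, Measurable (wi i)) (hwiC : ∀ i t, ‖wi i t‖ ≤ C) :
    ∃ Φ : SmoothFields X,
      (∀ i t z, Φ.F i t z = h (x t + P z) (ui i t) - h (x t) (u t) + wi i t) ∧
      ∀ i t z, Φ.D i t z = (h' (x t + P z) (ui i t)).comp (fderiv ℝ P z) := by
  have hC : 0 ≤ C := (norm_nonneg _).trans (hPC 0)
  have hball : ∀ (a : X) (b : V), ‖a‖ ≤ C + C → ‖b‖ ≤ C →
      (a, b) ∈ Metric.closedBall (0 : X × V) (C + C) := fun a b ha hb => by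
    rw [mem_closedBall_zero_iff]
    exact max_le ha (hb.trans (by linarith))
  obtain ⟨C₁, h₁⟩ := (isCompact_closedBall (0 : X × V) (C + C)).exists_bound_of_continuousOn
    hc.continuousOn
  obtain ⟨C₂, h₂⟩ := (isCompact_closedBall (0 : X × V) (C + C)).exists_bound_of_continuousOn
    hc'.continuousOn
  have hxP : ∀ t z, ‖x t + P z‖ ≤ C + C := fun t z => norm_add_le_of_le (hxC t) (hPC z)
  have h0 : (0 : X × V) ∈ Metric.closedBall (0 : X × V) (C + C) := by simp; positivity
  have hC1 : 0 ≤ C₁ := (norm_nonneg _).trans (h₁ 0 h0)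
  have hC2 : 0 ≤ C₂ := (norm_nonneg _).trans (h₂ 0 h0)
  have hxx : ∀ t, ‖x t‖ ≤ C + C := fun t => (hxC t).trans (by linarith)
  have hPc := hP.continuous
  refine ⟨{
    F := fun i t z => h (x t + P z) (ui i t) - h (x t) (u t) + wi i t
    D := fun i t z => (h' (x t + P z) (ui i t)).comp (fderiv ℝ P z)
    K := ⟨max (C₁ + C₁ + C) (C₂ * C), le_max_of_le_left (by positivity)⟩
    measF := fun i z => ?_
    measD := fun i z => ?_
    hasFDerivAt := fun i t z => ?_
    contD := fun i t => ?_
    normF := fun i t z => ?_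
    normD := fun i t z => ?_ }, fun _ _ _ => rfl, fun _ _ _ => rfl⟩
  · exact ((hc.measurable.comp ((hx.add_const (P z)).prodMk (hui i))).sub
      (hc.measurable.comp (hx.prodMk hu))).add (hwi i)
  · have hcz : Continuous fun q : X × V => (h' (q.1 + P z) q.2).comp (fderiv ℝ P z) :=
      (hc'.comp (f := fun q : X × V => (q.1 + P z, q.2)) (by fun_prop)).clm_comp
        continuous_const
    exact hcz.measurable.comp (hx.prodMk (hui i))
  · have h1 : HasFDerivAt (fun z => x t + P z) (fderiv ℝ P z) z :=
      ((hP.differentiable one_ne_zero).differentiableAt.hasFDerivAt).const_add _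
    exact (((hh _ _).comp z h1).sub_const (h (x t) (u t))).add_const (wi i t)
  · exact (hc'.comp (f := fun z : X => (x t + P z, ui i t)) (by fun_prop)).clm_comp
      (hP.continuous_fderiv one_ne_zero)
  · refine le_trans ?_ (le_max_left _ _)
    exact norm_add_le_of_le (norm_sub_le_of_le (h₁ _ (hball _ _ (hxP t z) (huiC i t)))
      (h₁ _ (hball _ _ (hxx t) (huC t)))) (hwiC i t)
  · refine le_trans ?_ (le_max_right _ _)
    exact (ContinuousLinearMap.opNorm_comp_le _ _).trans
      (mul_le_mul (h₂ _ (hball _ _ (hxP t z) (huiC i t))) (hPC' z) (norm_nonneg _) hC2)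

end ControlFields

theorem isUnit_mul_transpose_of_rank_eq {m n : ℕ} {E : Matrix (Fin m) (Fin n) ℝ}
    (h : E.rank = m) : IsUnit (E * E.transpose) := by
  rw [← Matrix.mulVec_surjective_iff_isUnit]
  have h1 : (E * E.transpose).rank = m := by rw [Matrix.rank_self_mul_transpose, h]
  have h2 : LinearMap.range (E * E.transpose).mulVecLin = ⊤ :=
    Submodule.eq_top_of_finrank_eq (by rw [← Matrix.rank, h1]; simp)
  exact LinearMap.range_eq_top.1 h2

namespace ProblemPDAE

theorem mV_mV {k m n : ℕ} (A : Matrix (Fin k) (Fin m) ℝ) (B : Matrix (Fin m) (Fin n) ℝ)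
    (x : Euc n) : mV A (mV B x) = mV (A * B) x :=
  congrArg (WithLp.toLp 2) (Matrix.mulVec_mulVec x.ofLp A B)

theorem inner_mV {m n : ℕ} (A : Matrix (Fin m) (Fin n) ℝ) (x : Euc n) (y : Euc m) :
    ⟪mV A x, y⟫ = ⟪x, mV A.transpose y⟫ := by
  rw [EuclideanSpace.inner_eq_star_dotProduct, EuclideanSpace.inner_eq_star_dotProduct]
  change y.ofLp ⬝ᵥ A.mulVec x.ofLp = A.transpose.mulVec y.ofLp ⬝ᵥ x.ofLp
  rw [Matrix.dotProduct_mulVec, Matrix.mulVec_transpose]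

/-- A matrix of full row rank has an explicit right inverse `Eᵀ(EEᵀ)⁻¹`. -/
theorem exists_rightInverse {m n : ℕ} {E : Matrix (Fin m) (Fin n) ℝ} (h : E.rank = m) :
    ∃ (A : Euc n →L[ℝ] Euc m) (B : Euc m →L[ℝ] Euc n), (∀ x, A x = mV E x) ∧
      (∀ y, A (B y) = y) ∧ ∀ x y, ⟪x, B y⟫ = ⟪mV ((E * E.transpose)⁻¹ * E) x, y⟫ := by
  have hu := isUnit_mul_transpose_of_rank_eq h
  refine ⟨(Matrix.toLpLin 2 2 E).toContinuousLinearMap,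
    (Matrix.toLpLin 2 2 (E.transpose * (E * E.transpose)⁻¹)).toContinuousLinearMap,
    fun _ => rfl, fun y => ?_, fun x y => ?_⟩
  · change mV E (mV _ y) = y
    rw [mV_mV, ← Matrix.mul_assoc, Matrix.mul_nonsing_inv _ ((Matrix.isUnit_iff_isUnit_det _).1 hu)]
    simp [mV]
  · change ⟪x, mV _ y⟫ = _
    rw [inner_mV, Matrix.transpose_mul, Matrix.transpose_nonsing_inv, Matrix.transpose_mul,
      Matrix.transpose_transpose]

end ProblemPDAE

theorem exists_pos_small {K T ε δ η : ℝ} (hK : 0 ≤ K) (hT : 0 ≤ T) (hε : 0 < ε) (hδ : 0 < δ)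
    (hη : 0 < η) : ∃ ρ > 0, ρ ≤ 1 ∧ ρ ≤ ε ∧ K * ρ ≤ δ ∧ K * ρ ≤ η ∧ K * ρ * (T + 1) ≤ ε := by
  obtain ⟨b, hb, hb1, hbε, hbδ, hbη⟩ : ∃ b > 0, b ≤ 1 ∧ b ≤ ε ∧ b ≤ δ ∧ b ≤ η :=
    ⟨min (min 1 ε) (min δ η), by positivity, by simp, by simp, by simp, by simp⟩
  have hd : 1 ≤ (K + 1) * (T + 1) := by nlinarith
  have hρ : 0 < b / ((K + 1) * (T + 1)) := by positivity
  have e : (K + 1) * (b / ((K + 1) * (T + 1))) * (T + 1) = b := by field_simp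
  have hρb : b / ((K + 1) * (T + 1)) ≤ b := div_le_self hb.le hd
  set ρ := b / ((K + 1) * (T + 1))
  have h1 : K * ρ * (T + 1) ≤ b := by nlinarith
  have h2 : K * ρ ≤ b := by nlinarith [mul_nonneg (mul_nonneg hK hρ.le) hT]
  exact ⟨ρ, hρ, hρb.trans hb1, hρb.trans hbε, h2.trans hbδ, h2.trans hbη, h1.trans hbε⟩

section Needles

variable {X V : Type}
  [NormedAddCommGroup X] [InnerProductSpace ℝ X] [FiniteDimensional ℝ X]
  [MeasurableSpace X] [BorelSpace X]
  [NormedAddCommGroup V] [InnerProductSpace ℝ V] [FiniteDimensional ℝ V]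
  [MeasurableSpace V] [BorelSpace V]

theorem pl2_add_pl2 (a a' : V) (b b' : X) :
    (pl2 (a + a') (b + b') : PL2 V X) = pl2 a b + pl2 a' b' := rfl

/-- The change of velocity at the state `x + z` caused by replacing the control `u` by `q.1` and
adding the drift `q.2`. -/
def velocity (h : X → V → X) (x : X) (u : V) (z : X) (q : V × X) : X :=
  h (x + z) q.1 - h x u + q.2

/-- Minimality of the zero arc among the arcs driven by controls and drifts chosen pointwise
from `N`, within the radius `R`. -/
def NeedleMin (t0 t1 : ℝ) (h : X → V → X) (x : ℝ → X) (u : ℝ → V) (N : Set (V × X)) (ε : ℝ)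
    (R : ℝ → ℝ≥0∞) (S : Set (PL2 X X)) (f : PL2 X X → ℝ) (e : PL2 X X) : Prop :=
  ∀ (q : ℝ → V × X) (z : ℝ → X), Measurable q →
    IntervalIntegrable (fun t => velocity h (x t) (u t) (z t) (q t)) volume t0 t1 →
    (∀ t ∈ Icc t0 t1, z t = z t0 + ∫ s in t0..t, velocity h (x s) (u s) (z s) (q s)) →
    (∀ t, q t ∈ N ∨ q t = (u t, 0)) → (∀ t ∈ Icc t0 t1, ‖z t‖ ≤ ε) →
    (∀ᵐ t ∂volume.restrict (Icc t0 t1),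
      ENNReal.ofReal ‖pl2 ((q t).1 - u t) (velocity h (x t) (u t) (z t) (q t))‖ ≤ R t) →
    ∫ t in t0..t1, ‖velocity h (x t) (u t) (z t) (q t)‖ ≤ ε →
    e + pl2 (z t0) (z t1) ∈ S → f e ≤ f (e + pl2 (z t0) (z t1))

theorem velocity_self (h : X → V → X) (x : X) (u : V) : velocity h x u 0 (u, 0) = 0 := by
  simp [velocity]

theorem continuous_velocity {h : X → V → X} (hc : Continuous fun q : X × V => h q.1 q.2) :
    Continuous fun r : X × V × X × V × X => velocity h r.1 r.2.1 r.2.2.1 r.2.2.2 := by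
  unfold velocity
  refine ((hc.comp (f := fun r : X × V × X × V × X => (r.1 + r.2.2.1, r.2.2.2.1))
    (by fun_prop)).sub (hc.comp (f := fun r : X × V × X × V × X => (r.1, r.2.1))
    (by fun_prop))).add (by fun_prop)

theorem continuous_norm_pl2_velocity {h : X → V → X} (hc : Continuous fun q : X × V => h q.1 q.2) :
    Continuous fun r : (X × V) × V × X =>
      ‖pl2 (r.2.1 - r.1.2) (velocity h r.1.1 r.1.2 0 r.2)‖ := by
  have h1 := (continuous_velocity hc).comp (f := fun r : (X × V) × V × X =>
    (r.1.1, r.1.2, (0 : X), r.2)) (by fun_prop)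
  have h2 : Continuous fun r : (X × V) × V × X =>
      (r.2.1 - r.1.2, velocity h r.1.1 r.1.2 0 r.2) :=
    (by fun_prop : Continuous fun r : (X × V) × V × X => r.2.1 - r.1.2).prodMk h1
  exact continuous_norm.comp (continuous_pl2.comp h2)

/-- The times at which the needle `c` fits strictly into the radius `R`. -/
def needleTimes (h : X → V → X) (x : ℝ → X) (u : ℝ → V) (R : ℝ → ℝ≥0∞) (c : V × X) (η : ℝ) :
    Set ℝ :=
  {t | ENNReal.ofReal (‖pl2 (c.1 - u t) (velocity h (x t) (u t) 0 c)‖ + η) ≤ R t}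

theorem measurableSet_needleTimes {h : X → V → X} (hc : Continuous fun q : X × V => h q.1 q.2)
    {x : ℝ → X} (hx : Measurable x) {u : ℝ → V} (hu : Measurable u) {R : ℝ → ℝ≥0∞}
    (hR : Measurable R) (c : V × X) (η : ℝ) : MeasurableSet (needleTimes h x u R c η) :=
  measurableSet_le (((continuous_norm_pl2_velocity hc).measurable.comp
    ((hx.prodMk hu).prodMk measurable_const)).add_const η).ennreal_ofReal hR

open scoped Classical in
/-- The control and drift of the `i`-th needle; the `0`-th one is the reference. -/
def needle (h : X → V → X) (x : ℝ → X) (u : ℝ → V) (R : ℝ → ℝ≥0∞) (c : ℕ → V × X) (i : ℕ)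
    (t : ℝ) : V × X :=
  if i ≠ 0 ∧ t ∈ needleTimes h x u R (c i) (1 / ((i : ℝ) + 1)) then c i else (u t, 0)

theorem measurable_needle {h : X → V → X} (hc : Continuous fun q : X × V => h q.1 q.2)
    {x : ℝ → X} (hx : Measurable x) {u : ℝ → V} (hu : Measurable u) {R : ℝ → ℝ≥0∞}
    (hR : Measurable R) (c : ℕ → V × X) (i : ℕ) : Measurable (needle h x u R c i) :=
  Measurable.ite ((MeasurableSet.const _).inter
    (measurableSet_needleTimes hc hx hu hR (c i) _)) measurable_const
    (hu.prodMk measurable_const)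

theorem needle_zero (h : X → V → X) (x : ℝ → X) (u : ℝ → V) (R : ℝ → ℝ≥0∞) (c : ℕ → V × X)
    (t : ℝ) : needle h x u R c 0 t = (u t, 0) := by
  simp [needle]

theorem needle_mem (h : X → V → X) (x : ℝ → X) (u : ℝ → V) (R : ℝ → ℝ≥0∞) {c : ℕ → V × X}
    {N : Set (V × X)} (hcN : ∀ i, c i ∈ N) (i : ℕ) (t : ℝ) :
    needle h x u R c i t ∈ N ∨ needle h x u R c i t = (u t, 0) := by
  unfold needle
  split_ifs
  · exact Or.inl (hcN i)
  · exact Or.inr rfl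

/-- Minimality among needle variations gives minimality for every finite subfamily of the
associated fields. -/
theorem NeedleMin.localMin {t0 t1 : ℝ} (h01 : t0 ≤ t1) {h : X → V → X} {x : ℝ → X} {u : ℝ → V}
    {N : Set (V × X)} {ε δ : ℝ} (hε : 0 < ε) (hδ : 0 < δ) {R : ℝ → ℝ≥0∞}
    (hRδ : ∀ᵐ t ∂volume.restrict (Icc t0 t1), ENNReal.ofReal δ ≤ R t) {S : Set (PL2 X X)}
    {f : PL2 X X → ℝ} {e : PL2 X X} (hmin : NeedleMin t0 t1 h x u N ε R S f e)
    {c : ℕ → V × X} (hcN : ∀ i, c i ∈ N) (hq : ∀ i, Measurable (needle h x u R c i))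
    {P : X → X} (hP : ∀ z, ‖z‖ ≤ 1 → P z = z) {Φ : SmoothFields X}
    (hΦ : ∀ i t z, Φ.F i t z = velocity h (x t) (u t) (P z) (needle h x u R c i t)) (n : ℕ) :
    ∃ ρ > 0, Φ.LocalMin t0 t1 f S e n ρ := by
  obtain ⟨ρ, hρ, hρ1, hρε, hρδ, hρn, hρT⟩ := exists_pos_small Φ.K.coe_nonneg (sub_nonneg.2 h01) hε
    hδ (Nat.one_div_pos_of_nat : 0 < 1 / ((n : ℝ) + 1))
  have hP0 : P 0 = 0 := hP 0 (by simp)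
  refine ⟨ρ, hρ, fun k z hk hkn hz hzρ hgap hS => ?_⟩
  have hF : ∀ t ∈ Icc t0 t1, Φ.F (k t) t (z t) =
      velocity h (x t) (u t) (z t) (needle h x u R c (k t) t) := fun t ht => by
    rw [hΦ, hP _ ((hzρ t ht).trans hρ1)]
  have hFz : ∀ t ∈ Icc t0 t1, ‖Φ.F (k t) t (z t) - Φ.F (k t) t 0‖ ≤ Φ.K * ρ := fun t ht => by
    have := Φ.norm_sub_le (k t) t (z t) 0
    rw [sub_zero] at this
    exact this.trans (mul_le_mul_of_nonneg_left (hzρ t ht) Φ.K.coe_nonneg)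
  have hint := Φ.intervalIntegrable_F hk hz.1.measurable t0 t1
  refine hmin (fun t => needle h x u R c (k t) t) z (SmoothFields.measurable_select hq hk) ?_ ?_
    (fun t => needle_mem h x u R hcN _ _) (fun t ht => (hzρ t ht).trans hρε) ?_ ?_ hS
  · refine hint.congr fun t ht => hF t ?_
    rw [uIoc_of_le h01] at ht
    exact Ioc_subset_Icc_self ht
  · intro t ht
    rw [hz.2 t ht]
    congr 1
    refine intervalIntegral.integral_congr fun s hs => hF s ?_
    rw [uIcc_of_le ht.1] at hs
    exact ⟨hs.1, hs.2.trans ht.2⟩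
  · filter_upwards [hRδ, ae_restrict_mem measurableSet_Icc] with t hδt ht
    rw [← hF t ht]
    have h1 : ‖pl2 ((needle h x u R c (k t) t).1 - u t) (Φ.F (k t) t (z t))‖ ≤
        ‖pl2 ((needle h x u R c (k t) t).1 - u t) (Φ.F (k t) t 0)‖ + Φ.K * ρ := by
      have h2 : pl2 ((needle h x u R c (k t) t).1 - u t) (Φ.F (k t) t (z t)) =
          pl2 ((needle h x u R c (k t) t).1 - u t) (Φ.F (k t) t 0) +
          pl2 (0 : V) (Φ.F (k t) t (z t) - Φ.F (k t) t 0) := by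
        rw [← pl2_add_pl2, add_zero, add_sub_cancel]
      rw [h2]
      refine norm_add_le_of_le le_rfl ((norm_pl2_le _ _).trans ?_)
      rw [norm_zero, zero_add]
      exact hFz t ht
    refine (ENNReal.ofReal_le_ofReal h1).trans ?_
    rw [hΦ, hP0]
    by_cases hT : k t ≠ 0 ∧ t ∈ needleTimes h x u R (c (k t)) (1 / ((k t : ℝ) + 1))
    · rw [needle, if_pos hT]
      refine le_trans (ENNReal.ofReal_le_ofReal ?_) hT.2
      have h3 : 1 / ((n : ℝ) + 1) ≤ 1 / ((k t : ℝ) + 1) :=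
        Nat.one_div_le_one_div (hkn t)
      gcongr
      exact hρn.trans h3
    · rw [needle, if_neg hT, velocity_self, sub_self]
      refine le_trans (ENNReal.ofReal_le_ofReal ?_) hδt
      have h4 : ‖pl2 (0 : V) (0 : X)‖ = 0 := norm_zero (E := PL2 V X)
      rw [h4, zero_add]
      exact hρδ
  · have h1 : ∀ t ∈ Icc t0 t1, ‖velocity h (x t) (u t) (z t) (needle h x u R c (k t) t)‖ ≤
        Φ.K * ρ + Φ.K * SmoothFields.gap k (fun _ => 0) t := fun t ht => by
      rw [← hF t ht, ← sub_add_cancel (Φ.F (k t) t (z t)) (Φ.F (k t) t 0)]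
      refine norm_add_le_of_le (hFz t ht) ?_
      by_cases hk0 : k t = 0
      · rw [hk0, hΦ, hP0, needle_zero, velocity_self, norm_zero]
        exact mul_nonneg Φ.K.coe_nonneg (SmoothFields.gap_nonneg _ _ _)
      · exact (Φ.normF _ _ _).trans
          (le_mul_of_one_le_right Φ.K.coe_nonneg (SmoothFields.one_le_gap hk0))
    have hg := SmoothFields.intervalIntegrable_gap (l := fun _ => 0) hk measurable_const hkn
      (fun _ => Nat.zero_le n) t0 t1
    have h2 := intervalIntegral.integral_mono_on_of_le_Ioo h01 (hint.norm.congr fun t ht => ?_)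
      ((intervalIntegrable_const (c := Φ.K * ρ)).add (hg.const_mul (Φ.K : ℝ)))
      fun t ht => h1 t (Ioo_subset_Icc_self ht)
    · refine h2.trans ?_
      rw [intervalIntegral.integral_add intervalIntegrable_const (hg.const_mul _),
        intervalIntegral.integral_const, smul_eq_mul, intervalIntegral.integral_const_mul]
      have h3 := mul_le_mul_of_nonneg_left hgap Φ.K.coe_nonneg
      linarith
    · rw [uIoc_of_le h01] at ht
      exact congrArg norm (hF t (Ioc_subset_Icc_self ht))

end Needles

section MaximumPrinciple

variable {X V : Type}
  [NormedAddCommGroup X] [InnerProductSpace ℝ X] [FiniteDimensional ℝ X]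
  [MeasurableSpace X] [BorelSpace X]
  [NormedAddCommGroup V] [InnerProductSpace ℝ V] [FiniteDimensional ℝ V]
  [MeasurableSpace V] [BorelSpace V]

theorem norm_needle_le (h : X → V → X) (x : ℝ → X) {u : ℝ → V} (R : ℝ → ℝ≥0∞) {c : ℕ → V × X}
    {C : ℝ} (hu : ∀ t, ‖u t‖ ≤ C) (hc : ∀ i, ‖c i‖ ≤ C) (i : ℕ) (t : ℝ) :
    ‖needle h x u R c i t‖ ≤ C := by
  unfold needle
  split_ifs
  · exact hc i
  · exact max_le (hu t) (by simpa using (norm_nonneg _).trans (hu t))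

/-- If the Weierstrass inequality holds for all needles built from a dense sequence, it holds
everywhere strictly inside the radius. -/
theorem inner_velocity_nonpos {h : X → V → X} (hc : Continuous fun q : X × V => h q.1 q.2)
    {x : ℝ → X} {u : ℝ → V} {N : Set (V × X)} {R : ℝ → ℝ≥0∞} {a : ℕ → V × X}
    (ha : N ⊆ closure (range a)) {p : X} {t : ℝ}
    (hW : ∀ i, ⟪p, velocity h (x t) (u t) 0
      (needle h x u R (fun i => a (Nat.unpair i).1) i t)⟫ ≤ 0)
    {q : V × X} (hq : q ∈ N)
    (hqR : ENNReal.ofReal ‖pl2 (q.1 - u t) (velocity h (x t) (u t) 0 q)‖ < R t) :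
    ⟪p, velocity h (x t) (u t) 0 q⟫ ≤ 0 := by
  by_contra! hpos
  obtain ⟨s', hs', hsR⟩ := ENNReal.lt_iff_exists_nnreal_btwn.1 hqR
  rw [ENNReal.ofReal_lt_coe_iff (norm_nonneg _)] at hs'
  obtain ⟨s, hs, hss'⟩ := exists_between hs'
  have hv : Continuous fun q : V × X => velocity h (x t) (u t) 0 q :=
    (continuous_velocity hc).comp (f := fun q : V × X => (x t, u t, (0 : X), q)) (by fun_prop)
  have hn : Continuous fun q : V × X => ‖pl2 (q.1 - u t) (velocity h (x t) (u t) 0 q)‖ :=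
    (continuous_norm_pl2_velocity hc).comp (f := fun q : V × X => ((x t, u t), q)) (by fun_prop)
  have hi : Continuous fun q : V × X => ⟪p, velocity h (x t) (u t) 0 q⟫ :=
    continuous_const.inner hv
  have ho : IsOpen {q : V × X | ‖pl2 (q.1 - u t) (velocity h (x t) (u t) 0 q)‖ < s ∧
      0 < ⟪p, velocity h (x t) (u t) 0 q⟫} :=
    (isOpen_lt hn continuous_const).inter (isOpen_lt continuous_const hi)
  obtain ⟨_, ⟨hjs, hjp⟩, j, rfl⟩ := mem_closure_iff.1 (ha hq) _ ho ⟨hs, hpos⟩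
  obtain ⟨k, hk⟩ := exists_nat_one_div_lt (sub_pos.2 hss')
  have hki : k + 1 ≤ Nat.pair j (k + 1) := Nat.right_le_pair _ _
  have hη : 1 / ((Nat.pair j (k + 1) : ℕ) + 1 : ℝ) ≤ 1 / ((k : ℝ) + 1) :=
    Nat.one_div_le_one_div ((Nat.le_succ k).trans hki)
  have hW' := hW (Nat.pair j (k + 1))
  rw [needle, if_pos] at hW'
  · rw [Nat.unpair_pair] at hW'
    exact hW'.not_gt hjp
  · refine ⟨by omega, ?_⟩
    rw [needleTimes, mem_ofPred_eq, Nat.unpair_pair]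
    refine le_trans ?_ hsR.le
    rw [← ENNReal.ofReal_coe_nnreal]
    exact ENNReal.ofReal_le_ofReal (by linarith)

/-- The maximum principle for needle variations with drift. -/
theorem NeedleMin.exists_multipliers {t0 t1 : ℝ} (h01 : t0 ≤ t1) {h : X → V → X}
    {h' : X → V → X →L[ℝ] X} (hh : ∀ x u, HasFDerivAt (fun x => h x u) (h' x u) x)
    (hc : Continuous fun q : X × V => h q.1 q.2) (hc' : Continuous fun q : X × V => h' q.1 q.2)
    {x : ℝ → X} (hx : Measurable x) {C : ℝ} (hxC : ∀ t, ‖x t‖ ≤ C) {u : ℝ → V}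
    (hu : Measurable u) (huC : ∀ t, ‖u t‖ ≤ C) {N : Set (V × X)} (hN : N.Nonempty)
    (hNC : ∀ q ∈ N, ‖q‖ ≤ C) {R : ℝ → ℝ≥0∞} (hR : Measurable R) {ε δ : ℝ} (hε : 0 < ε)
    (hδ : 0 < δ) (hRδ : ∀ᵐ t ∂volume.restrict (Icc t0 t1), ENNReal.ofReal δ ≤ R t)
    {S : Set (PL2 X X)} (hS : IsClosed S) {e : PL2 X X} (he : e ∈ S) {f : PL2 X X → ℝ}
    (hf : LocallyLipschitz f) (hmin : NeedleMin t0 t1 h x u N ε R S f e) :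
    ∃ (p : ℝ → X) (lam : ℝ), lam ∈ ({0, 1} : Set ℝ) ∧ Continuous p ∧
      IntervalIntegrable (fun s => -(ContinuousLinearMap.adjoint (h' (x s) (u s)) (p s)))
        volume t0 t1 ∧
      (∀ t ∈ Icc t0 t1, p t = p t0 +
        ∫ s in t0..t, -(ContinuousLinearMap.adjoint (h' (x s) (u s)) (p s))) ∧
      (∀ t ∈ Icc t0 t1, (lam, p t) ≠ 0) ∧
      (∃ a ∈ limSubdiff f e, ∃ b ∈ limitingNC S e, pl2 (p t0) (-(p t1)) = lam • a + b) ∧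
      (∀ᵐ t ∂volume.restrict (Icc t0 t1), ∀ q ∈ N,
        ENNReal.ofReal ‖pl2 (q.1 - u t) (velocity h (x t) (u t) 0 q)‖ < R t →
        ⟪p t, velocity h (x t) (u t) 0 q⟫ ≤ 0) ∧
      (S = univ → lam = 1) := by
  obtain ⟨P, C', hP, hP1, hPC, hPC'⟩ := exists_truncation X
  have : Nonempty N := hN.to_subtype
  obtain ⟨a, haN, had⟩ : ∃ a : ℕ → V × X, (∀ j, a j ∈ N) ∧ N ⊆ closure (range a) := by
    refine ⟨fun j => TopologicalSpace.denseSeq N j, fun j => Subtype.coe_prop _, fun q hqN => ?_⟩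
    have h1 := image_closure_subset_closure_image continuous_subtype_val
      (mem_image_of_mem _ (TopologicalSpace.denseRange_denseSeq N ⟨q, hqN⟩))
    rwa [← range_comp] at h1
  let c : ℕ → V × X := fun i => a (Nat.unpair i).1
  have hcN : ∀ i, c i ∈ N := fun i => haN _
  have hq := measurable_needle hc hx hu hR c
  have hqC : ∀ i t, ‖needle h x u R c i t‖ ≤ max C C' := fun i t =>
    (norm_needle_le h x R huC (fun i => hNC _ (hcN i)) i t).trans (le_max_left _ _)
  obtain ⟨Φ, hΦF, hΦD⟩ := exists_controlFields hh hc hc' hP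
    (fun z => (hPC z).trans (le_max_right C C')) (fun z => (hPC' z).trans (le_max_right C C')) hx
    (fun t => (hxC t).trans (le_max_left C C')) hu (fun t => (huC t).trans (le_max_left C C'))
    (ui := fun i t => (needle h x u R c i t).1) (fun i => (hq i).fst)
    (fun i t => (norm_fst_le _).trans (hqC i t))
    (wi := fun i t => (needle h x u R c i t).2) (fun i => (hq i).snd)
    (fun i t => (norm_snd_le _).trans (hqC i t))
  have hP0 : P 0 = 0 := hP1 0 (by simp)
  have hPid : fderiv ℝ P 0 = ContinuousLinearMap.id ℝ X := by
    have h1 : P =ᶠ[𝓝 0] id := by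
      filter_upwards [Metric.ball_mem_nhds (0 : X) one_pos] with z hz
      exact hP1 z (mem_ball_zero_iff.1 hz).le
    rw [h1.fderiv_eq, fderiv_id]
  have hD : ∀ t, Φ.D 0 t 0 = h' (x t) (u t) := fun t => by
    rw [hΦD, hPid, hP0, add_zero, needle_zero, ContinuousLinearMap.comp_id]
  have hF : ∀ i t, Φ.F i t 0 = velocity h (x t) (u t) 0 (needle h x u R c i t) := fun i t => by
    rw [hΦF, hP0, velocity]
  obtain ⟨p, lam, hlam, ⟨hpc, hp⟩, hne, htr, hW, hone⟩ := Φ.exists_multipliers h01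
    (fun t => by rw [hF, needle_zero, velocity_self]) hS he hf
    (hmin.localMin h01 hε hδ hRδ hcN hq hP1 hΦF)
  have hint := Φ.intervalIntegrable_adjoint (k := fun _ => 0) (z := fun _ => 0) measurable_const
    measurable_const hpc t0 t1
  simp only [hD] at hp hint
  refine ⟨p, lam, hlam, hpc, hint, hp, hne, htr, ?_, hone⟩
  filter_upwards [ae_all_iff.2 hW] with t ht q hqN hqR
  exact inner_velocity_nonpos hc had (fun i => (hF i t) ▸ ht i) hqN hqR

end MaximumPrinciple

theorem continuous_comp_comp {W X Y Z Z' : Type*} [TopologicalSpace W]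
    [NormedAddCommGroup X] [NormedSpace ℝ X] [NormedAddCommGroup Y] [NormedSpace ℝ Y]
    [NormedAddCommGroup Z] [NormedSpace ℝ Z] [NormedAddCommGroup Z'] [NormedSpace ℝ Z']
    {G : W → Z →L[ℝ] Y} (hG : Continuous G) (B : Y →L[ℝ] Z') (i : X →L[ℝ] Z) :
    Continuous fun q => (B.comp (G q)).comp i :=
  (continuous_const.clm_comp hG).clm_comp continuous_const

section Pairs

variable {X V Y : Type} [NormedAddCommGroup X] [InnerProductSpace ℝ X]
  [NormedAddCommGroup V] [InnerProductSpace ℝ V] [NormedAddCommGroup Y] [InnerProductSpace ℝ Y]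
  {g : PL2 X V → Y} {g' : PL2 X V → PL2 X V →L[ℝ] Y}

theorem hasFDerivAt_comp_pl2_left (hg : ∀ z, HasStrictFDerivAt g (g' z) z) (B : Y →L[ℝ] X)
    (x : X) (u : V) :
    HasFDerivAt (fun x => B (g (pl2 x u))) ((B.comp (g' (pl2 x u))).comp (pl2inl X V)) x :=
  (B.hasFDerivAt.comp _ (hg _).hasFDerivAt).comp x (hasFDerivAt_pl2_left x u)

theorem continuous_comp_pl2 (hg : ∀ z, HasStrictFDerivAt g (g' z) z) (B : Y →L[ℝ] X) :
    Continuous fun q : X × V => B (g (pl2 q.1 q.2)) :=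
  B.continuous.comp
    ((continuous_iff_continuousAt.2 fun z => (hg z).continuousAt).comp continuous_pl2)

theorem continuous_deriv_comp_pl2 (hg : ∀ z, HasStrictFDerivAt g (g' z) z) {X' : Type}
    [NormedAddCommGroup X'] [InnerProductSpace ℝ X'] (B : Y →L[ℝ] X) (i : X' →L[ℝ] PL2 X V) :
    Continuous fun q : X × V => (B.comp (g' (pl2 q.1 q.2))).comp i :=
  continuous_comp_comp ((continuous_of_hasStrictFDerivAt hg).comp continuous_pl2) B i

theorem measurable_adjoint_deriv [FiniteDimensional ℝ X] [FiniteDimensional ℝ V]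
    [MeasurableSpace X] [BorelSpace X] [MeasurableSpace V] [BorelSpace V]
    (hg : ∀ z, HasStrictFDerivAt g (g' z) z) (B : Y →L[ℝ] X) {x p : ℝ → X} {u : ℝ → V}
    (hx : Measurable x) (hu : Measurable u) (hp : Measurable p) :
    Measurable fun t => ContinuousLinearMap.adjoint
      ((B.comp (g' (pl2 (x t) (u t)))).comp (pl2inr X V)) (p t) := by
  have hM : Continuous fun q : (X × V) × X =>
      ContinuousLinearMap.adjoint ((B.comp (g' (pl2 q.1.1 q.1.2))).comp (pl2inr X V)) q.2 :=
    (ContinuousLinearMap.adjoint.continuous.comp ((continuous_deriv_comp_pl2 hg B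
      (pl2inr X V)).comp (continuous_fst (X := X × V) (Y := X)))).clm_apply continuous_snd
  have h := hM.measurable.comp ((hx.prodMk hu).prodMk hp)
  simpa only [Function.comp_def] using h

theorem inner_pl2_adjoint [CompleteSpace X] [CompleteSpace V] (L : PL2 X V →L[ℝ] X) (p : X)
    (w : PL2 X V) :
    ⟪pl2 (ContinuousLinearMap.adjoint (L.comp (pl2inl X V)) p)
      (ContinuousLinearMap.adjoint (L.comp (pl2inr X V)) p), w⟫ = ⟪p, L w⟫ := by
  have hw : L w = L (pl2inl X V (pl2fst w)) + L (pl2inr X V (pl2snd w)) := by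
    rw [← map_add]
    exact congrArg L (pl2_eq_inl_add_inr (pl2fst w) (pl2snd w))
  rw [hw, inner_add_right, real_inner_comm, inner_pl2, real_inner_comm,
    real_inner_comm _ (pl2snd w)]
  exact congrArg₂ (· + ·) (ContinuousLinearMap.adjoint_inner_left _ _ _)
    (ContinuousLinearMap.adjoint_inner_left _ _ _)

end Pairs

theorem Arc.intervalIntegrable_d {n : ℕ} {t0 t1 : ℝ} (xs : Arc n t0 t1) {t : ℝ}
    (ht : t ∈ Icc t0 t1) : IntervalIntegrable xs.d volume t0 t :=
  xs.intble.mono_set (by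
    rw [uIcc_of_le ht.1, uIcc_of_le (ht.1.trans ht.2)]; exact Icc_subset_Icc_right ht.2)

theorem Arc.exists_extension {n : ℕ} {t0 t1 : ℝ} (h01 : t0 ≤ t1) (xs : Arc n t0 t1) :
    ∃ (x : ℝ → Euc n) (C : ℝ), Continuous x ∧ (∀ t ∈ Icc t0 t1, x t = xs.f t) ∧
      ∀ t, ‖x t‖ ≤ C := by
  have hc : ContinuousOn xs.f (Icc t0 t1) := by
    have h1 := intervalIntegral.continuousOn_primitive_interval' xs.intble left_mem_uIcc
    rw [uIcc_of_le h01] at h1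
    exact (continuousOn_const.add h1).congr xs.rel
  obtain ⟨C, hC⟩ := isCompact_Icc.exists_bound_of_continuousOn hc
  exact ⟨IccExtend h01 ((Icc t0 t1).domRestrict xs.f), C, hc.domRestrict.Icc_extend',
    fun t ht => IccExtend_of_mem _ _ ht, fun t => hC _ (Subtype.coe_prop _)⟩

namespace ProblemPDAE

variable {nx nu m : ℕ} {t0 t1 : ℝ}

theorem nnnorm_eq_ofReal {Y : Type*} [SeminormedAddCommGroup Y] (y : Y) :
    (‖y‖₊ : ℝ≥0∞) = ENNReal.ofReal ‖y‖ := by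
  rw [ofReal_norm, enorm_eq_nnnorm]

theorem exists_bound_of_isCompact_Cset {E : Matrix (Fin m) (Fin nx) ℝ}
    {g : PL2 (Euc nx) (Euc nu) → Euc m} {Uset : Set (Euc nu)} {ε : ℝ} {R : ℝ → ℝ≥0∞}
    {xs : Arc nx t0 t1} {us : ℝ → Euc nu} (hε : 0 ≤ ε)
    (hCcpt : IsCompact (Cset E g Uset ε R xs us)) :
    ∃ C, 0 ≤ C ∧ ∀ t ∈ Icc t0 t1, ∀ u ∈ Uset, ∀ v, mV E v = g (pl2 (xs.f t) u) →
      (‖pl2 (u - us t) (v - xs.d t)‖₊ : ℝ≥0∞) ≤ R t → ‖u‖ ≤ C ∧ ‖v‖ ≤ C := by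
  obtain ⟨C, hC⟩ := hCcpt.isBounded.exists_norm_le
  refine ⟨max C 0, le_max_right _ _, fun t ht u hu v hv hR => ?_⟩
  have h1 := hC (t, xs.f t, u, v) (subset_closure ⟨ht, hu, hv, by simpa using hε, hR⟩)
  have h2 : ‖((u, v) : Euc nu × Euc nx)‖ ≤ C :=
    (norm_snd_le (xs.f t, u, v)).trans ((norm_snd_le (t, xs.f t, u, v)).trans h1)
  exact ⟨((norm_fst_le (u, v)).trans h2).trans (le_max_left _ _),
    ((norm_snd_le (u, v)).trans h2).trans (le_max_left _ _)⟩

/-- A local minimum of radius `R` is minimal among the needle variations of its control whose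
drift lies in the kernel of `E`. -/
theorem IsLocalMinOfRadius.needleMin {E : Matrix (Fin m) (Fin nx) ℝ}
    {g : PL2 (Euc nx) (Euc nu) → Euc m} {f : PL2 (Euc nx) (Euc nx) → ℝ} {Uset : Set (Euc nu)}
    {S : Set (PL2 (Euc nx) (Euc nx))} {ε : ℝ} {R : ℝ → ℝ≥0∞} {xs : Arc nx t0 t1}
    {us : ℝ → Euc nu} (hmin : IsLocalMinOfRadius E g f Uset S ε R xs us)
    {A : Euc nx →L[ℝ] Euc m} {B : Euc m →L[ℝ] Euc nx} (hA : ∀ x, A x = mV E x)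
    (hAB : ∀ y, A (B y) = y) {x : ℝ → Euc nx} (hx : ∀ t ∈ Icc t0 t1, x t = xs.f t)
    {u : ℝ → Euc nu} (hu : ∀ᵐ t ∂volume.restrict (Icc t0 t1), u t = us t)
    {N : Set (Euc nu × Euc nx)} (hN : ∀ q ∈ N, q.1 ∈ Uset ∧ A q.2 = 0) :
    NeedleMin t0 t1 (fun x u => B (g (pl2 x u))) x u N ε R S f
      (pl2 (xs.f t0) (xs.f t1)) := by
  intro q z hq hint hz hqN hzε hqR hvε hS
  obtain ⟨⟨hus, hadm, hSs⟩, hmin⟩ := hmin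
  set w : ℝ → Euc nx := fun t => velocity (fun x u => B (g (pl2 x u))) (x t) (u t) (z t) (q t)
  let y : Arc nx t0 t1 :=
    { f := fun t => xs.f t + z t
      d := fun t => xs.d t + w t
      intble := xs.intble.add hint
      rel := fun t ht => by
        have hw : IntervalIntegrable w volume t0 t := hint.mono_set (by
          rw [uIcc_of_le ht.1, uIcc_of_le (ht.1.trans ht.2)]; exact Icc_subset_Icc_right ht.2)
        rw [intervalIntegral.integral_add (xs.intervalIntegrable_d ht) hw, xs.rel t ht, hz t ht]
        abel }
  refine hmin y (fun t => (q t).1) ⟨hq.fst, ?_, hS⟩ ?_ ?_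
  · filter_upwards [hadm, hu, ae_restrict_mem measurableSet_Icc] with t ht hut htI
    have hqt : (q t).1 ∈ Uset ∧ A (q t).2 = 0 := by
      rcases hqN t with h | h
      · exact hN _ h
      · rw [h, hut]
        exact ⟨ht.2, map_zero A⟩
    refine ⟨?_, hqt.1⟩
    change mV E (xs.d t + (B (g (pl2 (x t + z t) (q t).1)) - B (g (pl2 (x t) (u t))) + (q t).2)) = _
    rw [← hA, map_add, map_add, map_sub, hAB, hAB, hqt.2, hA, ht.1, hx t htI, hut]
    change _ = g (pl2 (xs.f t + z t) (q t).1)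
    abel
  · filter_upwards [hqR, hu, ae_restrict_mem measurableSet_Icc] with t ht hut htI
    refine ⟨?_, ?_⟩
    · change ‖xs.f t + z t - xs.f t‖ ≤ ε
      rw [add_sub_cancel_left]
      exact hzε t htI
    · change (‖pl2 ((q t).1 - us t) (xs.d t + w t - xs.d t)‖₊ : ℝ≥0∞) ≤ R t
      rw [add_sub_cancel_left, nnnorm_eq_ofReal, ← hut]
      exact ht
  · change ∫ t in t0..t1, ‖xs.d t + w t - xs.d t‖ ≤ ε
    simpa only [add_sub_cancel_left] using hvε

/-- The velocity of a pair `(u, v)` with `Ev = g(x, u)` is realised by a drift in the kernel. -/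
theorem velocity_eq_sub {E : Matrix (Fin m) (Fin nx) ℝ} {g : PL2 (Euc nx) (Euc nu) → Euc m}
    {A : Euc nx →L[ℝ] Euc m} {B : Euc m →L[ℝ] Euc nx} (hA : ∀ x, A x = mV E x)
    {x v d : Euc nx} {u us : Euc nu} (hv : mV E v = g (pl2 x u)) (hd : mV E d = g (pl2 x us)) :
    velocity (fun x u => B (g (pl2 x u))) x us 0 (u, v - d - B (A (v - d))) = v - d := by
  rw [velocity, map_sub, hA, hA, hv, hd, add_zero, map_sub]
  exact add_sub_cancel _ _

/-- The Weierstrass condition implies the maximum principle for the control in normal form. -/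
theorem adjoint_mem_frechetNC {E : Matrix (Fin m) (Fin nx) ℝ} {g : PL2 (Euc nx) (Euc nu) → Euc m}
    {g' : PL2 (Euc nx) (Euc nu) → PL2 (Euc nx) (Euc nu) →L[ℝ] Euc m}
    (hg : ∀ z, HasStrictFDerivAt g (g' z) z) {Uset : Set (Euc nu)}
    {A : Euc nx →L[ℝ] Euc m} {B : Euc m →L[ℝ] Euc nx} (hA : ∀ x, A x = mV E x)
    (hAB : ∀ y, A (B y) = y) {x d p : Euc nx} {us : Euc nu} (hd : mV E d = g (pl2 x us))
    {δ : ℝ} (hδ : 0 < δ) {r : ℝ≥0∞} (hr : ENNReal.ofReal δ ≤ r)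
    (hW : ∀ u ∈ Uset, ∀ v : Euc nx, mV E v = g (pl2 x u) →
      (‖pl2 (u - us) (v - d)‖₊ : ℝ≥0∞) < r → ⟪p, v - d⟫ ≤ 0) :
    ContinuousLinearMap.adjoint ((B.comp (g' (pl2 x us))).comp (pl2inr (Euc nx) (Euc nu))) p ∈
      frechetNC Uset us := by
  have hd1 : HasFDerivAt (fun u => B (g (pl2 x u)))
      ((B.comp (g' (pl2 x us))).comp (pl2inr (Euc nx) (Euc nu))) us :=
    (B.hasFDerivAt.comp _ (hg _).hasFDerivAt).comp us (hasFDerivAt_pl2_right x us)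
  have hc : ContinuousAt (fun u => ‖pl2 (u - us) (B (g (pl2 x u)) - B (g (pl2 x us)))‖) us :=
    (continuous_norm.comp continuous_pl2).continuousAt.comp
      (f := fun u => (u - us, B (g (pl2 x u)) - B (g (pl2 x us))))
      ((continuousAt_id.sub continuousAt_const).prodMk (hd1.continuousAt.sub continuousAt_const))
  have h0 : ‖pl2 (us - us) (B (g (pl2 x us)) - B (g (pl2 x us)))‖ < δ := by
    rw [sub_self, sub_self]
    exact (norm_zero (E := PL2 (Euc nu) (Euc nx))).trans_lt hδ
  refine mem_frechetNC_of_isLocalMaxOn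
    (φ := fun u => ⟪p, B (g (pl2 x u))⟫) (((innerSL ℝ p).hasFDerivAt).comp us hd1) ?_
    fun w => ContinuousLinearMap.adjoint_inner_left _ _ _
  filter_upwards [nhdsWithin_le_nhds (hc.eventually_lt_const h0), self_mem_nhdsWithin] with u hu huU
  have h1 := hW u huU (d + (B (g (pl2 x u)) - B (g (pl2 x us)))) (by
    rw [← hA, map_add, map_sub, hAB, hAB, hA, hd, add_sub_cancel])
  rw [add_sub_cancel_left, nnnorm_eq_ofReal, inner_sub_right] at h1
  have h2 := h1 (((ENNReal.ofReal_lt_ofReal_iff hδ).2 hu).trans_le hr)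
  linarith

end ProblemPDAE

namespace ProblemPDAE

/-- Necessary optimality conditions for (P'_DAE) when `E` has full
row rank (no further constraint qualification needed): nontriviality, transversality,
the explicit Euler adjoint equations with multiplier `(EEᵀ)⁻¹Ep(t)`, and the
Weierstrass condition; in the free end point case `λ₀` can be taken as `1`. -/
theorem necessary_optimality_PDAE_fullrank
    {nx nu m : ℕ} {t0 t1 : ℝ} (ht : t0 < t1)
    (E : Matrix (Fin m) (Fin nx) ℝ) (hrank : E.rank = m)
    (g : PL2 (Euc nx) (Euc nu) → Euc m)
    (g' : PL2 (Euc nx) (Euc nu) → (PL2 (Euc nx) (Euc nu) →L[ℝ] Euc m))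
    (hg : ∀ z, HasStrictFDerivAt g (g' z) z)
    (f : PL2 (Euc nx) (Euc nx) → ℝ) (hf : LocallyLipschitz f)
    (Uset : Set (Euc nu)) (S : Set (PL2 (Euc nx) (Euc nx)))
    (hU : IsClosed Uset) (hS : IsClosed S)
    (ε : ℝ) (hε : 0 < ε) (R : ℝ → ℝ≥0∞) (hR : Measurable R)
    (xs : Arc nx t0 t1) (us : ℝ → Euc nu)
    (hmin : IsLocalMinOfRadius E g f Uset S ε R xs us)
    (δ : ℝ) (hδ : 0 < δ)
    (hRδ : ∀ᵐ t ∂(volume.restrict (Set.Icc t0 t1)), ENNReal.ofReal δ ≤ R t)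
    (hCcpt : IsCompact (Cset E g Uset ε R xs us)) :
    ∃ (p : Arc nx t0 t1) (lam0 : ℝ) (μf : ℝ → Euc nu),
      lam0 ∈ ({0, 1} : Set ℝ) ∧ Measurable μf ∧
      -- nontriviality
      (∀ t ∈ Set.Icc t0 t1, (lam0, p.f t) ≠ 0) ∧
      -- transversality
      (∃ a ∈ limSubdiff f (pl2 (xs.f t0) (xs.f t1)),
        ∃ b ∈ limitingNC S (pl2 (xs.f t0) (xs.f t1)),
        pl2 (p.f t0) (-(p.f t1)) = lam0 • a + b) ∧
      -- Euler adjoint equations: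
      -- ṗ(t) = −∇ₓg(x_*,u_*)ᵀ(EEᵀ)⁻¹Ep(t), μ(t) = ∇ᵤg(x_*,u_*)ᵀ(EEᵀ)⁻¹Ep(t)
      (∀ᵐ t ∂(volume.restrict (Set.Icc t0 t1)),
        μf t ∈ clarkeNC Uset (us t) ∧
        ∀ w : PL2 (Euc nx) (Euc nu),
          ⟪pl2 (-(p.d t)) (μf t), w⟫ =
            ⟪mV ((E * E.transpose)⁻¹ * E) (p.f t),
              g' (pl2 (xs.f t) (us t)) w⟫) ∧
      -- Weierstrass condition of radius R(·)
      (∀ᵐ t ∂(volume.restrict (Set.Icc t0 t1)), ∀ u ∈ Uset, ∀ v : Euc nx,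
        mV E v = g (pl2 (xs.f t) u) →
        (‖pl2 (u - us t) (v - xs.d t)‖₊ : ℝ≥0∞) < R t →
        ⟪p.f t, v - xs.d t⟫ ≤ 0) ∧
      -- free end point
      (S = Set.univ → lam0 = 1) := by
  obtain ⟨A, B, hA, hAB, hE⟩ := exists_rightInverse hrank
  obtain ⟨x, C₁, hxc, hx, hxC⟩ := xs.exists_extension ht.le
  obtain ⟨C₂, hC₂, hbd⟩ := exists_bound_of_isCompact_Cset hε.le hCcpt
  obtain ⟨hus, hadm, hSs⟩ := hmin.1
  have hgood : ∀ᵐ t ∂volume.restrict (Icc t0 t1), t ∈ Icc t0 t1 ∧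
      mV E (xs.d t) = g (pl2 (xs.f t) (us t)) ∧ us t ∈ Uset ∧ ‖us t‖ ≤ C₂ ∧ ‖xs.d t‖ ≤ C₂ := by
    filter_upwards [hadm, ae_restrict_mem measurableSet_Icc] with t h1 h2
    refine ⟨h2, h1.1, h1.2, hbd t h2 _ h1.2 _ h1.1 ?_⟩
    rw [sub_self, sub_self, nnnorm_eq_ofReal]
    have h3 : ‖(pl2 0 0 : PL2 (Euc nu) (Euc nx))‖ = 0 := norm_zero (E := PL2 (Euc nu) (Euc nx))
    simp [h3]
  let u : ℝ → Euc nu := {t | ‖us t‖ ≤ C₂}.indicator us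
  have hu : Measurable u := hus.indicator (measurableSet_le hus.norm measurable_const)
  have huC : ∀ t, ‖u t‖ ≤ C₂ := fun t => by
    by_cases h : t ∈ {t | ‖us t‖ ≤ C₂}
    · rw [show u t = us t from indicator_of_mem h _]
      exact h
    · rw [show u t = 0 from indicator_of_notMem h _, norm_zero]
      exact hC₂
  have huus : ∀ᵐ t ∂volume.restrict (Icc t0 t1), u t = us t := by
    filter_upwards [hgood] with t h
    exact indicator_of_mem (s := {t | ‖us t‖ ≤ C₂}) h.2.2.2.1 _
  let T : Euc nx →L[ℝ] Euc nx := ContinuousLinearMap.id ℝ _ - B.comp A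
  let C : ℝ := max (max C₁ C₂) (‖T‖ * (C₂ + C₂))
  have hC₂C : C₂ ≤ C := (le_max_right _ _).trans (le_max_left _ _)
  let N : Set (Euc nu × Euc nx) := {q | (q.1 ∈ Uset ∧ A q.2 = 0) ∧ ‖q‖ ≤ C}
  have hN : N.Nonempty := by
    have : (ae (volume.restrict (Icc t0 t1))).NeBot := by
      rw [ae_neBot, Ne, Measure.restrict_eq_zero, Real.volume_Icc, ENNReal.ofReal_eq_zero, not_le]
      exact sub_pos.2 ht
    obtain ⟨t, h⟩ := hgood.exists
    exact ⟨(us t, 0), ⟨h.2.2.1, map_zero A⟩,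
      max_le (h.2.2.2.1.trans hC₂C) (by simpa using hC₂.trans hC₂C)⟩
  obtain ⟨p, lam, hlam, hpc, hpi, hp, hne, htr, hW, hone⟩ :=
    (hmin.needleMin hA hAB hx huus (N := N) fun q hq => hq.1).exists_multipliers ht.le
      (hasFDerivAt_comp_pl2_left hg B) (continuous_comp_pl2 hg B)
      (continuous_deriv_comp_pl2 hg B (pl2inl (Euc nx) (Euc nu))) hxc.measurable
      (fun t => (hxC t).trans ((le_max_left _ _).trans (le_max_left _ _))) hu
      (fun t => (huC t).trans hC₂C) hN (fun q hq => hq.2) hR hε hδ hRδ hS hSs hf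
  have hWs : ∀ᵐ t ∂volume.restrict (Icc t0 t1), ∀ a ∈ Uset, ∀ v : Euc nx,
      mV E v = g (pl2 (xs.f t) a) → (‖pl2 (a - us t) (v - xs.d t)‖₊ : ℝ≥0∞) < R t →
      ⟪p t, v - xs.d t⟫ ≤ 0 := by
    filter_upwards [hW, hgood, huus] with t hWt hgt hut a ha v hv hvR
    obtain ⟨htI, hd, husU, husC, hdC⟩ := hgt
    obtain ⟨haC, hvC⟩ := hbd t htI a ha v hv hvR.le
    have hTC : ‖v - xs.d t - B (A (v - xs.d t))‖ ≤ C :=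
      ((T.le_opNorm_of_le (norm_sub_le_of_le hvC hdC))).trans (le_max_right _ _)
    have hWq := hWt (a, v - xs.d t - B (A (v - xs.d t)))
      ⟨⟨ha, by rw [map_sub, hAB, sub_self]⟩, max_le (haC.trans hC₂C) hTC⟩
    rw [hx t htI, hut, velocity_eq_sub hA hv hd, ← nnnorm_eq_ofReal] at hWq
    exact hWq hvR
  refine ⟨⟨p, _, hpi, hp⟩, lam, _, hlam,
    measurable_adjoint_deriv hg B hxc.measurable hu hpc.measurable, hne, htr, ?_, hWs, hone⟩
  filter_upwards [hWs, hgood, huus, hRδ] with t hWt hgt hut hδt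
  obtain ⟨htI, hd, husU, -, -⟩ := hgt
  rw [hx t htI, hut]
  refine ⟨frechetNC_subset_clarkeNC husU (adjoint_mem_frechetNC hg hA hAB hd hδ hδt hWt),
    fun w => ?_⟩
  rw [neg_neg, inner_pl2_adjoint, ContinuousLinearMap.comp_apply, hE]

end ProblemPDAE

end
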